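/- arXiv:1101.1123 — 2 statements merged into one kernel-verified Lean document; each statement's English description precedes it below -/
import Mathlib

section
/- Let k be an algebraically closed field of characteristic 0 and let A be a finitely generated k-algebra that is a domain. Let V be a finite-dimensional k-subspace of A with 1 ∈ V that generates A as a k-algebra and suppose 2 ≤ limsup_{n→∞} log(dim_k V^n)/log n < 3. If A has a nonzero locally nilpotent k-derivation, then limsup_{n→∞} log(dim_k V^n)/log n = 2 (so A has GK dimension 2). -/
/-- `δ` is a `k`-derivation of the (possibly noncommutative) `k`-algebra `A`. -/
def IsDerivation {k A : Type*} [CommSemiring k] [Semiring A] [Algebra k A]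
    (δ : A →ₗ[k] A) : Prop :=
  ∀ a b : A, δ (a * b) = a * δ b + δ a * b

/-- `δ` is locally nilpotent. -/
def IsLocallyNilpotent {k A : Type*} [CommSemiring k] [Semiring A] [Algebra k A]
    (δ : A →ₗ[k] A) : Prop :=
  ∀ a : A, ∃ n : ℕ, (δ ^ n) a = 0

section Growth

open Filter

theorem exists_rpow_bound_of_limsup_lt_three (f : ℕ → ℕ)
    (hlow : 2 ≤ limsup (fun n : ℕ => Real.log (f n) / Real.log n) atTop)
    (hhigh : limsup (fun n : ℕ => Real.log (f n) / Real.log n) atTop < 3) :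
    ∃ a : ℝ, a < 3 ∧ ∀ᶠ n : ℕ in atTop, (f n : ℝ) ≤ (n : ℝ) ^ a := by
  have hbdd : IsBoundedUnder (· ≤ ·) atTop
      (fun n : ℕ => Real.log (f n) / Real.log n) := by
    by_contra h
    have h0 : {a : ℝ | ∀ᶠ n : ℕ in atTop, Real.log (f n) / Real.log n ≤ a} = ∅ := by
      ext a
      simp only [Set.mem_ofPred_eq, Set.mem_empty_iff_false, iff_false]
      exact fun ha => h ⟨a, by simpa using ha⟩
    rw [limsup_eq, h0, Real.sInf_empty] at hlow
    norm_num at hlow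
  obtain ⟨a, ha1, ha3⟩ := exists_between hhigh
  refine ⟨a, ha3, ?_⟩
  filter_upwards [eventually_lt_of_limsup_lt ha1 hbdd, eventually_ge_atTop 2] with n hn hn2
  have hn1 : (1 : ℝ) < n := by exact_mod_cast hn2
  rcases Nat.eq_zero_or_pos (f n) with h | h
  · rw [h]; simp; positivity
  · have hf : (0 : ℝ) < f n := by exact_mod_cast h
    rw [Real.le_rpow_iff_log_le hf (by linarith)]
    exact ((div_lt_iff₀ (Real.log_pos hn1)).1 hn).le

theorem not_forall_cube_le (f : ℕ → ℕ) {a : ℝ} (ha : a < 3)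
    (hf : ∀ᶠ n : ℕ in atTop, (f n : ℝ) ≤ (n : ℝ) ^ a) {C : ℕ} (hC : 0 < C) :
    ¬ ∀ n : ℕ, (n + 1) ^ 3 ≤ f (C * n) := by
  intro h
  have h1 : Tendsto (fun n : ℕ => C * n) atTop atTop :=
    tendsto_id.const_mul_atTop' hC
  have h2 : Tendsto (fun n : ℕ => (n : ℝ) ^ (3 - a)) atTop atTop :=
    (tendsto_rpow_atTop (by linarith)).comp tendsto_natCast_atTop_atTop
  obtain ⟨n, hn, hn1, hn2⟩ := ((h1.eventually hf).and
    ((eventually_ge_atTop 1).and (h2.eventually_gt_atTop ((C : ℝ) ^ a)))).exists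
  have hn0 : (0 : ℝ) < n := by exact_mod_cast hn1
  have h3 : ((n : ℝ)) ^ (3 : ℝ) ≤ (C : ℝ) ^ a * (n : ℝ) ^ a := by
    rw [← Real.mul_rpow (by positivity) hn0.le]
    refine le_trans ?_ (le_trans (by exact_mod_cast h n : ((n : ℝ) + 1) ^ 3 ≤ f (C * n)) ?_)
    · rw [show (3 : ℝ) = ((3 : ℕ) : ℝ) by norm_num, Real.rpow_natCast]
      gcongr; linarith
    · simpa using hn
  have h4 : (n : ℝ) ^ (3 : ℝ) = (n : ℝ) ^ (3 - a) * (n : ℝ) ^ a := by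
    rw [← Real.rpow_add hn0]; congr 1; ring
  rw [h4] at h3
  have := le_of_mul_le_mul_right h3 (by positivity)
  linarith

theorem not_forall_two_pow_le (f : ℕ → ℕ) {a : ℝ} (ha : a < 3)
    (hf : ∀ᶠ n : ℕ in atTop, (f n : ℝ) ≤ (n : ℝ) ^ a) {C : ℕ} (hC : 0 < C) :
    ¬ ∀ n : ℕ, 2 ^ n ≤ f (C * n ^ 2) := by
  intro h
  have h1 : Tendsto (fun n : ℕ => C * n ^ 2) atTop atTop :=
    (tendsto_pow_atTop two_ne_zero).const_mul_atTop' hC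
  have h2 : Tendsto (fun n : ℕ => (n : ℝ) ^ 6 / (2 : ℝ) ^ n) atTop (nhds 0) :=
    tendsto_pow_const_div_const_pow_of_one_lt 6 (by norm_num)
  have h3 : (0 : ℝ) < 1 / (C : ℝ) ^ 3 := by positivity
  obtain ⟨n, hn, hn1, hn2⟩ := ((h1.eventually hf).and
    ((eventually_ge_atTop 1).and (h2.eventually_lt_const h3))).exists
  have h4 : ((C * n ^ 2 : ℕ) : ℝ) ^ a ≤ ((C * n ^ 2 : ℕ) : ℝ) ^ (3 : ℝ) := by
    apply Real.rpow_le_rpow_of_exponent_le _ ha.le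
    exact_mod_cast Nat.mul_pos hC (by positivity)
  rw [show (3 : ℝ) = ((3 : ℕ) : ℝ) by norm_num, Real.rpow_natCast] at h4
  have h5 : (2 : ℝ) ^ n ≤ f (C * n ^ 2) := by exact_mod_cast h n
  have h6 : (2 : ℝ) ^ n ≤ (C : ℝ) ^ 3 * (n : ℝ) ^ 6 := by
    refine (h5.trans (hn.trans h4)).trans (le_of_eq ?_)
    push_cast; ring
  rw [div_lt_div_iff₀ (by positivity) (by positivity)] at hn2
  linarith

theorem limsup_log_div_log_le_two (f : ℕ → ℕ) (C : ℕ) (h : ∀ n, f n ≤ C * (n + 1) ^ 2) :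
    limsup (fun n : ℕ => Real.log (f n) / Real.log n) atTop ≤ 2 := by
  have hlim : Tendsto (fun n : ℕ => Real.log (4 * (C + 1)) / Real.log n + 2) atTop (nhds 2) := by
    have : Tendsto (fun n : ℕ => Real.log (4 * (C + 1)) / Real.log n) atTop (nhds 0) :=
      (Real.tendsto_log_atTop.comp tendsto_natCast_atTop_atTop).const_div_atTop _
    simpa using this.add_const 2
  rw [← hlim.limsup_eq]
  refine limsup_le_limsup ?_ ?_ hlim.isBoundedUnder_le
  · filter_upwards [eventually_ge_atTop 2] with n hn
    have hn1 : (1 : ℝ) < n := by exact_mod_cast hn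
    have hl := Real.log_pos hn1
    have hC1 : (1 : ℝ) ≤ 4 * (C + 1) := by
      have : (0 : ℝ) ≤ C := by positivity
      linarith
    rw [div_add' _ _ _ hl.ne', div_le_div_iff_of_pos_right hl]
    rcases Nat.eq_zero_or_pos (f n) with h0 | h0
    · rw [h0]
      have := Real.log_nonneg hC1
      simp only [Nat.cast_zero, Real.log_zero]
      positivity
    · rw [show (2 : ℝ) = ((2 : ℕ) : ℝ) by norm_num, ← Real.log_pow,
        ← Real.log_mul (by positivity) (by positivity)]
      apply Real.log_le_log (by exact_mod_cast h0)
      have h1 : (f n : ℝ) ≤ C * (n + 1) ^ 2 := by exact_mod_cast h n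
      refine h1.trans ?_
      have h2 : ((n : ℝ) + 1) ^ 2 ≤ (2 * n) ^ 2 := by gcongr; linarith
      have h3 : (0 : ℝ) ≤ C := by positivity
      nlinarith [mul_le_mul_of_nonneg_left h2 h3, sq_nonneg (n : ℝ)]
  · refine IsBoundedUnder.isCoboundedUnder_le ⟨0, ?_⟩
    simp only [eventually_map]
    filter_upwards with n
    exact div_nonneg (Real.log_natCast_nonneg _) (Real.log_natCast_nonneg _)

end Growth

namespace Submodule

variable {k A : Type*} [Field k] [Ring A] [Algebra k A]

instance finiteDimensional_mul (V W : Submodule k A) [FiniteDimensional k V]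
    [FiniteDimensional k W] : FiniteDimensional k ↥(V * W) :=
  Module.Finite.of_fg
    (FG.mul ((fg_iff_finiteDimensional V).2 ‹_›) ((fg_iff_finiteDimensional W).2 ‹_›))

instance finiteDimensional_pow (V : Submodule k A) [FiniteDimensional k V] (n : ℕ) :
    FiniteDimensional k ↥(V ^ n) :=
  Module.Finite.of_fg (FG.pow ((fg_iff_finiteDimensional V).2 ‹_›) n)

theorem pow_mono_of_one_mem {V : Submodule k A} (h1 : 1 ∈ V) {m n : ℕ} (h : m ≤ n) :
    V ^ m ≤ V ^ n :=
  pow_le_pow_right' (one_le.2 h1) h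

theorem one_mem_pow {V : Submodule k A} (h1 : 1 ∈ V) (n : ℕ) : 1 ∈ V ^ n :=
  one_le.1 (one_le_pow_of_one_le' (one_le.2 h1) n)

theorem pow_subset_adjoin (V : Submodule k A) (n : ℕ) :
    V ^ n ≤ Subalgebra.toSubmodule (Algebra.adjoin k (V : Set A)) := by
  induction n with
  | zero =>
    rw [pow_zero, one_le]
    exact one_mem (Algebra.adjoin k (V : Set A))
  | succ n ih =>
    rw [pow_succ, mul_le]
    exact fun a ha b hb => mul_mem (S := Subalgebra k A) (ih ha) (Algebra.subset_adjoin hb)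

theorem exists_mem_pow_of_mem_adjoin {V : Submodule k A} (h1 : 1 ∈ V) {a : A}
    (ha : a ∈ Algebra.adjoin k (V : Set A)) : ∃ n, a ∈ V ^ n := by
  induction ha using Algebra.adjoin_induction with
  | mem x hx => exact ⟨1, by simpa using hx⟩
  | algebraMap r => exact ⟨0, by rw [pow_zero]; exact algebraMap_mem r⟩
  | add x y _ _ hx hy =>
    obtain ⟨m, hm⟩ := hx
    obtain ⟨n, hn⟩ := hy
    exact ⟨max m n, add_mem (pow_mono_of_one_mem h1 (le_max_left _ _) hm)
      (pow_mono_of_one_mem h1 (le_max_right _ _) hn)⟩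
  | mul x y _ _ hx hy =>
    obtain ⟨m, hm⟩ := hx
    obtain ⟨n, hn⟩ := hy
    exact ⟨m + n, by rw [pow_add]; exact mul_mem_mul hm hn⟩

theorem exists_finset_subset_pow {V : Submodule k A} (h1 : 1 ∈ V) (s : Finset A)
    (hs : ∀ a ∈ s, a ∈ Algebra.adjoin k (V : Set A)) : ∃ n, ∀ a ∈ s, a ∈ V ^ n := by
  choose! f hf using fun a ha => exists_mem_pow_of_mem_adjoin h1 (hs a ha)
  exact ⟨s.sup f, fun a ha => pow_mono_of_one_mem h1 (Finset.le_sup ha) (hf a ha)⟩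

theorem exists_le_pow {V : Submodule k A} (h1 : 1 ∈ V) (U : Submodule k A)
    [FiniteDimensional k U] (hU : ∀ a ∈ U, a ∈ Algebra.adjoin k (V : Set A)) :
    ∃ n, U ≤ V ^ n := by
  obtain ⟨s, rfl⟩ := (fg_iff_finiteDimensional U).2 ‹_›
  obtain ⟨n, hn⟩ := exists_finset_subset_pow h1 s fun a ha => hU a (subset_span ha)
  exact ⟨n, span_le.2 hn⟩

theorem finrank_map_of_injective {M N : Type*} [AddCommGroup M] [Module k M] [AddCommGroup N]
    [Module k N] (f : M →ₗ[k] N) (hf : Function.Injective f) (U : Submodule k M) :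
    Module.finrank k (U.map f) = Module.finrank k U :=
  (LinearEquiv.finrank_eq (equivMapOfInjective f hf U)).symm

theorem finrank_sup_of_disjoint {M : Type*} [AddCommGroup M] [Module k M] (U W : Submodule k M)
    [FiniteDimensional k U] [FiniteDimensional k W] (h : Disjoint U W) :
    Module.finrank k ↥(U ⊔ W) = Module.finrank k U + Module.finrank k W := by
  rw [← finrank_sup_add_finrank_inf_eq, h.eq_bot, finrank_bot, add_zero]

theorem finrank_one [Nontrivial A] : Module.finrank k ↥(1 : Submodule k A) = 1 := by
  rw [one_eq_span]
  exact finrank_span_singleton one_ne_zero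

end Submodule

/-- Subexponential growth makes every subalgebra of a domain satisfy the left Ore condition. -/
theorem Subalgebra.exists_mul_eq_mul_of_growth {k A : Type*} [Field k] [Ring A] [IsDomain A]
    [Algebra k A] {V : Submodule k A} [FiniteDimensional k V] (hV1 : (1 : A) ∈ V)
    (hVgen : Algebra.adjoin k (V : Set A) = ⊤)
    (hexp : ∀ C : ℕ, 0 < C → ¬ ∀ n : ℕ, 2 ^ n ≤ Module.finrank k ↥(V ^ (C * n ^ 2)))
    (S : Subalgebra k A) {r s : A} (hr : r ∈ S) (hs : s ∈ S) (hr0 : r ≠ 0) (hs0 : s ≠ 0) :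
    ∃ p ∈ S, ∃ q ∈ S, p ≠ 0 ∧ p * r = q * s := by
  by_contra! h
  classical
  obtain ⟨c, hc⟩ := Submodule.exists_finset_subset_pow hV1 {r, s} fun a _ => by
    rw [hVgen]; trivial
  obtain ⟨U, hU0, hU⟩ : ∃ U : ℕ → Submodule k A, U 0 = 1 ∧ ∀ n, U (n + 1) =
      (U n).map (LinearMap.mulRight k r) ⊔ (U n).map (LinearMap.mulRight k s) :=
    ⟨fun n => Nat.rec 1 (fun _ U =>
      U.map (LinearMap.mulRight k r) ⊔ U.map (LinearMap.mulRight k s)) n, rfl, fun _ => rfl⟩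
  have hUS : ∀ n, ∀ u ∈ U n, u ∈ S := by
    intro n
    induction n with
    | zero =>
      intro u hu
      rw [hU0] at hu
      obtain ⟨a, rfl⟩ := Submodule.mem_one.1 hu
      exact S.algebraMap_mem a
    | succ n ih =>
      intro u hu
      rw [hU, Submodule.mem_sup] at hu
      obtain ⟨_, ⟨a, ha, rfl⟩, _, ⟨b, hb, rfl⟩, rfl⟩ := hu
      exact add_mem (mul_mem (ih a ha) hr) (mul_mem (ih b hb) hs)
  have hUV : ∀ n, U n ≤ V ^ (c * n) := by
    intro n
    induction n with
    | zero => rw [hU0, mul_zero, pow_zero]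
    | succ n ih =>
      rw [hU, mul_add, mul_one, pow_add]
      refine sup_le ?_ ?_ <;> rintro _ ⟨a, ha, rfl⟩ <;>
        exact Submodule.mul_mem_mul (ih ha) (hc _ (by simp))
  have hUfin : ∀ n : ℕ, FiniteDimensional k (U n : Submodule k A) := fun n =>
    Submodule.finiteDimensional_of_le (hUV n)
  have hUrank : ∀ n, Module.finrank k (U n) = 2 ^ n := by
    intro n
    induction n with
    | zero => rw [hU0, pow_zero, Submodule.finrank_one]
    | succ n ih =>
      rw [hU, Submodule.finrank_sup_of_disjoint,
        Submodule.finrank_map_of_injective _ (mul_left_injective₀ hr0),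
        Submodule.finrank_map_of_injective _ (mul_left_injective₀ hs0), ih]
      · ring
      · rw [Submodule.disjoint_def]
        rintro _ ⟨a, ha, rfl⟩ ⟨b, hb, hab⟩
        by_contra h0
        refine h a (hUS n a ha) b (hUS n b hb) ?_ hab.symm
        rintro rfl
        simp at h0
  refine hexp (c + 1) c.succ_pos fun n => ?_
  rw [← hUrank n]
  refine Submodule.finrank_mono ((hUV n).trans (Submodule.pow_mono_of_one_mem hV1 ?_))
  nlinarith [Nat.le_self_pow two_ne_zero n, Nat.zero_le c]

/-- A domain satisfying the left Ore condition embeds in a division algebra. -/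
theorem exists_divisionRing_embedding.{u} (k : Type*) (A : Type u) [Field k] [Ring A] [IsDomain A]
    [Algebra k A] (hore : ∀ r s : A, r ≠ 0 → s ≠ 0 → ∃ p q : A, p ≠ 0 ∧ p * r = q * s) :
    ∃ (Q : Type u) (_ : DivisionRing Q) (_ : Algebra k Q) (f : A →ₐ[k] Q),
      Function.Injective f := by
  obtain ⟨hO⟩ : Nonempty (OreLocalization.OreSet (nonZeroDivisors A)) := by
    rw [OreLocalization.nonempty_oreSet_iff_of_noZeroDivisors]
    intro r s
    rcases eq_or_ne r 0 with rfl | hr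
    · exact ⟨0, 1, by simp⟩
    · obtain ⟨p, q, hp, hpq⟩ := hore r s hr (nonZeroDivisors.coe_ne_zero s)
      exact ⟨q, ⟨p, mem_nonZeroDivisors_of_ne_zero hp⟩, hpq⟩
  let φ : A →+* OreLocalization (nonZeroDivisors A) A := OreLocalization.numeratorRingHom
  have hφ : Function.Injective φ :=
    OreLocalization.numeratorHom_inj fun x hx => hx.1
  exact ⟨OreLocalization (nonZeroDivisors A) A, inferInstance, inferInstance,
    { φ with commutes' := fun a => rfl }, hφ⟩

namespace IsDerivation

variable {k A : Type*} [Field k] [Ring A] [Algebra k A] {δ : A →ₗ[k] A}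

theorem map_one (h : IsDerivation δ) : δ 1 = 0 := by
  simpa using h 1 1

/-- The constants of a derivation form a subalgebra. -/
def constants (h : IsDerivation δ) : Subalgebra k A where
  carrier := {a | δ a = 0}
  mul_mem' {a b} ha hb := by
    change δ (a * b) = 0
    rw [h, show δ a = 0 from ha, show δ b = 0 from hb]
    simp
  add_mem' {a b} ha hb := by
    change δ (a + b) = 0
    rw [map_add, show δ a = 0 from ha, show δ b = 0 from hb, add_zero]
  algebraMap_mem' r := by
    change δ (algebraMap k A r) = 0
    rw [Algebra.algebraMap_eq_smul_one, map_smul, h.map_one, smul_zero]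

theorem mem_constants (h : IsDerivation δ) {a : A} : a ∈ h.constants ↔ δ a = 0 := Iff.rfl

theorem pow_const_mul (h : IsDerivation δ) {f : A} (hf : δ f = 0) (n : ℕ) (a : A) :
    (δ ^ n) (f * a) = f * (δ ^ n) a := by
  induction n with
  | zero => simp
  | succ n ih => rw [pow_succ', Module.End.mul_apply, ih, h, hf, zero_mul, add_zero]; rfl

theorem pow_mul_of_sq_eq_zero (h : IsDerivation δ) {z : A} (hz : δ (δ z) = 0) (n : ℕ) (a : A) :
    (δ ^ (n + 1)) (a * z) = (δ ^ (n + 1)) a * z + (n + 1) • ((δ ^ n) a * δ z) := by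
  induction n with
  | zero => simp [h a z, add_comm]
  | succ n ih =>
    rw [pow_succ' δ (n + 1), Module.End.mul_apply, ih, map_add, map_nsmul, h, h, hz, mul_zero,
      zero_add, Module.End.mul_apply, ← Module.End.mul_apply δ (δ ^ n), ← pow_succ',
      succ_nsmul _ (n + 1)]
    abel

theorem pow_apply_pow (h : IsDerivation δ) {z : A} (hz : δ (δ z) = 0) (n : ℕ) :
    (δ ^ n) (z ^ n) = n.factorial • δ z ^ n ∧ (δ ^ (n + 1)) (z ^ n) = 0 := by
  induction n with
  | zero => simp [h.map_one]
  | succ n ih =>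
    have h2 : (δ ^ (n + 1 + 1)) (z ^ n) = 0 := by
      rw [pow_succ', Module.End.mul_apply, ih.2, map_zero]
    constructor
    · rw [pow_succ z, h.pow_mul_of_sq_eq_zero hz, ih.1, ih.2, zero_mul, zero_add, smul_mul_assoc,
        ← pow_succ, smul_smul, Nat.factorial_succ]
    · rw [pow_succ z, h.pow_mul_of_sq_eq_zero hz, ih.2, h2]
      simp

theorem pow_apply_eq_zero_of_le {n m : ℕ} (hnm : n ≤ m) {a : A} (ha : (δ ^ n) a = 0) :
    (δ ^ m) a = 0 := by
  obtain ⟨d, rfl⟩ := Nat.exists_eq_add_of_le hnm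
  rw [add_comm, pow_add, Module.End.mul_apply, ha, map_zero]

theorem exists_slice (hln : IsLocallyNilpotent δ) (h0 : δ ≠ 0) :
    ∃ z : A, δ z ≠ 0 ∧ δ (δ z) = 0 := by
  obtain ⟨a, ha⟩ : ∃ a, δ a ≠ 0 := by
    by_contra! h
    exact h0 (LinearMap.ext h)
  classical
  have hex := hln (δ a)
  have hn := Nat.find_spec hex
  rcases hm : Nat.find hex with _ | m
  · rw [hm] at hn; exact absurd hn ha
  · have hmin := Nat.find_min hex (m := m) (by omega)
    have hc : ∀ x, (δ ^ m) (δ x) = δ ((δ ^ m) x) := fun x => by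
      rw [← Module.End.mul_apply, ← Module.End.mul_apply, ← pow_succ, ← pow_succ']
    rw [hm, pow_succ, Module.End.mul_apply, hc, hc] at hn
    exact ⟨(δ ^ m) a, by rwa [← hc], hn⟩

theorem nsmul_factorial_ne_zero {k A : Type*} [Field k] [CharZero k] [AddCommGroup A] [Module k A]
    (n : ℕ) {a : A} (ha : a ≠ 0) : n.factorial • a ≠ 0 := by
  rw [← Nat.cast_smul_eq_nsmul k]
  exact smul_ne_zero (by exact_mod_cast n.factorial_ne_zero) ha

variable [IsDomain A] [CharZero k]

/-- The powers of `z` are left independent over the constants. -/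
theorem mul_finrank_constants_le (h : IsDerivation δ) {z : A} (hz0 : δ z ≠ 0)
    (hz : δ (δ z) = 0) {F : Submodule k A} [FiniteDimensional k F]
    (hF : F ≤ Subalgebra.toSubmodule h.constants) {V : Submodule k A} [FiniteDimensional k V]
    (hV1 : 1 ∈ V) {c d : ℕ} (hzV : z ∈ V ^ c) (hFV : F ≤ V ^ d) (n : ℕ) :
    (n + 1) * Module.finrank k F ≤ Module.finrank k ↥(V ^ (d + c * n)) := by
  obtain ⟨U, hU0, hU⟩ : ∃ U : ℕ → Submodule k A, U 0 = F ∧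
      ∀ n, U (n + 1) = U n ⊔ F.map (LinearMap.mulRight k (z ^ (n + 1))) :=
    ⟨fun n => Nat.rec F (fun n U => U ⊔ F.map (LinearMap.mulRight k (z ^ (n + 1)))) n,
      rfl, fun _ => rfl⟩
  have hUV : ∀ n, U n ≤ V ^ (d + c * n) := by
    intro n
    induction n with
    | zero => rwa [hU0, mul_zero, add_zero]
    | succ n ih =>
      rw [hU]
      refine sup_le (ih.trans (Submodule.pow_mono_of_one_mem hV1 (by gcongr; omega))) ?_
      rintro _ ⟨a, ha, rfl⟩
      rw [pow_add, pow_mul]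
      exact Submodule.mul_mem_mul (hFV ha) (Submodule.pow_mem_pow _ hzV _)
  have hUfin : ∀ n : ℕ, FiniteDimensional k (U n : Submodule k A) := fun n =>
    Submodule.finiteDimensional_of_le (hUV n)
  have hz0' : z ≠ 0 := by rintro rfl; simp at hz0
  have hUδ : ∀ n, ∀ u ∈ U n, (δ ^ (n + 1)) u = 0 := by
    intro n
    induction n with
    | zero => exact fun u hu => by simpa using h.mem_constants.1 (hF (hU0 ▸ hu))
    | succ n ih =>
      intro u hu
      rw [hU, Submodule.mem_sup] at hu
      obtain ⟨a, ha, _, ⟨b, hb, rfl⟩, rfl⟩ := hu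
      rw [map_add, pow_apply_eq_zero_of_le (Nat.le_succ _) (ih a ha), zero_add,
        LinearMap.mulRight_apply, h.pow_const_mul (hF hb), (h.pow_apply_pow hz _).2, mul_zero]
  have hrank : ∀ n, Module.finrank k ↥(U n) = (n + 1) * Module.finrank k F := by
    intro n
    induction n with
    | zero => rw [hU0, zero_add, one_mul]
    | succ n ih =>
      rw [hU, Submodule.finrank_sup_of_disjoint, ih,
        Submodule.finrank_map_of_injective _ (mul_left_injective₀ (pow_ne_zero _ hz0'))]
      · ring
      · rw [Submodule.disjoint_def]
        rintro _ ha ⟨b, hb, rfl⟩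
        have h1 := hUδ n _ ha
        rw [LinearMap.mulRight_apply, h.pow_const_mul (hF hb), (h.pow_apply_pow hz _).1,
          mul_eq_zero] at h1
        rcases h1 with h1 | h1
        · simp [h1]
        · exact absurd h1 (nsmul_factorial_ne_zero (k := k) _ (pow_ne_zero _ hz0))
  rw [← hrank n]
  exact Submodule.finrank_mono (hUV n)

end IsDerivation

namespace Subfield

variable {Q : Type*} [DivisionRing Q]

/-- An inner derivation preserves a skew subfield as soon as it sends generators into it. -/
theorem commutator_mem_closure {s : Set Q} {t : Q}
    (h : ∀ x ∈ s, t * x - x * t ∈ closure s) {x : Q} (hx : x ∈ closure s) :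
    t * x - x * t ∈ closure s := by
  induction hx using closure_induction with
  | mem x hx => exact h x hx
  | one => simp
  | add x y _ _ hx hy =>
    rw [show t * (x + y) - (x + y) * t = (t * x - x * t) + (t * y - y * t) by noncomm_ring]
    exact add_mem hx hy
  | neg x _ hx =>
    rw [show t * -x - -x * t = -(t * x - x * t) by noncomm_ring]
    exact neg_mem hx
  | inv x hx hx' =>
    rcases eq_or_ne x 0 with rfl | h0
    · simp
    rw [show t * x⁻¹ - x⁻¹ * t = -(x⁻¹ * (t * x - x * t) * x⁻¹) by
      simp only [mul_sub, sub_mul, mul_assoc, mul_inv_cancel₀ h0, mul_one,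
        inv_mul_cancel_left₀ h0, neg_sub]]
    exact neg_mem (mul_mem (mul_mem (inv_mem hx) hx') (inv_mem hx))
  | mul x y hx' hy' hx hy =>
    rw [show t * (x * y) - x * y * t = (t * x - x * t) * y + x * (t * y - y * t) by noncomm_ring]
    exact add_mem (mul_mem hx hy') (mul_mem hx' hy)

theorem mul_mem_span_pow {D : Subfield Q} {t : Q} {d x : Q} (hd : d ∈ D)
    (hx : x ∈ Submodule.span D (Set.range (t ^ · : ℕ → Q))) :
    d * x ∈ Submodule.span D (Set.range (t ^ · : ℕ → Q)) :=
  Submodule.smul_mem _ (⟨d, hd⟩ : D) hx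

theorem mul_mem_span_pow_self {D : Subfield Q} {t : Q} (hD : ∀ d ∈ D, t * d - d * t ∈ D) {x : Q}
    (hx : x ∈ Submodule.span D (Set.range (t ^ · : ℕ → Q))) :
    t * x ∈ Submodule.span D (Set.range (t ^ · : ℕ → Q)) := by
  induction hx using Submodule.span_induction with
  | mem x hx =>
    obtain ⟨n, rfl⟩ := hx
    exact Submodule.subset_span ⟨n + 1, pow_succ' t n⟩
  | zero => simp
  | add x y _ _ hx hy => rw [mul_add]; exact add_mem hx hy
  | smul d x hx hx' =>
    rw [show t * (d • x) = d * (t * x) + (t * d - d * t) * x by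
      rw [Subfield.smul_def, smul_eq_mul]; noncomm_ring]
    exact add_mem (mul_mem_span_pow d.2 hx') (mul_mem_span_pow (hD d d.2) hx)

end Subfield

namespace IsDerivation

variable {k A : Type*} [Field k] [CharZero k] [Ring A] [IsDomain A] [Algebra k A] {δ : A →ₗ[k] A}
  {Q : Type*} [DivisionRing Q] [Algebra k Q] {ι : A →ₐ[k] Q}

/-- Elements killed by a power of a derivation with slice `z` are skew polynomials in
`(δ z)⁻¹ z` over a skew field generated by constants. -/
theorem exists_finset_mem_span_pow (h : IsDerivation δ) {z : A} (hz0 : δ z ≠ 0)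
    (hz : δ (δ z) = 0) (hι : Function.Injective ι)
    (hore : ∀ r ∈ h.constants, ∀ s ∈ h.constants, r ≠ 0 → s ≠ 0 →
      ∃ p ∈ h.constants, ∃ q ∈ h.constants, p ≠ 0 ∧ p * r = q * s) (n : ℕ) :
    ∀ a, (δ ^ n) a = 0 → ∃ F : Finset A, (∀ f ∈ F, δ f = 0) ∧ ∀ D : Subfield Q,
      (∀ f ∈ F, ι f ∈ D) → ι (δ z) ∈ D →
      (∀ d ∈ D, (ι (δ z))⁻¹ * ι z * d - d * ((ι (δ z))⁻¹ * ι z) ∈ D) →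
      ι a ∈ Submodule.span D (Set.range (((ι (δ z))⁻¹ * ι z) ^ · : ℕ → Q)) := by
  classical
  induction n with
  | zero =>
    intro a ha
    obtain rfl : a = 0 := by simpa using ha
    exact ⟨∅, by simp, fun D _ _ _ => by simp⟩
  | succ n ih =>
    intro a ha
    rcases eq_or_ne ((δ ^ n) a) 0 with he | he
    · exact ih a he
    have hw : ∀ m, δ z ^ m ∈ h.constants := fun m => pow_mem (h.mem_constants.2 hz) m
    obtain ⟨p, hp, q, hq, hp0, hpq⟩ := hore ((δ ^ n) a)
      (by rwa [pow_succ', Module.End.mul_apply] at ha) (n.factorial • δ z ^ n)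
      (nsmul_mem (hw n) _) he (nsmul_factorial_ne_zero (k := k) n (pow_ne_zero n hz0))
    obtain ⟨F, hF, hFD⟩ := ih (p * a - q * z ^ n) (by
      rw [map_sub, h.pow_const_mul hp, h.pow_const_mul hq, (h.pow_apply_pow hz n).1, hpq, sub_self])
    refine ⟨insert p (insert q F), ?_, fun D hD hwD hDt => ?_⟩
    · simpa only [Finset.forall_mem_insert] using ⟨hp, hq, hF⟩
    simp only [Finset.forall_mem_insert] at hD
    have hzt : ι z = ι (δ z) * ((ι (δ z))⁻¹ * ι z) := by
      rw [mul_inv_cancel_left₀ ((map_ne_zero_iff ι hι).2 hz0)]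
    have hzn : ∀ m, ι z ^ m ∈
        Submodule.span D (Set.range (((ι (δ z))⁻¹ * ι z) ^ · : ℕ → Q)) := by
      intro m
      induction m with
      | zero => exact Submodule.subset_span ⟨0, by simp⟩
      | succ m ihm =>
        rw [pow_succ', hzt, mul_assoc, ← hzt]
        exact Subfield.mul_mem_span_pow hwD (Subfield.mul_mem_span_pow_self hDt ihm)
    have ha' : ι a = (ι p)⁻¹ * (ι q * ι z ^ n + ι (p * a - q * z ^ n)) := by
      rw [map_sub, map_mul ι q, map_pow, add_sub_cancel, map_mul,
        inv_mul_cancel_left₀ ((map_ne_zero_iff ι hι).2 hp0)]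
    rw [ha']
    exact Subfield.mul_mem_span_pow (inv_mem hD.1) (add_mem
      (Subfield.mul_mem_span_pow hD.2.1 (hzn n)) (hFD D hD.2.2 hwD hDt))

end IsDerivation

/-- A commutator with `w⁻¹ z` lies in every skew field containing the polynomial expressions
`z f w - w f z` and `z w - w z`. -/
theorem Subfield.commutator_mem_of_mem {Q : Type*} [DivisionRing Q] {D : Subfield Q} {z w f : Q}
    (hw0 : w ≠ 0) (hw : w ∈ D) (hf : f ∈ D) (h : z * f * w - w * f * z ∈ D)
    (h1 : z * w - w * z ∈ D) : w⁻¹ * z * f - f * (w⁻¹ * z) ∈ D := by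
  have : w⁻¹ * z * f - f * (w⁻¹ * z) = w⁻¹ *
      ((z * f * w - w * f * z) - w * f * w⁻¹ * (z * w - w * z)) * w⁻¹ := by
    apply mul_left_cancel₀ hw0
    apply mul_right_cancel₀ hw0
    simp only [mul_assoc, mul_inv_cancel_left₀ hw0, inv_mul_cancel₀ hw0, mul_one, mul_sub, sub_mul,
      inv_mul_cancel_left₀ hw0]
    abel
  rw [this]
  exact mul_mem (mul_mem (inv_mem hw)
    (sub_mem h (mul_mem (mul_mem (mul_mem hw hf) (inv_mem hw)) h1))) (inv_mem hw)

namespace IsDerivation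

variable {k A : Type*} [Field k] [Ring A] [IsDomain A] [Algebra k A] {δ : A →ₗ[k] A}
  {Q : Type*} [DivisionRing Q] [Algebra k Q] {ι : A →ₐ[k] Q}

/-- Under subexponential growth, a finite set of constants enlarges to a finite set of constants
generating a skew field stable under the commutator with `(δ z)⁻¹ z`. -/
theorem exists_finset_stable (h : IsDerivation δ) {z : A} (hz0 : δ z ≠ 0) (hz : δ (δ z) = 0)
    (hι : Function.Injective ι) {V : Submodule k A} [FiniteDimensional k V] (hV1 : (1 : A) ∈ V)
    (hVgen : Algebra.adjoin k (V : Set A) = ⊤)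
    (hexp : ∀ C : ℕ, 0 < C → ¬ ∀ n : ℕ, 2 ^ n ≤ Module.finrank k ↥(V ^ (C * n ^ 2)))
    (G : Finset A) (hG : ∀ f ∈ G, δ f = 0) :
    ∃ G' : Finset A, G ⊆ G' ∧ (∀ f ∈ G', δ f = 0) ∧ δ z ∈ G' ∧
      ∀ d ∈ Subfield.closure (Set.range (algebraMap k Q) ∪ ι '' G'),
        (ι (δ z))⁻¹ * ι z * d - d * ((ι (δ z))⁻¹ * ι z) ∈
          Subfield.closure (Set.range (algebraMap k Q) ∪ ι '' G') := by
  classical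
  have hw0 : ι (δ z) ≠ 0 := (map_ne_zero_iff ι hι).2 hz0
  set η : A → A := fun f => z * f * δ z - δ z * f * z with hη
  obtain ⟨H, hH0, hH⟩ : ∃ H : ℕ → Finset A, H 0 = insert 1 (insert (δ z) G) ∧
      ∀ n, H (n + 1) = H n ∪ (H n).image η :=
    ⟨fun n => Nat.rec (insert 1 (insert (δ z) G)) (fun _ H => H ∪ H.image η) n, rfl, fun _ => rfl⟩
  have hHmono : Monotone H := monotone_nat_of_le_succ fun n => by
    rw [hH]; exact Finset.subset_union_left
  have hHδ : ∀ n, ∀ f ∈ H n, δ f = 0 := by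
    intro n
    induction n with
    | zero =>
      simpa only [hH0, Finset.forall_mem_insert] using ⟨h.map_one, hz, hG⟩
    | succ n ih =>
      intro f hf
      rw [hH, Finset.mem_union, Finset.mem_image] at hf
      obtain hf | ⟨f, hf, rfl⟩ := hf
      · exact ih f hf
      · simp only [hη, map_sub, h _ _, ih f hf, hz]
        simp
  let D : ℕ → Subfield Q := fun n =>
    Subfield.closure (Set.range (algebraMap k Q) ∪ ι '' (H n))
  have hDmono : Monotone D := fun m n hmn => Subfield.closure_mono
    (Set.union_subset_union_right _ (Set.image_mono (hHmono hmn)))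
  have hDk : ∀ n r, algebraMap k Q r ∈ D n := fun n r =>
    Subfield.subset_closure (Or.inl ⟨r, rfl⟩)
  have hDH : ∀ n, ∀ f ∈ H n, ι f ∈ D n := fun n f hf =>
    Subfield.subset_closure (Or.inr ⟨f, hf, rfl⟩)
  have hwH : ∀ n, δ z ∈ H n := fun n => hHmono n.zero_le (by simp [hH0])
  have h1H : ∀ n, 1 ∈ H n := fun n => hHmono n.zero_le (by simp [hH0])
  by_cases hst : ∃ n, ∀ f ∈ H n, ι (η f) ∈ D n
  · obtain ⟨n, hn⟩ := hst
    have hηι : ∀ f ∈ H n, ι z * ι f * ι (δ z) - ι (δ z) * ι f * ι z ∈ D n := fun f hf => by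
      simpa [hη] using hn f hf
    refine ⟨H n, ?_, hHδ n, hwH n, fun d hd => Subfield.commutator_mem_closure ?_ hd⟩
    · exact subset_trans (fun f hf => by simp [hH0, hf]) (hHmono n.zero_le)
    · rintro _ (⟨r, rfl⟩ | ⟨f, hf, rfl⟩)
      · rw [Algebra.commutes, sub_self]
        exact zero_mem _
      · exact Subfield.commutator_mem_of_mem hw0 (hDH n _ (hwH n)) (hDH n f hf) (hηι f hf)
          (by simpa using hηι 1 (h1H n))
  · exfalso
    push Not at hst
    choose f hf hfD using hst
    obtain ⟨c, hc⟩ := Submodule.exists_finset_subset_pow hV1 (insert z (H 0)) fun a _ => by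
      rw [hVgen]; trivial
    have hdeg : ∀ n, ∀ g ∈ H n, g ∈ V ^ (c + 2 * c * n) := by
      intro n
      induction n with
      | zero => exact fun g hg => hc g (Finset.mem_insert_of_mem hg)
      | succ n ih =>
        intro g hg
        rw [hH, Finset.mem_union, Finset.mem_image] at hg
        obtain hg | ⟨g, hg, rfl⟩ := hg
        · exact Submodule.pow_mono_of_one_mem hV1 (by gcongr; omega) (ih g hg)
        · have hzc := hc z (by simp)
          have hwc := hc (δ z) (Finset.mem_insert_of_mem (hwH 0))
          rw [show c + 2 * c * (n + 1) = c + (c + 2 * c * n) + c by ring, pow_add, pow_add]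
          exact sub_mem (Submodule.mul_mem_mul (Submodule.mul_mem_mul hzc (ih g hg)) hwc)
            (Submodule.mul_mem_mul (Submodule.mul_mem_mul hwc (ih g hg)) hzc)
    have hηH : ∀ n, η (f n) ∈ H (n + 1) := fun n => by
      rw [hH]; exact Finset.mem_union_right _ (Finset.mem_image_of_mem η (hf n))
    have hη0 : ∀ n, η (f n) ≠ 0 := fun n h0 => hfD n (by rw [h0, map_zero]; exact zero_mem _)
    obtain ⟨U, hU0, hU⟩ : ∃ U : ℕ → Submodule k A, U 0 = 1 ∧ ∀ n, U (n + 1) =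
        U n ⊔ (U n).map (LinearMap.mulRight k (η (f n))) :=
      ⟨fun n => Nat.rec 1 (fun n U => U ⊔ U.map (LinearMap.mulRight k (η (f n)))) n, rfl,
        fun _ => rfl⟩
    have hUD : ∀ n, ∀ u ∈ U n, ι u ∈ D n := by
      intro n
      induction n with
      | zero =>
        intro u hu
        rw [hU0] at hu
        obtain ⟨r, rfl⟩ := Submodule.mem_one.1 hu
        rw [ι.commutes]
        exact hDk 0 r
      | succ n ih =>
        intro u hu
        rw [hU, Submodule.mem_sup] at hu
        obtain ⟨a, ha, _, ⟨b, hb, rfl⟩, rfl⟩ := hu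
        rw [LinearMap.mulRight_apply, map_add, map_mul]
        exact add_mem (hDmono n.le_succ (ih a ha))
          (mul_mem (hDmono n.le_succ (ih b hb)) (hDH _ _ (hηH n)))
    have hUV : ∀ n, U n ≤ V ^ ((3 * c + 1) * n ^ 2) := by
      intro n
      induction n with
      | zero => rw [hU0, zero_pow two_ne_zero, mul_zero, pow_zero]
      | succ n ih =>
        rw [hU]
        refine sup_le (ih.trans (Submodule.pow_mono_of_one_mem hV1 (by gcongr; omega))) ?_
        rintro _ ⟨a, ha, rfl⟩
        have := Submodule.mul_mem_mul (ih ha) (hdeg _ _ (hηH n))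
        rw [← pow_add] at this
        refine Submodule.pow_mono_of_one_mem hV1 ?_ this
        nlinarith [Nat.zero_le (c * n)]
    have hUfin : ∀ n : ℕ, FiniteDimensional k (U n : Submodule k A) := fun n =>
      Submodule.finiteDimensional_of_le (hUV n)
    have hUrank : ∀ n, Module.finrank k (U n) = 2 ^ n := by
      intro n
      induction n with
      | zero => rw [hU0, pow_zero, Submodule.finrank_one]
      | succ n ih =>
        rw [hU, Submodule.finrank_sup_of_disjoint,
          Submodule.finrank_map_of_injective _ (mul_left_injective₀ (hη0 n)), ih]
        · ring
        · rw [Submodule.disjoint_def]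
          rintro _ ha ⟨b, hb, rfl⟩
          rcases eq_or_ne b 0 with rfl | hb0
          · simp
          refine absurd ?_ (hfD n)
          have hb0' : ι b ≠ 0 := (map_ne_zero_iff ι hι).2 hb0
          rw [← inv_mul_cancel_left₀ hb0' (ι (η (f n))), ← map_mul]
          exact mul_mem (inv_mem (hUD n b hb)) (hUD n _ ha)
    refine hexp (3 * c + 1) (Nat.succ_pos _) fun n => ?_
    rw [← hUrank n]
    exact Submodule.finrank_mono (hUV n)

end IsDerivation

namespace Submodule

variable {k A : Type*} [Field k] [Ring A] [Algebra k A]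

theorem finrank_mul_le (U W : Submodule k A) [FiniteDimensional k U] [FiniteDimensional k W] :
    Module.finrank k ↥(U * W) ≤ Module.finrank k U * Module.finrank k W := by
  rw [← mulMap_range, ← Module.finrank_tensorProduct]
  exact LinearMap.finrank_range_le _

theorem finrank_span_pair_pow_le (x : A) (n : ℕ) :
    Module.finrank k ↥(span k {1, x} ^ n) ≤ n + 1 := by
  classical
  have hle : span k {1, x} ^ n ≤
      span k (((Finset.range (n + 1)).image (x ^ ·) : Finset A) : Set A) := by
    induction n with
    | zero => rw [pow_zero, one_le]; exact subset_span (by simp)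
    | succ n ih =>
      rw [pow_succ]
      refine (mul_le_mul_left ih _).trans ?_
      rw [span_mul_span, span_le]
      rintro _ ⟨a, ha, b, hb, rfl⟩
      rw [Finset.mem_coe, Finset.mem_image] at ha
      obtain ⟨j, hj, rfl⟩ := ha
      rw [Finset.mem_range] at hj
      refine subset_span ?_
      rw [Finset.mem_coe, Finset.mem_image]
      rcases hb with rfl | rfl
      · exact ⟨j, Finset.mem_range.2 (by omega), by simp⟩
      · exact ⟨j + 1, Finset.mem_range.2 (by omega), pow_succ _ _⟩
  refine (finrank_mono hle).trans ((finrank_span_finset_le_card _).trans ?_)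
  exact Finset.card_image_le.trans (Finset.card_range _).le

theorem _root_.Transcendental.finrank_span_pow {x : A} (hx : Transcendental k x) (n : ℕ) :
    Module.finrank k ↥(span k (Set.range fun j : Fin (n + 1) => x ^ (j : ℕ))) = n + 1 := by
  have hli : LinearIndependent k fun j : ℕ => x ^ j := by
    have h := (Polynomial.basisMonomials k).linearIndependent.map'
      (Polynomial.aeval x).toLinearMap
      (LinearMap.ker_eq_bot.2 (transcendental_iff_injective.1 hx))
    have heq : (fun j : ℕ => x ^ j) =
        ⇑(Polynomial.aeval x).toLinearMap ∘ ⇑(Polynomial.basisMonomials k) := by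
      ext j
      simp
    rwa [heq]
  exact (finrank_span_eq_card (hli.comp _ Fin.val_injective)).trans (Fintype.card_fin _)

theorem exists_transcendental_of_not_le_one [IsAlgClosed k] [IsDomain A] {W : Submodule k A}
    (hW : ¬ W ≤ 1) : ∃ x ∈ W, Transcendental k x := by
  obtain ⟨x, hxW, hx⟩ := SetLike.not_le_iff_exists.1 hW
  refine ⟨x, hxW, fun halg => hx ?_⟩
  obtain ⟨r, hr⟩ := minpoly.mem_range_of_degree_eq_one k x
    (IsAlgClosed.degree_eq_one_of_irreducible k (minpoly.irreducible halg.isIntegral))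
  exact mem_one.2 ⟨r, hr⟩

end Submodule

theorem Subalgebra.mul_mem_toSubmodule_mul {k A : Type*} [Field k] [Ring A] [Algebra k A]
    (S : Subalgebra k A) {N : Submodule k A} {p : A} (hp : p ∈ S) (u : A)
    (hu : u ∈ Subalgebra.toSubmodule S * N) : p * u ∈ Subalgebra.toSubmodule S * N := by
  rw [← S.isIdempotentElem_toSubmodule, mul_assoc]
  exact Submodule.mul_mem_mul hp hu

section SkewField

variable {k Q : Type*} [Field k] [DivisionRing Q] [Algebra k Q]

theorem mul_comm_of_mem_adjoin_singleton {x p q : Q} (hp : p ∈ Algebra.adjoin k {x})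
    (hq : q ∈ Algebra.adjoin k {x}) : p * q = q * p :=
  Algebra.commute_of_mem_adjoin_singleton_of_commute hq
    (Algebra.commute_of_mem_adjoin_singleton_of_commute hp rfl).symm

/-- Every element of the field `k(x)` has a denominator in `k[x]`. -/
theorem Subfield.exists_mul_mem_adjoin_singleton {x y : Q}
    (hy : y ∈ closure (Set.range (algebraMap k Q) ∪ {x})) :
    ∃ p ∈ Algebra.adjoin k {x}, p ≠ 0 ∧ p * y ∈ Algebra.adjoin k {x} := by
  induction hy using closure_induction with
  | mem y hy =>
    refine ⟨1, one_mem _, one_ne_zero, ?_⟩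
    rw [one_mul]
    rcases hy with ⟨r, rfl⟩ | rfl
    · exact Subalgebra.algebraMap_mem _ r
    · exact Algebra.subset_adjoin rfl
  | one => exact ⟨1, one_mem _, one_ne_zero, by simp⟩
  | add y z _ _ hy hz =>
    obtain ⟨p, hp, hp0, hpy⟩ := hy
    obtain ⟨q, hq, hq0, hqz⟩ := hz
    refine ⟨p * q, mul_mem hp hq, mul_ne_zero hp0 hq0, ?_⟩
    rw [mul_add, mul_assoc p q z]
    refine add_mem ?_ (mul_mem hp hqz)
    rw [mul_comm_of_mem_adjoin_singleton hp hq, mul_assoc]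
    exact mul_mem hq hpy
  | neg y _ hy =>
    obtain ⟨p, hp, hp0, hpy⟩ := hy
    exact ⟨p, hp, hp0, by rw [mul_neg]; exact neg_mem hpy⟩
  | inv y _ hy =>
    obtain ⟨p, hp, hp0, hpy⟩ := hy
    rcases eq_or_ne y 0 with rfl | hy0
    · exact ⟨1, one_mem _, one_ne_zero, by simp⟩
    · exact ⟨p * y, hpy, mul_ne_zero hp0 hy0, by rwa [mul_inv_cancel_right₀ hy0]⟩
  | mul y z _ _ hy hz =>
    obtain ⟨p, hp, hp0, hpy⟩ := hy
    obtain ⟨q, hq, hq0, hqz⟩ := hz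
    refine ⟨q * p, mul_mem hq hp, mul_ne_zero hq0 hp0, ?_⟩
    rw [← mul_assoc, mul_assoc q p y, mul_comm_of_mem_adjoin_singleton hq hpy, mul_assoc (p * y)]
    exact mul_mem hpy hqz

theorem exists_ne_zero_mul_mem_adjoin_mul {x : Q} {N : Submodule k Q} {y : Q}
    (hy : y ∈ Submodule.span (Subfield.closure (Set.range (algebraMap k Q) ∪ {x})) (N : Set Q)) :
    ∃ p ∈ Algebra.adjoin k {x}, p ≠ 0 ∧
      p * y ∈ Subalgebra.toSubmodule (Algebra.adjoin k {x}) * N := by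
  have hmul := fun p => (Algebra.adjoin k {x}).mul_mem_toSubmodule_mul (N := N) (p := p)
  induction hy using Submodule.span_induction with
  | mem y hy =>
    exact ⟨1, one_mem _, one_ne_zero, Submodule.mul_mem_mul (one_mem (Algebra.adjoin k {x})) hy⟩
  | zero => exact ⟨1, one_mem _, one_ne_zero, by simp⟩
  | add y z _ _ hy hz =>
    obtain ⟨p, hp, hp0, hpy⟩ := hy
    obtain ⟨q, hq, hq0, hqz⟩ := hz
    refine ⟨p * q, mul_mem hp hq, mul_ne_zero hp0 hq0, ?_⟩
    rw [mul_add, mul_assoc p q z]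
    refine add_mem ?_ (hmul p hp _ hqz)
    rw [mul_comm_of_mem_adjoin_singleton hp hq, mul_assoc]
    exact hmul q hq _ hpy
  | smul c y _ hy =>
    obtain ⟨p, hp, hp0, hpy⟩ := hy
    obtain ⟨q, hq, hq0, hqc⟩ := Subfield.exists_mul_mem_adjoin_singleton c.2
    refine ⟨p * q, mul_mem hp hq, mul_ne_zero hp0 hq0, ?_⟩
    rw [Subfield.smul_def, smul_eq_mul, ← mul_assoc, mul_assoc p,
      mul_comm_of_mem_adjoin_singleton hp hqc, mul_assoc]
    exact hmul _ hqc _ hpy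

theorem exists_ne_zero_forall_mul_mem_adjoin_mul {x : Q} {N : Submodule k Q} (s : Finset Q)
    (hs : ∀ y ∈ s,
      y ∈ Submodule.span (Subfield.closure (Set.range (algebraMap k Q) ∪ {x})) (N : Set Q)) :
    ∃ p ∈ Algebra.adjoin k {x}, p ≠ 0 ∧
      ∀ y ∈ s, p * y ∈ Subalgebra.toSubmodule (Algebra.adjoin k {x}) * N := by
  classical
  have hmul := fun p => (Algebra.adjoin k {x}).mul_mem_toSubmodule_mul (N := N) (p := p)
  induction s using Finset.induction_on with
  | empty => exact ⟨1, one_mem _, one_ne_zero, by simp⟩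
  | insert y s _ ih =>
    rw [Finset.forall_mem_insert] at hs
    obtain ⟨p, hp, hp0, hpy⟩ := exists_ne_zero_mul_mem_adjoin_mul hs.1
    obtain ⟨q, hq, hq0, hqs⟩ := ih hs.2
    refine ⟨p * q, mul_mem hp hq, mul_ne_zero hp0 hq0, ?_⟩
    rw [Finset.forall_mem_insert]
    constructor
    · rw [mul_comm_of_mem_adjoin_singleton hp hq, mul_assoc]
      exact hmul q hq _ hpy
    · intro z hz
      rw [mul_assoc]
      exact hmul p hp _ (hqs z hz)

/-- A subspace of less than quadratic growth has powers of bounded rank over `k(x)`. -/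
theorem exists_pow_succ_subset_span [IsAlgClosed k] {W : Submodule k Q} [FiniteDimensional k W]
    (h1 : (1 : Q) ∈ W)
    (hgrowth : ∀ C : ℕ, 0 < C → ¬ ∀ n : ℕ, (n + 1) ^ 2 ≤ Module.finrank k ↥(W ^ (C * n))) :
    ∃ x ∈ W, ∃ n : ℕ, ((W ^ (n + 1) : Submodule k Q) : Set Q) ⊆
      Submodule.span (Subfield.closure (Set.range (algebraMap k Q) ∪ {x}))
        ((W ^ n : Submodule k Q) : Set Q) := by
  by_cases hW : W ≤ 1
  · refine ⟨0, zero_mem _, 0, fun y hy => Submodule.subset_span ?_⟩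
    rw [zero_add, pow_one] at hy
    rw [pow_zero]
    exact hW hy
  obtain ⟨x, hxW, hx⟩ := Submodule.exists_transcendental_of_not_le_one hW
  refine ⟨x, hxW, ?_⟩
  by_contra! hn
  set K := Subfield.closure (Set.range (algebraMap k Q) ∪ {x}) with hK
  have hxK : x ∈ K := Subfield.subset_closure (Or.inr rfl)
  choose y hyW hyK using fun n => Set.not_subset.1 (hn n)
  refine hgrowth 2 two_pos fun n => ?_
  set F : Submodule k Q := Submodule.span k (Set.range fun j : Fin (n + 1) => x ^ (j : ℕ)) with hF
  have hFK : ∀ f ∈ F, f ∈ K := by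
    intro f hf
    induction hf using Submodule.span_induction with
    | mem f hf => obtain ⟨j, rfl⟩ := hf; exact pow_mem hxK _
    | zero => exact zero_mem _
    | add f g _ _ hf hg => exact add_mem hf hg
    | smul r f _ hf =>
      rw [Algebra.smul_def]
      exact mul_mem (Subfield.subset_closure (Or.inl ⟨r, rfl⟩)) hf
  have hFW : F ≤ W ^ n := by
    rw [hF, Submodule.span_le]
    rintro _ ⟨j, rfl⟩
    exact Submodule.pow_mono_of_one_mem h1 (Nat.lt_succ_iff.1 j.2) (Submodule.pow_mem_pow _ hxW _)
  have hFrank : Module.finrank k F = n + 1 := hx.finrank_span_pow n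
  have hFfin : FiniteDimensional k F := Submodule.finiteDimensional_of_le hFW
  have hy0 : ∀ m, y m ≠ 0 := fun m h0 => hyK m (by rw [h0]; exact zero_mem _)
  obtain ⟨U, hU0, hU⟩ : ∃ U : ℕ → Submodule k Q, U 0 = F ∧
      ∀ m, U (m + 1) = U m ⊔ F.map (LinearMap.mulRight k (y m)) :=
    ⟨fun m => Nat.rec F (fun m U => U ⊔ F.map (LinearMap.mulRight k (y m))) m, rfl, fun _ => rfl⟩
  have hUW : ∀ m, U m ≤ W ^ (n + m) := by
    intro m
    induction m with
    | zero => rwa [hU0, add_zero]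
    | succ m ih =>
      rw [hU]
      refine sup_le (ih.trans (Submodule.pow_mono_of_one_mem h1 (by omega))) ?_
      rintro _ ⟨a, ha, rfl⟩
      rw [pow_add]
      exact Submodule.mul_mem_mul (hFW ha) (hyW m)
  have hUfin : ∀ m : ℕ, FiniteDimensional k (U m : Submodule k Q) := fun m =>
    Submodule.finiteDimensional_of_le (hUW m)
  have hUK : ∀ m, ∀ u ∈ U m, u ∈ Submodule.span K ((W ^ m : Submodule k Q) : Set Q) := by
    intro m
    induction m with
    | zero =>
      intro u hu
      rw [hU0] at hu
      rw [← mul_one u]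
      exact Submodule.smul_mem _ (⟨u, hFK u hu⟩ : K)
        (Submodule.subset_span (Submodule.one_mem_pow h1 0))
    | succ m ih =>
      intro u hu
      rw [hU, Submodule.mem_sup] at hu
      obtain ⟨a, ha, _, ⟨b, hb, rfl⟩, rfl⟩ := hu
      exact add_mem
        (Submodule.span_mono (Submodule.pow_mono_of_one_mem h1 m.le_succ) (ih a ha))
        (Submodule.smul_mem _ (⟨b, hFK b hb⟩ : K) (Submodule.subset_span (hyW m)))
  have hrank : ∀ m, Module.finrank k ↥(U m) = (m + 1) * (n + 1) := by
    intro m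
    induction m with
    | zero => rw [hU0, hFrank, zero_add, one_mul]
    | succ m ih =>
      rw [hU, Submodule.finrank_sup_of_disjoint, ih,
        Submodule.finrank_map_of_injective _ (mul_left_injective₀ (hy0 m)), hFrank]
      · ring
      · rw [Submodule.disjoint_def]
        rintro _ ha ⟨b, hb, rfl⟩
        rcases eq_or_ne b 0 with rfl | hb0
        · simp
        refine absurd ?_ (hyK m)
        rw [SetLike.mem_coe, ← inv_mul_cancel_left₀ hb0 (y m)]
        exact Submodule.smul_mem _ (⟨b⁻¹, inv_mem (hFK b hb)⟩ : K) (hUK m _ ha)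
  rw [sq, ← hrank n, two_mul]
  exact Submodule.finrank_mono (hUW n)

/-- A skew subfield generated by a finite-dimensional subspace of less than quadratic growth:
it has denominators in the subalgebra generated, and its finite-dimensional subspaces have linear
growth. -/
theorem exists_subfield_of_growth [IsAlgClosed k] {W : Submodule k Q} [FiniteDimensional k W]
    (h1 : (1 : Q) ∈ W)
    (hgrowth : ∀ C : ℕ, 0 < C → ¬ ∀ n : ℕ, (n + 1) ^ 2 ≤ Module.finrank k ↥(W ^ (C * n))) :
    ∃ T : Subfield Q, (∀ r, algebraMap k Q r ∈ T) ∧ (∀ w ∈ W, w ∈ T) ∧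
      (∀ s : Finset Q, (∀ y ∈ s, y ∈ T) → ∃ g ∈ Algebra.adjoin k (W : Set Q), g ≠ 0 ∧
        ∀ y ∈ s, g * y ∈ Algebra.adjoin k (W : Set Q)) ∧
      ∀ U : Submodule k Q, FiniteDimensional k U → (∀ u ∈ U, u ∈ T) →
        ∃ C : ℕ, ∀ n, Module.finrank k ↥(U ^ n) ≤ C * (n + 1) := by
  obtain ⟨x, hxW, m, hm⟩ := exists_pow_succ_subset_span h1 hgrowth
  set K := Subfield.closure (Set.range (algebraMap k Q) ∪ {x}) with hK
  set N : Submodule k Q := W ^ m with hN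
  set M : Submodule K Q := Submodule.span K (N : Set Q) with hM
  have hMfin : FiniteDimensional K M := by
    obtain ⟨s, hs⟩ := (Submodule.fg_iff_finiteDimensional N).2 inferInstance
    have : M ≤ Submodule.span K (s : Set Q) := by
      refine Submodule.span_le.2 fun y hy => ?_
      rw [← hs] at hy
      induction hy using Submodule.span_induction with
      | mem y hy => exact Submodule.subset_span hy
      | zero => exact zero_mem _
      | add y z _ _ hy hz => exact add_mem hy hz
      | smul r y _ hy =>
        rw [Algebra.smul_def]
        exact Submodule.smul_mem _
          (⟨algebraMap k Q r, Subfield.subset_closure (Or.inl ⟨r, rfl⟩)⟩ : K) hy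
    exact Submodule.finiteDimensional_of_le this
  have hKM : ∀ c ∈ K, ∀ y ∈ M, c * y ∈ M := fun c hc y hy => Submodule.smul_mem _ (⟨c, hc⟩ : K) hy
  have h1M : 1 ∈ M := Submodule.subset_span (Submodule.one_mem_pow h1 m)
  have hMW : ∀ w ∈ W, ∀ y ∈ M, y * w ∈ M := by
    intro w hw y hy
    induction hy using Submodule.span_induction with
    | mem y hy => exact hm (by rw [pow_succ]; exact Submodule.mul_mem_mul hy hw)
    | zero => rw [zero_mul]; exact zero_mem _
    | add y z _ _ hy hz => rw [add_mul]; exact add_mem hy hz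
    | smul c y _ hy =>
      rw [smul_mul_assoc]
      exact Submodule.smul_mem _ c hy
  have hMB : ∀ b ∈ Algebra.adjoin k (W : Set Q), ∀ y ∈ M, y * b ∈ M := by
    intro b hb
    induction hb using Algebra.adjoin_induction with
    | mem b hb => exact hMW b hb
    | algebraMap r =>
      intro y hy
      rw [← Algebra.commutes]
      exact hKM _ (Subfield.subset_closure (Or.inl ⟨r, rfl⟩)) y hy
    | add b c _ _ hb hc => intro y hy; rw [mul_add]; exact add_mem (hb y hy) (hc y hy)
    | mul b c _ _ hb hc => intro y hy; rw [← mul_assoc]; exact hc _ (hb y hy)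
  have hMinv : ∀ b, b ≠ 0 → (∀ y ∈ M, y * b ∈ M) → ∀ y ∈ M, y * b⁻¹ ∈ M := by
    intro b hb0 hb y hy
    let f : M →ₗ[K] M := (LinearMap.mulRight K b).restrict hb
    have hf : Function.Injective f := fun u v huv => by
      have : (u : Q) * b = v * b := congrArg Subtype.val huv
      exact Subtype.ext (mul_right_cancel₀ hb0 this)
    obtain ⟨u, hu⟩ := LinearMap.surjective_of_injective hf ⟨y, hy⟩
    have hu' : (u : Q) * b = y := congrArg Subtype.val hu
    rw [← hu', mul_inv_cancel_right₀ hb0]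
    exact u.2
  have hMK : ∀ c ∈ K, ∀ y ∈ M, y * c ∈ M := by
    intro c hc
    induction hc using Subfield.closure_induction with
    | mem c hc =>
      refine hMB c ?_
      rcases hc with ⟨r, rfl⟩ | rfl
      · exact Subalgebra.algebraMap_mem _ r
      · exact Algebra.subset_adjoin hxW
    | one => simp
    | add b c _ _ hb hc => intro y hy; rw [mul_add]; exact add_mem (hb y hy) (hc y hy)
    | neg c _ hc => intro y hy; rw [mul_neg]; exact neg_mem (hc y hy)
    | inv c _ hc =>
      rcases eq_or_ne c 0 with rfl | hc0
      · simp
      · exact hMinv c hc0 hc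
    | mul b c _ _ hb hc => intro y hy; rw [← mul_assoc]; exact hc _ (hb y hy)
  have hNB : ∀ b ∈ N, b ∈ Algebra.adjoin k (W : Set Q) := fun b hb =>
    Submodule.pow_subset_adjoin W m hb
  have hMmul : ∀ z ∈ M, ∀ y ∈ M, y * z ∈ M := by
    intro z hz
    induction hz using Submodule.span_induction with
    | mem z hz => exact hMB z (hNB z hz)
    | zero => simp
    | add b c _ _ hb hc => intro y hy; rw [mul_add]; exact add_mem (hb y hy) (hc y hy)
    | smul c z _ hz =>
      intro y hy
      rw [Subfield.smul_def, smul_eq_mul, ← mul_assoc]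
      exact hz _ (hMK c c.2 y hy)
  let T : Subfield Q :=
    { carrier := M
      mul_mem' := fun {a b} ha hb => hMmul b hb a ha
      one_mem' := h1M
      add_mem' := fun {a b} ha hb => add_mem ha hb
      zero_mem' := zero_mem _
      neg_mem' := fun {a} ha => neg_mem ha
      inv_mem' := fun a ha => by
        rcases eq_or_ne a 0 with rfl | ha0
        · rwa [inv_zero]
        · rw [← one_mul a⁻¹]
          exact hMinv a ha0 (hMmul a ha) 1 h1M }
  have hT : ∀ y, y ∈ T ↔ y ∈ M := fun y => Iff.rfl
  have hWT : ∀ w ∈ W, w ∈ T := fun w hw => by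
    rw [hT, ← one_mul w]
    exact hMW w hw 1 h1M
  have hNT : ∀ y ∈ N, y ∈ T := fun y hy => Submodule.subset_span hy
  have hP : Algebra.adjoin k {x} ≤ Algebra.adjoin k (W : Set Q) :=
    Algebra.adjoin_mono (Set.singleton_subset_iff.2 hxW)
  refine ⟨T, fun r => ?_, hWT, fun s hs => ?_, fun U hU hUT => ?_⟩
  · rw [hT, ← mul_one (algebraMap k Q r)]
    exact hKM _ (Subfield.subset_closure (Or.inl ⟨r, rfl⟩)) 1 h1M
  · obtain ⟨p, hp, hp0, hps⟩ := exists_ne_zero_forall_mul_mem_adjoin_mul s hs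
    refine ⟨p, hP hp, hp0, fun y hy => ?_⟩
    have hle : Subalgebra.toSubmodule (Algebra.adjoin k {x}) * N ≤
        Subalgebra.toSubmodule (Algebra.adjoin k (W : Set Q)) := by
      rw [Submodule.mul_le]
      exact fun a ha b hb => mul_mem (S := Subalgebra k Q) (hP ha) (hNB b hb)
    exact hle (hps y hy)
  · set X : Submodule k Q := Submodule.span k {1, x} with hX
    have hX1 : (1 : Q) ∈ X := Submodule.subset_span (by simp)
    have hXP : Algebra.adjoin k (X : Set Q) = Algebra.adjoin k {x} := by
      rw [hX, Algebra.adjoin_span]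
      refine le_antisymm (Algebra.adjoin_le ?_) (Algebra.adjoin_mono (by simp))
      rintro y (rfl | rfl)
      · exact one_mem _
      · exact Algebra.subset_adjoin rfl
    have hXfin : FiniteDimensional k X := FiniteDimensional.span_of_finite k (Set.toFinite _)
    have hXN : ∀ u ∈ Subalgebra.toSubmodule (Algebra.adjoin k {x}) * N, ∃ D, u ∈ X ^ D * N := by
      intro u hu
      induction hu using Submodule.mul_induction_on' with
      | mem_mul_mem a ha b hb =>
        obtain ⟨D, hD⟩ := Submodule.exists_mem_pow_of_mem_adjoin hX1 (hXP ▸ ha)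
        exact ⟨D, Submodule.mul_mem_mul hD hb⟩
      | add a _ b _ ha hb =>
        obtain ⟨D, hD⟩ := ha
        obtain ⟨E, hE⟩ := hb
        exact ⟨max D E, add_mem
          (mul_le_mul_left (Submodule.pow_mono_of_one_mem hX1 (le_max_left _ _)) N hD)
          (mul_le_mul_left (Submodule.pow_mono_of_one_mem hX1 (le_max_right _ _)) N hE)⟩
    obtain ⟨s, hs⟩ := (Submodule.fg_iff_finiteDimensional (N * U)).2 inferInstance
    have hsT : ∀ y ∈ N * U, y ∈ T := by
      intro y hy
      induction hy using Submodule.mul_induction_on' with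
      | mem_mul_mem a ha b hb => exact mul_mem (hNT a ha) (hUT b hb)
      | add a _ b _ ha hb => exact add_mem ha hb
    obtain ⟨p, hp, hp0, hps⟩ := exists_ne_zero_forall_mul_mem_adjoin_mul s
      fun y hy => hsT y (hs ▸ Submodule.subset_span hy)
    choose! D hD using fun y hy => hXN _ (hps y hy)
    have hpNU : ∀ u ∈ N * U, p * u ∈ X ^ (s.sup D) * N := by
      intro u hu
      rw [← hs] at hu
      have hle : Submodule.span k (s : Set Q) ≤
          (X ^ (s.sup D) * N).comap (LinearMap.mulLeft k p) := by
        rw [Submodule.span_le]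
        exact fun y hy => mul_le_mul_left
          (Submodule.pow_mono_of_one_mem hX1 (Finset.le_sup hy)) N (hD y hy)
      exact hle hu
    have hXp : ∀ j, ∀ a ∈ X ^ j, p * a = a * p := fun j a ha =>
      mul_comm_of_mem_adjoin_singleton hp (hXP ▸ Submodule.pow_subset_adjoin X j ha)
    have hpow : ∀ n, ∀ u ∈ N * U ^ n, p ^ n * u ∈ X ^ (s.sup D * n) * N := by
      intro n
      induction n with
      | zero => simp
      | succ n ih =>
        intro u hu
        rw [pow_succ U, ← mul_assoc] at hu
        induction hu using Submodule.mul_induction_on' with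
        | mem_mul_mem a ha b hb =>
          rw [pow_succ', mul_assoc, ← mul_assoc (p ^ n)]
          have hpa := ih a ha
          generalize p ^ n * a = v at hpa
          induction hpa using Submodule.mul_induction_on' with
          | mem_mul_mem c hc d hd =>
            rw [show p * (c * d * b) = c * (p * (d * b)) by
              rw [mul_assoc, ← mul_assoc, hXp _ c hc, mul_assoc],
              mul_add, mul_one, pow_add, mul_assoc]
            exact Submodule.mul_mem_mul hc (hpNU _ (Submodule.mul_mem_mul hd hb))
          | add c _ d _ hc hd =>
            rw [add_mul, mul_add p]
            exact add_mem hc hd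
        | add a _ b _ ha hb =>
          rw [mul_add (p ^ (n + 1))]
          exact add_mem ha hb
    refine ⟨(s.sup D + 1) * Module.finrank k N, fun n => ?_⟩
    have hle : (U ^ n).map (LinearMap.mulLeft k (p ^ n)) ≤ X ^ (s.sup D * n) * N := by
      rintro _ ⟨u, hu, rfl⟩
      refine hpow n u ?_
      rw [← one_mul u]
      exact Submodule.mul_mem_mul (Submodule.one_mem_pow h1 m) hu
    rw [← Submodule.finrank_map_of_injective (LinearMap.mulLeft k (p ^ n))
      (mul_right_injective₀ (pow_ne_zero n hp0))]
    refine (Submodule.finrank_mono hle).trans ((Submodule.finrank_mul_le _ _).trans ?_)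
    calc _ ≤ (s.sup D * n + 1) * Module.finrank k N :=
          Nat.mul_le_mul_right _ (Submodule.finrank_span_pair_pow_le x _)
      _ ≤ ((s.sup D + 1) * (n + 1)) * Module.finrank k N :=
          Nat.mul_le_mul_right _ (by nlinarith)
      _ = _ := by ring

end SkewField

section SkewPolynomial

variable {k Q : Type*} [Field k] [DivisionRing Q] [Algebra k Q]

theorem Algebra.commutator_mem_adjoin {S : Subalgebra k Q} {W : Set Q} {t : Q} (hWS : W ⊆ S)
    (h : ∀ w ∈ W, t * w - w * t ∈ S) {b : Q} (hb : b ∈ Algebra.adjoin k W) :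
    t * b - b * t ∈ S := by
  have hS : Algebra.adjoin k W ≤ S := Algebra.adjoin_le hWS
  induction hb using Algebra.adjoin_induction with
  | mem w hw => exact h w hw
  | algebraMap r => rw [Algebra.commutes, sub_self]; exact zero_mem _
  | add b c _ _ hb hc =>
    rw [show t * (b + c) - (b + c) * t = (t * b - b * t) + (t * c - c * t) by noncomm_ring]
    exact add_mem hb hc
  | mul b c hb' hc' hb hc =>
    rw [show t * (b * c) - b * c * t = (t * b - b * t) * c + b * (t * c - c * t) by noncomm_ring]
    exact add_mem (mul_mem hb (hS hc')) (mul_mem (hS hb') hc)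

namespace Submodule

theorem commutator_mem_pow {W : Submodule k Q} {t : Q} {c : ℕ} (h1 : 1 ∈ W)
    (h : ∀ w ∈ W, t * w - w * t ∈ W ^ c) (j : ℕ) :
    ∀ u ∈ W ^ j, t * u - u * t ∈ W ^ (j + c) := by
  induction j with
  | zero =>
    intro u hu
    rw [pow_zero] at hu
    obtain ⟨r, rfl⟩ := mem_one.1 hu
    rw [Algebra.commutes, sub_self]
    exact zero_mem _
  | succ j ih =>
    intro u hu
    rw [pow_succ] at hu
    induction hu using Submodule.mul_induction_on' with
    | mem_mul_mem a ha b hb =>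
      rw [show t * (a * b) - a * b * t = (t * a - a * t) * b + a * (t * b - b * t) by noncomm_ring]
      refine add_mem ?_ ?_
      · rw [show j + 1 + c = j + c + 1 by omega, pow_succ]
        exact mul_mem_mul (ih a ha) hb
      · refine pow_mono_of_one_mem h1 (show j + c ≤ j + 1 + c by omega) ?_
        rw [pow_add]
        exact mul_mem_mul ha (h b hb)
    | add a _ b _ ha hb =>
      rw [show t * (a + b) - (a + b) * t = (t * a - a * t) + (t * b - b * t) by noncomm_ring]
      exact add_mem ha hb

theorem span_pair_mul_pow_le {W : Submodule k Q} {t : Q} (h1 : 1 ∈ W)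
    (ht : ∀ w ∈ W, t * w - w * t ∈ W ^ 2) (m : ℕ) :
    span k {1, t} * W ^ m ≤ W ^ (m + 1) * span k {1, t} := by
  set X := span k {1, t} with hX
  have hX1 : (1 : Submodule k Q) ≤ X := one_le.2 (subset_span (by simp))
  have hXt : t ∈ X := subset_span (by simp)
  have hXW : X * W ≤ W * X ⊔ W ^ 2 := by
    rw [← span_eq W, hX, span_mul_span, span_le, ← hX, span_eq W]
    rintro _ ⟨a, (rfl | rfl), w, hw, rfl⟩
    · refine mem_sup_left ?_
      change 1 * w ∈ _
      rw [one_mul, ← mul_one w]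
      exact mul_mem_mul hw (one_le.1 hX1)
    · change a * w ∈ _
      rw [← add_sub_cancel (w * a) (a * w)]
      exact add_mem (mem_sup_left (mul_mem_mul hw hXt)) (mem_sup_right (ht w hw))
  induction m with
  | zero =>
    rw [pow_zero, mul_one, zero_add, pow_one]
    exact le_mul_of_one_le_left' (one_le.2 h1)
  | succ m ih =>
    calc X * W ^ (m + 1) = X * W * W ^ m := by rw [pow_succ', mul_assoc]
      _ ≤ (W * X ⊔ W ^ 2) * W ^ m := mul_le_mul_left hXW _
      _ = W * (X * W ^ m) ⊔ W ^ (m + 1 + 1) := by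
        rw [sup_mul, mul_assoc, ← pow_add, show 2 + m = m + 1 + 1 by omega]
      _ ≤ W ^ (m + 1 + 1) * X := by
        refine sup_le ?_ (le_mul_of_one_le_right' hX1)
        rw [pow_succ' W (m + 1), mul_assoc]
        exact mul_le_mul_right ih _

theorem span_pair_pow_mul_pow_le {W : Submodule k Q} {t : Q} (h1 : 1 ∈ W)
    (ht : ∀ w ∈ W, t * w - w * t ∈ W ^ 2) (d : ℕ) :
    ∀ m, span k {1, t} ^ d * W ^ m ≤ W ^ (m + d) * span k {1, t} ^ d := by
  induction d with
  | zero => simp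
  | succ d ih =>
    intro m
    calc span k {1, t} ^ (d + 1) * W ^ m = span k {1, t} ^ d * (span k {1, t} * W ^ m) := by
          rw [pow_succ, mul_assoc]
      _ ≤ span k {1, t} ^ d * (W ^ (m + 1) * span k {1, t}) :=
          mul_le_mul_right (span_pair_mul_pow_le h1 ht m) _
      _ = span k {1, t} ^ d * W ^ (m + 1) * span k {1, t} := by rw [mul_assoc]
      _ ≤ W ^ (m + 1 + d) * span k {1, t} ^ d * span k {1, t} := mul_le_mul_left (ih _) _
      _ = _ := by rw [mul_assoc, ← pow_succ, add_right_comm, add_assoc]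

theorem pow_le_pow_mul_span_pair_pow {V W : Submodule k Q} {t : Q} (h1 : 1 ∈ W)
    (ht : ∀ w ∈ W, t * w - w * t ∈ W ^ 2) {d : ℕ} (hV : V ≤ W * span k {1, t} ^ d) (n : ℕ) :
    V ^ n ≤ W ^ (n * (d + 1)) * span k {1, t} ^ (n * d) := by
  induction n with
  | zero => simp
  | succ n ih =>
    calc V ^ (n + 1) = V * V ^ n := pow_succ' _ _
      _ ≤ (W * span k {1, t} ^ d) * (W ^ (n * (d + 1)) * span k {1, t} ^ (n * d)) :=
          mul_le_mul' hV ih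
      _ = W * (span k {1, t} ^ d * W ^ (n * (d + 1))) * span k {1, t} ^ (n * d) := by
          simp only [mul_assoc]
      _ ≤ W * (W ^ (n * (d + 1) + d) * span k {1, t} ^ d) * span k {1, t} ^ (n * d) :=
          mul_le_mul_left (mul_le_mul_right (span_pair_pow_mul_pow_le h1 ht d _) _) _
      _ = W ^ (n * (d + 1) + d + 1) * span k {1, t} ^ (d + n * d) := by
          rw [pow_succ' W, pow_add (span k {1, t})]
          simp only [mul_assoc]
      _ = _ := by congr 2 <;> ring

theorem exists_finrank_pow_le_of_commutator {V W : Submodule k Q} [FiniteDimensional k W] {t : Q}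
    (h1 : 1 ∈ W) (ht : ∀ w ∈ W, t * w - w * t ∈ W ^ 2) {d : ℕ}
    (hV : V ≤ W * span k {1, t} ^ d) {C : ℕ}
    (hC : ∀ n, Module.finrank k ↥(W ^ n) ≤ C * (n + 1)) :
    ∃ C' : ℕ, ∀ n, Module.finrank k ↥(V ^ n) ≤ C' * (n + 1) ^ 2 := by
  have hX : FiniteDimensional k (span k {1, t} : Submodule k Q) :=
    FiniteDimensional.span_of_finite k (Set.toFinite _)
  refine ⟨C * (d + 1) ^ 2, fun n => ?_⟩
  refine (finrank_mono (pow_le_pow_mul_span_pair_pow h1 ht hV n)).trans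
    ((finrank_mul_le _ _).trans ((Nat.mul_le_mul (hC _) (finrank_span_pair_pow_le t _)).trans ?_))
  calc C * (n * (d + 1) + 1) * (n * d + 1) ≤ C * ((d + 1) * (n + 1)) * ((d + 1) * (n + 1)) := by
        gcongr <;> nlinarith
    _ = _ := by ring

end Submodule

theorem exists_coefficients_of_mem_span_pow {D : Subfield Q} {t a : Q}
    (ha : a ∈ Submodule.span D (Set.range (t ^ · : ℕ → Q))) :
    ∃ (s : Finset Q) (d : ℕ), (∀ y ∈ s, y ∈ D) ∧ ∀ W : Submodule k Q, (∀ y ∈ s, y ∈ W) →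
      a ∈ W * Submodule.span k {1, t} ^ d := by
  classical
  obtain ⟨c, rfl⟩ := Finsupp.mem_span_range_iff_exists_finsupp.1 ha
  refine ⟨c.support.image fun i => (c i : Q), c.support.sup id, ?_, fun W hW => ?_⟩
  · simp only [Finset.mem_image]
    rintro _ ⟨i, _, rfl⟩
    exact (c i).2
  · refine sum_mem fun i hi => ?_
    change (c i : Q) * t ^ i ∈ _
    refine Submodule.mul_mem_mul (hW _ (Finset.mem_image_of_mem _ hi)) ?_
    exact Submodule.pow_mono_of_one_mem (Submodule.subset_span (by simp)) (Finset.le_sup hi)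
      (Submodule.pow_mem_pow _ (Submodule.subset_span (by simp)) _)

theorem exists_common_coefficients_of_mem_span_pow {D : Subfield Q} {t : Q} (s : Finset Q)
    (hs : ∀ a ∈ s, a ∈ Submodule.span D (Set.range (t ^ · : ℕ → Q))) :
    ∃ (r : Finset Q) (d : ℕ), (∀ y ∈ r, y ∈ D) ∧ ∀ W : Submodule k Q, (∀ y ∈ r, y ∈ W) →
      ∀ a ∈ s, a ∈ W * Submodule.span k {1, t} ^ d := by
  classical
  choose! r d hr h using fun a ha => exists_coefficients_of_mem_span_pow (k := k) (hs a ha)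
  refine ⟨s.biUnion r, s.sup d, fun y hy => ?_, fun W hW a ha => ?_⟩
  · obtain ⟨a, ha, hy⟩ := Finset.mem_biUnion.1 hy
    exact hr a ha y hy
  · exact mul_le_mul_right (Submodule.pow_mono_of_one_mem (Submodule.subset_span (by simp))
      (Finset.le_sup ha)) W (h a ha W fun y hy => hW y (Finset.mem_biUnion.2 ⟨a, ha, hy⟩))

/-- Skew polynomials over a skew field generated by a subspace of less than quadratic growth
have at most quadratic growth. -/
theorem exists_finrank_pow_le_of_subset_span_pow [IsAlgClosed k] {W : Submodule k Q}
    [FiniteDimensional k W] (h1 : (1 : Q) ∈ W)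
    (hgrowth : ∀ C : ℕ, 0 < C → ¬ ∀ n : ℕ, (n + 1) ^ 2 ≤ Module.finrank k ↥(W ^ (C * n)))
    {D : Subfield Q} {t : Q} (hWD : ∀ w ∈ W, w ∈ D)
    (hDW : D ≤ Subfield.closure (Set.range (algebraMap k Q) ∪ W))
    (hDt : ∀ d ∈ D, t * d - d * t ∈ D) (s : Finset Q)
    (hs : ∀ a ∈ s, a ∈ Submodule.span D (Set.range (t ^ · : ℕ → Q))) :
    ∃ C : ℕ, ∀ n, Module.finrank k ↥(Submodule.span k (s : Set Q) ^ n) ≤ C * (n + 1) ^ 2 := by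
  classical
  obtain ⟨T, hkT, hWT, hden, hlin⟩ := exists_subfield_of_growth h1 hgrowth
  have hDT : D ≤ T := hDW.trans (Subfield.closure_le.2 (Set.union_subset
    (by rintro _ ⟨r, rfl⟩; exact hkT r) hWT))
  obtain ⟨c, d, hcD, hc⟩ := exists_common_coefficients_of_mem_span_pow (k := k) s hs
  obtain ⟨r, hr⟩ := (Submodule.fg_iff_finiteDimensional W).2 ‹_›
  have hrW : ∀ w ∈ r, w ∈ W := fun w hw => hr ▸ Submodule.subset_span hw
  obtain ⟨g, hg, hg0, hgs⟩ := hden (c ∪ r.image fun w => t * w - w * t) fun y hy => by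
    rw [Finset.mem_union, Finset.mem_image] at hy
    rcases hy with hy | ⟨w, hw, rfl⟩
    · exact hDT (hcD y hy)
    · exact hDT (hDt w (hWD w (hrW w hw)))
  let S : Subalgebra k Q := { T with algebraMap_mem' := hkT }
  have hgT : g ∈ T := (Algebra.adjoin_le hWT : Algebra.adjoin k (W : Set Q) ≤ S) hg
  set U : Submodule k Q := Submodule.span k (insert g⁻¹ (W : Set Q)) with hU
  have hWU : W ≤ U := fun w hw => Submodule.subset_span (Set.mem_insert_of_mem _ hw)
  have hgU : g⁻¹ ∈ U := Submodule.subset_span (Set.mem_insert _ _)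
  have hUsup : U = Submodule.span k {g⁻¹} ⊔ W := by
    rw [hU, Submodule.span_insert, Submodule.span_eq]
  have hUfin : FiniteDimensional k U := by rw [hUsup]; infer_instance
  have hU1 : 1 ∈ U := hWU h1
  have hWUadj : Algebra.adjoin k (W : Set Q) ≤ Algebra.adjoin k (U : Set Q) :=
    Algebra.adjoin_mono hWU
  have hgadj : g⁻¹ ∈ Algebra.adjoin k (U : Set Q) := Algebra.subset_adjoin hgU
  have hyadj : ∀ y ∈ c ∪ r.image fun w => t * w - w * t, y ∈ Algebra.adjoin k (U : Set Q) :=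
    fun y hy => by
      rw [← inv_mul_cancel_left₀ hg0 y]
      exact mul_mem hgadj (hWUadj (hgs y hy))
  let μ : Q →ₗ[k] Q := LinearMap.mulLeft k t - LinearMap.mulRight k t
  have hμW : ∀ w ∈ W, t * w - w * t ∈ Algebra.adjoin k (U : Set Q) := by
    have hle : W ≤ (Subalgebra.toSubmodule (Algebra.adjoin k (U : Set Q))).comap μ := by
      rw [← hr, Submodule.span_le]
      exact fun w hw => hyadj _ (Finset.mem_union_right _ (Finset.mem_image_of_mem _ hw))
    exact hle
  have hμg : t * g⁻¹ - g⁻¹ * t ∈ Algebra.adjoin k (U : Set Q) := by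
    have : t * g⁻¹ - g⁻¹ * t = -(g⁻¹ * (t * g - g * t) * g⁻¹) := by
      simp only [mul_sub, sub_mul, mul_assoc, mul_inv_cancel₀ hg0, mul_one,
        inv_mul_cancel_left₀ hg0, neg_sub]
    rw [this]
    exact neg_mem (mul_mem (mul_mem hgadj
      (Algebra.commutator_mem_adjoin (fun w hw => hWUadj (Algebra.subset_adjoin hw)) hμW hg)) hgadj)
  have hμU : ∀ u ∈ U.map μ, u ∈ Algebra.adjoin k (U : Set Q) := by
    have hle : U.map μ ≤ Subalgebra.toSubmodule (Algebra.adjoin k (U : Set Q)) := by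
      rw [hU, Submodule.map_span_le, ← hU]
      rintro w (rfl | hw)
      · exact hμg
      · exact hμW w hw
    exact hle
  obtain ⟨e₁, he₁⟩ := Submodule.exists_le_pow hU1 (U.map μ) hμU
  obtain ⟨e₂, he₂⟩ := Submodule.exists_finset_subset_pow hU1 _ hyadj
  set e := max e₁ e₂ with he
  have hμe : ∀ u ∈ U, t * u - u * t ∈ U ^ e := fun u hu =>
    Submodule.pow_mono_of_one_mem hU1 (le_max_left _ _) (he₁ ⟨u, hu, rfl⟩)
  have hce : ∀ y ∈ c, y ∈ U ^ e := fun y hy =>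
    Submodule.pow_mono_of_one_mem hU1 (le_max_right _ _) (he₂ y (Finset.mem_union_left _ hy))
  have hUT : ∀ u ∈ U ^ e, u ∈ T := by
    intro u hu
    have hUS : Algebra.adjoin k (U : Set Q) ≤ S := by
      refine Algebra.adjoin_le fun u hu => ?_
      have hle : U ≤ Subalgebra.toSubmodule S := by
        rw [hU, Submodule.span_le]
        rintro w (rfl | hw)
        · exact T.inv_mem hgT
        · exact hWT w hw
      exact hle hu
    exact hUS (Submodule.pow_subset_adjoin U e hu)
  obtain ⟨C, hC⟩ := hlin (U ^ e) inferInstance hUT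
  refine Submodule.exists_finrank_pow_le_of_commutator (Submodule.one_mem_pow hU1 e)
    (fun u hu => ?_) (Submodule.span_le.2 (hc (U ^ e) hce)) hC
  rw [← pow_mul, mul_two]
  exact Submodule.commutator_mem_pow hU1 hμe e u hu

end SkewPolynomial

/-- Let `k` be an algebraically closed field of characteristic `0` and
let `A` be a finitely generated `k`-algebra that is a domain.  Let `V` be a
finite-dimensional `k`-subspace of `A` with `1 ∈ V` generating `A` as a `k`-algebra, and
suppose `2 ≤ limsup_n log(dim V^n)/log n < 3`.  If `A` has a nonzero locally nilpotent
`k`-derivation, then `limsup_n log(dim V^n)/log n = 2` (i.e. `A` has GK dimension `2`). -/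
theorem gkdim_eq_two_of_locally_nilpotent_derivation
    (k A : Type*) [Field k] [IsAlgClosed k] [CharZero k]
    [Ring A] [IsDomain A] [Algebra k A]
    (V : Submodule k A) (hVfd : FiniteDimensional k V) (hV1 : (1 : A) ∈ V)
    (hVgen : Algebra.adjoin k (V : Set A) = ⊤)
    (hlow : 2 ≤ Filter.limsup
      (fun n : ℕ => Real.log (Module.finrank k ↥(V ^ n)) / Real.log n) Filter.atTop)
    (hhigh : Filter.limsup
      (fun n : ℕ => Real.log (Module.finrank k ↥(V ^ n)) / Real.log n) Filter.atTop < 3)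
    (δ : A →ₗ[k] A) (hδ : IsDerivation δ) (hδ0 : δ ≠ 0) (hln : IsLocallyNilpotent δ) :
    Filter.limsup
      (fun n : ℕ => Real.log (Module.finrank k ↥(V ^ n)) / Real.log n) Filter.atTop = 2 := by
  classical
  obtain ⟨a, ha, hfa⟩ := exists_rpow_bound_of_limsup_lt_three _ hlow hhigh
  have hexp := fun C hC => not_forall_two_pow_le _ ha hfa (C := C) hC
  have hcube := fun C hC => not_forall_cube_le _ ha hfa (C := C) hC
  obtain ⟨Q, _, _, ι, hι⟩ := exists_divisionRing_embedding k A fun r s hr hs => by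
    obtain ⟨p, -, q, -, hp, hpq⟩ := Subalgebra.exists_mul_eq_mul_of_growth hV1 hVgen hexp ⊤
      (Algebra.mem_top (x := r)) (Algebra.mem_top (x := s)) hr hs
    exact ⟨p, q, hp, hpq⟩
  obtain ⟨z, hz0, hz⟩ := IsDerivation.exists_slice hln hδ0
  obtain ⟨s, hs⟩ := (Submodule.fg_iff_finiteDimensional V).2 hVfd
  choose n hn using hln
  choose F hF hFD using fun a => hδ.exists_finset_mem_span_pow hz0 hz hι
    (fun r hr s hs hr0 hs0 => Subalgebra.exists_mul_eq_mul_of_growth hV1 hVgen hexp _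
      hr hs hr0 hs0) (n a) a (hn a)
  obtain ⟨G, hsG, hG, hwG, hGt⟩ := hδ.exists_finset_stable hz0 hz hι hV1 hVgen hexp
    (s.biUnion F) fun f hf => by
      obtain ⟨a, -, hf⟩ := Finset.mem_biUnion.1 hf
      exact hF a f hf
  set D := Subfield.closure (Set.range (algebraMap k Q) ∪ ι '' G) with hD
  have hGD : ∀ f ∈ G, ι f ∈ D := fun f hf => Subfield.subset_closure (Or.inr ⟨f, hf, rfl⟩)
  set W : Submodule k A := Submodule.span k ((insert 1 G : Finset A) : Set A) with hW
  have hW1 : (1 : A) ∈ W := Submodule.subset_span (by simp)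
  have hGW : ∀ f ∈ G, f ∈ W := fun f hf => Submodule.subset_span (by simp [hf])
  have hWfin : FiniteDimensional k W := FiniteDimensional.span_finset k _
  have hWE : ∀ m, W ^ m ≤ Subalgebra.toSubmodule hδ.constants := fun m => by
    refine (Submodule.pow_subset_adjoin W m).trans ?_
    rw [hW, Algebra.adjoin_span]
    refine Algebra.adjoin_le fun f hf => ?_
    rw [Finset.mem_coe, Finset.mem_insert] at hf
    rcases hf with rfl | hf
    · exact one_mem _
    · exact hG f hf
  obtain ⟨c, hc⟩ := Submodule.exists_finset_subset_pow hV1 {z} fun a _ => by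
    rw [hVgen]; trivial
  obtain ⟨d, hd⟩ := Submodule.exists_le_pow hV1 W fun a _ => by rw [hVgen]; trivial
  obtain ⟨C, hC⟩ := exists_finrank_pow_le_of_subset_span_pow (W := W.map ι.toLinearMap)
    (D := D) (t := (ι (δ z))⁻¹ * ι z) ⟨1, hW1, map_one ι⟩ (fun C hC0 h => by
      refine hcube (d * C + c + 1) (Nat.succ_pos _) fun m => ?_
      have h1 := h m
      rw [← Submodule.map_pow, Submodule.finrank_map_of_injective _ hι] at h1
      have hWV : W ^ (C * m) ≤ V ^ (d * (C * m)) := by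
        rw [pow_mul V]
        exact pow_le_pow_left' hd _
      calc (m + 1) ^ 3 = (m + 1) * (m + 1) ^ 2 := by ring
        _ ≤ (m + 1) * Module.finrank k ↥(W ^ (C * m)) := Nat.mul_le_mul_left _ h1
        _ ≤ Module.finrank k ↥(V ^ (d * (C * m) + c * m)) :=
          hδ.mul_finrank_constants_le hz0 hz (hWE _) hV1 (hc z (by simp)) hWV m
        _ ≤ _ := Submodule.finrank_mono (Submodule.pow_mono_of_one_mem hV1 (by nlinarith)))
    (by
      rintro _ ⟨w, hw, rfl⟩
      change ι w ∈ D
      induction hw using Submodule.span_induction with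
      | mem f hf =>
        rw [Finset.mem_coe, Finset.mem_insert] at hf
        rcases hf with rfl | hf
        · rw [map_one]; exact one_mem _
        · exact hGD f hf
      | zero => rw [map_zero]; exact zero_mem _
      | add f g _ _ hf hg => rw [map_add]; exact add_mem hf hg
      | smul r f _ hf =>
        rw [map_smul, Algebra.smul_def]
        exact mul_mem (Subfield.subset_closure (Or.inl ⟨r, rfl⟩)) hf)
    (Subfield.closure_mono (Set.union_subset_union_right _
      (by rintro _ ⟨f, hf, rfl⟩; exact ⟨f, hGW f hf, rfl⟩)))
    hGt (s.image ι) (fun y hy => by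
      obtain ⟨a, ha, rfl⟩ := Finset.mem_image.1 hy
      exact hFD a D (fun f hf => hGD f (hsG (Finset.mem_biUnion.2 ⟨a, ha, hf⟩))) (hGD _ hwG) hGt)
  have hspan : Submodule.span k ((s.image ι : Finset Q) : Set Q) = V.map ι.toLinearMap := by
    rw [← hs, Submodule.map_span, Finset.coe_image]
    rfl
  refine le_antisymm (limsup_log_div_log_le_two _ C fun m => ?_) hlow
  rw [← Submodule.finrank_map_of_injective ι.toLinearMap hι, Submodule.map_pow, ← hspan]
  exact hC m
end

section
/- Let k be an algebraically closed field of characteristic 0 and let A be a finitely generated k-algebra that is a domain. Suppose there is a finite-dimensional k-subspace V of A with 1 ∈ V that generates A as a k-algebra and satisfies 2 ≤ limsup_{n→∞} log(dim_k V^n)/log n < 3, and suppose A has a nonzero locally nilpotent k-derivation. Then A has quadratic growth: there exist a finite-dimensional k-subspace W of A with 1 ∈ W that generates A as a k-algebra and positive real constants C₁ and C₂ such that C₁·n² < dim_k W^n < C₂·n² for all natural numbers n ≥ 1. -/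
section Leibniz

variable {S R : Type*} [Semiring S] [Ring R] [Module S R] {δ : Module.End S R}

theorem Module.End.pow_apply_eq_zero_of_le {m n : ℕ} (h : m ≤ n) {u : R}
    (hu : (δ ^ m) u = 0) : (δ ^ n) u = 0 := by
  obtain ⟨l, rfl⟩ := Nat.exists_eq_add_of_le' h
  rw [pow_add, Module.End.mul_apply, hu, map_zero]

theorem Module.End.pow_apply_mul_eq_zero (hδ : ∀ a b, δ (a * b) = a * δ b + δ a * b) (m : ℕ) :
    ∀ {p q : ℕ} {u v : R}, (δ ^ p) u = 0 → (δ ^ q) v = 0 → p + q ≤ m + 1 →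
      (δ ^ m) (u * v) = 0 := by
  induction m with
  | zero =>
    intro p q u v hu hv hpq
    rcases Nat.eq_zero_or_pos p with rfl | hp
    · simp only [pow_zero, Module.End.one_apply] at hu
      simp [hu]
    · obtain rfl : q = 0 := by omega
      simp only [pow_zero, Module.End.one_apply] at hv
      simp [hv]
  | succ m ih =>
    intro p q u v hu hv hpq
    rcases p with _ | p
    · simp only [pow_zero, Module.End.one_apply] at hu
      simp [hu]
    rcases q with _ | q
    · simp only [pow_zero, Module.End.one_apply] at hv
      simp [hv]
    rw [pow_succ, Module.End.mul_apply, hδ, map_add,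
      ih (p := p + 1) (q := q) hu (by rwa [pow_succ, Module.End.mul_apply] at hv) (by omega),
      ih (p := p) (q := q + 1) (by rwa [pow_succ, Module.End.mul_apply] at hu) hv (by omega),
      add_zero]

theorem Module.End.map_one_eq_zero (hδ : ∀ a b, δ (a * b) = a * δ b + δ a * b) : δ 1 = 0 := by
  have h := hδ 1 1
  simpa using h

theorem Module.End.map_mul_pow_succ (hδ : ∀ a b, δ (a * b) = a * δ b + δ a * b) {y : R}
    (hy : δ y = 1) (u : R) (j : ℕ) :
    δ (u * y ^ (j + 1)) = (j + 1) • (u * y ^ j) + δ u * y ^ (j + 1) := by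
  induction j with
  | zero => simp [hδ, hy]
  | succ j ih =>
    rw [pow_succ, ← mul_assoc, hδ, ih, hy, add_mul, smul_mul_assoc, mul_one, succ_nsmul _ (j + 1)]
    simp only [pow_succ, mul_assoc]
    abel

theorem Module.End.pow_apply_mul_pow (hδ : ∀ a b, δ (a * b) = a * δ b + δ a * b) {y : R}
    (hy : δ y = 1) {u : R} (hu : δ u = 0) (j : ℕ) :
    (δ ^ j) (u * y ^ j) = j.factorial • u := by
  induction j with
  | zero => simp
  | succ j ih =>
    rw [pow_succ, Module.End.mul_apply, map_mul_pow_succ hδ hy, hu, zero_mul, add_zero, map_nsmul,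
      ih, smul_smul, Nat.factorial_succ]

end Leibniz

section KerPow

variable {k R : Type*} [Field k] [Ring R] [Algebra k R]

theorem IsDerivation.pow_le_ker {δ : R →ₗ[k] R} (hδ : IsDerivation δ) {V : Submodule k R} {d : ℕ}
    (hV : V ≤ LinearMap.ker (δ ^ (d + 1))) (n : ℕ) :
    V ^ n ≤ LinearMap.ker (δ ^ (d * n + 1)) := by
  induction n with
  | zero =>
    rw [pow_zero, Submodule.one_le]
    simp [Module.End.map_one_eq_zero hδ]
  | succ n ih =>
    rw [pow_succ, Submodule.mul_le]
    intro u hu v hv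
    exact Module.End.pow_apply_mul_eq_zero hδ _ (ih hu) (hV hv) (by rw [Nat.mul_succ]; omega)

theorem finrank_ker_pow_le {f : R →ₗ[k] R} [FiniteDimensional k (LinearMap.ker f)] (n : ℕ) :
    FiniteDimensional k (LinearMap.ker (f ^ n)) ∧
      Module.finrank k (LinearMap.ker (f ^ n)) ≤ n * Module.finrank k (LinearMap.ker f) := by
  induction n with
  | zero =>
    have : LinearMap.ker (f ^ 0) = ⊥ := by
      rw [pow_zero]; exact LinearMap.ker_eq_bot_of_injective fun _ _ h => h
    rw [this]
    exact ⟨inferInstance, by simp⟩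
  | succ n ih =>
    obtain ⟨ih1, ih2⟩ := ih
    let g : LinearMap.ker (f ^ (n + 1)) →ₗ[k] LinearMap.ker f :=
      ((f ^ n).comp (LinearMap.ker (f ^ (n + 1))).subtype).codRestrict _ fun u => by
        rw [LinearMap.mem_ker, LinearMap.comp_apply, ← Module.End.mul_apply, ← pow_succ']
        exact LinearMap.mem_ker.1 u.2
    let e : LinearMap.ker g →ₗ[k] LinearMap.ker (f ^ n) :=
      ((LinearMap.ker (f ^ (n + 1))).subtype.comp (LinearMap.ker g).subtype).codRestrict _
        fun u => congrArg Subtype.val (LinearMap.mem_ker.1 u.2)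
    have he : Function.Injective e := fun u v h =>
      Subtype.ext (Subtype.ext (congrArg (LinearMap.ker (f ^ n)).subtype h))
    have h1 : FiniteDimensional k (LinearMap.ker g) := FiniteDimensional.of_injective e he
    have h2 : FiniteDimensional k (LinearMap.ker (f ^ (n + 1))) := by
      have := Module.Finite.of_injective (LinearMap.range g).subtype
        (Submodule.injective_subtype _)
      have := Module.Finite.equiv (LinearMap.quotKerEquivRange g).symm
      exact Module.Finite.of_submodule_quotient (LinearMap.ker g)
    refine ⟨h2, ?_⟩
    have h3 := LinearMap.finrank_range_add_finrank_ker g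
    have h4 := LinearMap.finrank_le_finrank_of_injective he
    have h5 := Submodule.finrank_le (LinearMap.range g)
    rw [Nat.succ_mul]
    omega

end KerPow
section Ore

universe u

/-- The ring homomorphism `a ↦ ι a + ι (δ a) ε` attached to a derivation `δ` of `A` and an algebra
homomorphism `ι` out of `A`. -/
def IsDerivation.toTrivSqZeroExt {k A B : Type*} [CommRing k] [Ring A] [Algebra k A] [Ring B]
    [Algebra k B] {δ : A →ₗ[k] A} (hδ : IsDerivation δ) (ι : A →ₐ[k] B) :
    A →+* TrivSqZeroExt B B where
  toFun a := TrivSqZeroExt.inl (ι a) + TrivSqZeroExt.inr (ι (δ a))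
  map_one' := by
    have h : δ 1 = 0 := by simpa using hδ 1 1
    simp [h]
  map_zero' := by simp
  map_add' a b := by ext <;> simp
  map_mul' a b := by ext <;> simp [hδ a b]

theorem IsDerivation.fst_toTrivSqZeroExt {k A B : Type*} [CommRing k] [Ring A] [Algebra k A]
    [Ring B] [Algebra k B] {δ : A →ₗ[k] A} (hδ : IsDerivation δ) (ι : A →ₐ[k] B) (a : A) :
    (hδ.toTrivSqZeroExt ι a).fst = ι a := by
  simp [IsDerivation.toTrivSqZeroExt]

theorem IsDerivation.snd_toTrivSqZeroExt {k A B : Type*} [CommRing k] [Ring A] [Algebra k A]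
    [Ring B] [Algebra k B] {δ : A →ₗ[k] A} (hδ : IsDerivation δ) (ι : A →ₐ[k] B) (a : A) :
    (hδ.toTrivSqZeroExt ι a).snd = ι (δ a) := by
  simp [IsDerivation.toTrivSqZeroExt]

open OreLocalization in
theorem IsDerivation.exists_extend_divisionRing {k : Type*} {A : Type u} [Field k] [Ring A]
    [IsDomain A] [Algebra k A] {δ : A →ₗ[k] A} (hδ : IsDerivation δ)
    (hore : ∀ a b : A, b ≠ 0 → ∃ a' b' : A, b' ≠ 0 ∧ b' * a = a' * b) :
    ∃ (Q : Type u) (_ : DivisionRing Q) (_ : Algebra k Q) (ι : A →ₐ[k] Q) (D : Q →ₗ[k] Q),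
      Function.Injective ι ∧ IsDerivation D ∧ ∀ a, D (ι a) = ι (δ a) := by
  choose! num den hden heq using hore
  let _ : OreSet (nonZeroDivisors A) := oreSetOfNoZeroDivisors
    (fun r s => num r s)
    (fun r s => ⟨den r s, mem_nonZeroDivisors_of_ne_zero
      (hden r s (nonZeroDivisors.ne_zero s.2))⟩)
    (fun r s => heq r s (nonZeroDivisors.ne_zero s.2))
  let Q := OreLocalization (nonZeroDivisors A) A
  let ι : A →ₐ[k] Q := { (numeratorRingHom : A →+* Q) with commutes' := fun r => rfl }
  let f : A →+* TrivSqZeroExt Q Q := hδ.toTrivSqZeroExt ι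
  have hι : Function.Injective ι := numeratorHom_inj fun _ h => h.1
  have hunit : ∀ s : nonZeroDivisors A,
      IsUnit ((f : A →* TrivSqZeroExt Q Q).domRestrict (nonZeroDivisors A) s) := fun s => by
    rw [TrivSqZeroExt.isUnit_iff_isUnit_fst, isUnit_iff_ne_zero]
    exact (hδ.fst_toTrivSqZeroExt ι s).symm ▸ (map_ne_zero_iff ι hι).2 (nonZeroDivisors.ne_zero s.2)
  let F : Q →+* TrivSqZeroExt Q Q := universalHom f (IsUnit.liftRight _ hunit) fun s => rfl
  have hF : ∀ a, F (ι a) = f a := fun a => universalHom_commutes _ _ _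
  have hfst : ∀ q : Q, (F q).fst = q := by
    have hfι : ∀ s : nonZeroDivisors A,
        IsUnit ((ι : A →* Q).domRestrict (nonZeroDivisors A) s) := fun s =>
      isUnit_iff_ne_zero.2 ((map_ne_zero_iff ι hι).2 (nonZeroDivisors.ne_zero s.2))
    have h1 := universalHom_unique (ι : A →+* Q) (IsUnit.liftRight _ hfι) (fun s => rfl)
      ((TrivSqZeroExt.fstHom k Q Q : TrivSqZeroExt Q Q →+* Q).comp F)
      (fun r => (congrArg TrivSqZeroExt.fst (hF r)).trans (hδ.fst_toTrivSqZeroExt ι r))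
    have h2 := universalHom_unique (ι : A →+* Q) (IsUnit.liftRight _ hfι) (fun s => rfl)
      (RingHom.id Q) (fun r => rfl)
    intro q
    exact RingHom.congr_fun (h1.trans h2.symm) q
  have hmul : ∀ p q : Q, (F (p * q)).snd = p * (F q).snd + (F p).snd * q := fun p q => by
    rw [map_mul, TrivSqZeroExt.snd_mul, hfst, hfst]
    simp
  refine ⟨Q, inferInstance, inferInstance, ι,
    { toFun := fun q => (F q).snd
      map_add' := fun p q => by simp
      map_smul' := fun c q => ?_ }, hι, hmul, fun a => ?_⟩
  · have hc : (F (algebraMap k Q c)).snd = 0 := by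
      have := hF (algebraMap k A c)
      rw [AlgHom.commutes] at this
      rw [this, hδ.snd_toTrivSqZeroExt, Algebra.algebraMap_eq_smul_one, map_smul, Module.End.map_one_eq_zero hδ, smul_zero, map_zero]
    rw [Algebra.smul_def, hmul, hc, zero_mul, add_zero, RingHom.id_apply, Algebra.smul_def]
  · exact (congrArg TrivSqZeroExt.snd (hF a)).trans (hδ.snd_toTrivSqZeroExt ι a)

end Ore
section Plateau

theorem Submodule.exists_mul_eq_of_mul_mem {κ Q : Type*} [Field κ] [DivisionRing Q] [Module κ Q]
    [IsScalarTower κ Q Q] {P : Submodule κ Q} [FiniteDimensional κ P] {q : Q} (hq : q ≠ 0)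
    (hP : ∀ u ∈ P, u * q ∈ P) {v : Q} (hv : v ∈ P) : ∃ u ∈ P, u * q = v := by
  let f : P →ₗ[κ] P := (LinearMap.mulRight κ q).restrict hP
  have hf : Function.Injective f := fun u v h =>
    Subtype.ext (mul_right_cancel₀ hq (congrArg P.subtype h))
  obtain ⟨u, hu⟩ := LinearMap.injective_iff_surjective.1 hf ⟨v, hv⟩
  exact ⟨u, u.2, congrArg P.subtype hu⟩

/-- The sum of the subspaces `M * y ^ i` for `i ≤ j`. -/
def Submodule.polySpan {κ Q : Type*} [Semiring κ] [Semiring Q] [Module κ Q] [IsScalarTower κ Q Q]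
    (M : Submodule κ Q) (y : Q) : ℕ → Submodule κ Q
  | 0 => M
  | j + 1 => M ⊔ (M.polySpan y j).map (LinearMap.mulRight κ y)

section

variable {κ Q : Type*} [Semiring κ] [Semiring Q] [Module κ Q] [IsScalarTower κ Q Q]
  (M : Submodule κ Q) (y : Q)

theorem Submodule.polySpan_mul_mem {j : ℕ} {u : Q} (hu : u ∈ M.polySpan y j) :
    u * y ∈ M.polySpan y (j + 1) :=
  Submodule.mem_sup_right ⟨u, hu, rfl⟩

theorem Submodule.polySpan_mul_pow_mem {j : ℕ} {u : Q} (hu : u ∈ M.polySpan y j) (i : ℕ) :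
    u * y ^ i ∈ M.polySpan y (j + i) := by
  induction i with
  | zero => simpa
  | succ i ih =>
    rw [pow_succ, ← mul_assoc]
    exact M.polySpan_mul_mem y ih

theorem Submodule.polySpan_mono : Monotone (M.polySpan y) := by
  refine monotone_nat_of_le_succ fun j => ?_
  induction j with
  | zero => exact le_sup_left
  | succ j ih => exact sup_le_sup_left (Submodule.map_mono ih) _

end

instance Submodule.finiteDimensional_polySpan {κ Q : Type*} [Field κ] [DivisionRing Q]
    [Module κ Q] [IsScalarTower κ Q Q] (M : Submodule κ Q) [FiniteDimensional κ M] (y : Q)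
    (j : ℕ) : FiniteDimensional κ (M.polySpan y j) := by
  induction j with
  | zero => assumption
  | succ j ih => exact Submodule.finiteDimensional_sup _ _

/-- The projection `w ↦ ∑ (-1) ^ i / i! • δ ^ i (w) * y ^ i` onto the constants of a locally
nilpotent derivation `δ` with slice `y`. -/
def dixmier (k : Type*) {S Q : Type*} [Field k] [Semiring S] [Ring Q] [Module k Q] [Module S Q]
    (δ : Module.End S Q) (y : Q) (d : ℕ) (w : Q) : Q :=
  ∑ i ∈ Finset.range (d + 1), ((-1) ^ i * (i.factorial : k)⁻¹) • ((δ ^ i) w * y ^ i)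

theorem map_dixmier_eq_zero {k S Q : Type*} [Field k] [CharZero k] [Semiring S] [Ring Q]
    [Algebra k Q] [Module S Q] [SMul k S] [IsScalarTower k S Q]
    {δ : Module.End S Q} (hδ : ∀ a b, δ (a * b) = a * δ b + δ a * b) {y : Q} (hy : δ y = 1)
    {d : ℕ} {w : Q} (hw : (δ ^ (d + 1)) w = 0) : δ (dixmier k δ y d w) = 0 := by
  have key : ∀ m : ℕ,
      δ (dixmier k δ y m w) = ((-1) ^ m * (m.factorial : k)⁻¹) • ((δ ^ (m + 1)) w * y ^ m) := by
    intro m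
    unfold dixmier
    induction m with
    | zero => simp
    | succ m ih =>
      rw [Finset.sum_range_succ, map_add, ih, LinearMap.map_smul_of_tower,
        Module.End.map_mul_pow_succ hδ hy, ← Module.End.mul_apply, ← pow_succ' δ, smul_add,
        ← add_assoc, ← Nat.cast_smul_eq_nsmul k (m + 1), smul_smul, ← add_smul]
      have : (-1) ^ m * (m.factorial : k)⁻¹ +
          (-1) ^ (m + 1) * ((m + 1).factorial : k)⁻¹ * ((m + 1 : ℕ) : k) = 0 := by
        have h1 : ((m + 1 : ℕ) : k) ≠ 0 := Nat.cast_ne_zero.2 m.succ_ne_zero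
        rw [Nat.factorial_succ, Nat.cast_mul, mul_inv, pow_succ]
        field_simp
        ring
      rw [this, zero_smul, zero_add]
  rw [key, hw, zero_mul, smul_zero]

variable {k κ Q : Type*} [Field k] [CharZero k] [Field κ] [Algebra k κ] [DivisionRing Q]
  [Algebra k Q] [Module κ Q] [IsScalarTower k κ Q] [IsScalarTower κ Q Q]
  {D : Module.End κ Q} {N : ℕ → Submodule κ Q} {M : Submodule κ Q} {L : ℕ} {c x y : Q}

theorem pow_apply_eq_zero_of_mem_polySpan (hD : ∀ a b, D (a * b) = a * D b + D a * b)
    (hM : M ≤ LinearMap.ker D) (hy : D y = 1) {j : ℕ} :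
    ∀ {u : Q}, u ∈ M.polySpan y j → (D ^ (j + 1)) u = 0 := by
  induction j with
  | zero => intro u hu; simpa using hM hu
  | succ j ih =>
    intro u hu
    obtain ⟨m, hm, v, ⟨v, hv, rfl⟩, rfl⟩ := Submodule.mem_sup.1 hu
    have h1 : (D ^ (j + 1 + 1)) m = 0 :=
      Module.End.pow_apply_eq_zero_of_le (m := 1) (by omega) (by simpa using hM hm)
    have h2 : (D ^ 2) y = 0 := by
      rw [pow_two, Module.End.mul_apply, hy, Module.End.map_one_eq_zero hD]
    rw [map_add, h1, zero_add]
    exact Module.End.pow_apply_mul_eq_zero hD _ (ih hv) h2 (by omega)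

theorem mem_polySpan_of_pow_apply_eq_zero [CharZero κ]
    (hD : ∀ a b, D (a * b) = a * D b + D a * b) (hN : Monotone N)
    (hND : ∀ u ∈ N L, D u ∈ N L) (hML : N L ⊓ LinearMap.ker D ≤ M) (hM : M ≤ LinearMap.ker D)
    (hy : D y = 1) {j : ℕ} (hjL : j ≤ L) (hP : ∀ i ≤ j, M.polySpan y i ≤ N i) :
    ∀ {u : Q}, u ∈ N L → (D ^ (j + 1)) u = 0 → u ∈ M.polySpan y j := by
  induction j with
  | zero =>
    intro u hu hu0
    exact hML ⟨hu, by simpa using hu0⟩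
  | succ j ih =>
    intro u hu hu0
    have hmem : ∀ i : ℕ, (D ^ i) u ∈ N L := fun i => by
      induction i with
      | zero => simpa
      | succ i ih => rw [pow_succ', Module.End.mul_apply]; exact hND _ ih
    have hm : (D ^ (j + 1)) u ∈ M :=
      hML ⟨hmem _, by rw [SetLike.mem_coe, LinearMap.mem_ker, ← Module.End.mul_apply, ← pow_succ', hu0]⟩
    have hmy : (D ^ (j + 1)) u * y ^ (j + 1) ∈ M.polySpan y (j + 1) := by
      simpa using M.polySpan_mul_pow_mem y (j := 0) hm (j + 1)
    have hsub : u - ((j + 1).factorial : κ)⁻¹ • ((D ^ (j + 1)) u * y ^ (j + 1)) ∈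
        M.polySpan y j := by
      refine ih (by omega) (fun i hi => hP i (by omega)) ?_ ?_
      · exact Submodule.sub_mem _ hu (Submodule.smul_mem _ _ (hN hjL (hP _ le_rfl hmy)))
      · rw [map_sub, map_smul, Module.End.pow_apply_mul_pow hD hy (hM hm),
          ← Nat.cast_smul_eq_nsmul κ, smul_smul, inv_mul_cancel₀, one_smul, sub_self]
        exact Nat.cast_ne_zero.2 (Nat.factorial_ne_zero _)
    rw [← sub_add_cancel u (((j + 1).factorial : κ)⁻¹ • ((D ^ (j + 1)) u * y ^ (j + 1)))]
    exact Submodule.add_mem _ (M.polySpan_mono y (Nat.le_succ j) hsub)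
      (Submodule.smul_mem _ _ hmy)

theorem polySpan_le [CharZero κ] [FiniteDimensional κ M]
    (hD : ∀ a b, D (a * b) = a * D b + D a * b) (hN : Monotone N)
    (hND : ∀ u ∈ N L, D u ∈ N L) (hML : N L ⊓ LinearMap.ker D ≤ M) (hM : M ≤ LinearMap.ker D)
    (hM0 : M ≤ N 0) (hy : D y = 1) (hc : c ≠ 0) (hDc : D c = 0) (hcy : c * y = x)
    (hNc : ∀ n, ∀ u ∈ N n, u * c ∈ N (n + 1)) (hNx : ∀ n, ∀ u ∈ N n, u * x ∈ N (n + 1)) :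
    ∀ j ≤ L, M.polySpan y j ≤ N j := by
  intro j
  induction j using Nat.strong_induction_on with
  | _ j ih =>
    intro hj
    rcases j with _ | j
    · exact hM0
    refine sup_le (hM0.trans (hN (Nat.zero_le _))) ?_
    rintro _ ⟨v, hv, rfl⟩
    have hPj : ∀ i ≤ j, M.polySpan y i ≤ N i := fun i hi => ih i (by omega) (by omega)
    obtain ⟨u, hu, rfl⟩ := Submodule.exists_mul_eq_of_mul_mem hc (fun u hu =>
      mem_polySpan_of_pow_apply_eq_zero hD hN hND hML hM hy (by omega) hPj
        (hN hj (hNc j u (hPj j le_rfl hu)))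
        (Module.End.pow_apply_mul_eq_zero hD _ (q := 1)
          (pow_apply_eq_zero_of_mem_polySpan hD hM hy hu) (by simpa using hDc) (by omega))) hv
    rw [LinearMap.mulRight_apply, mul_assoc, hcy]
    exact hNx j u (hPj j le_rfl hu)

/-- If the constants of the filtration `N` do not grow between `0` and `L`, then they are stable
under right multiplication by the iterated commutators of `y` with the constants `dixmier w`. -/
theorem mul_commutator_dixmier_mem [CharZero κ] [FiniteDimensional κ M]
    (hD : ∀ a b, D (a * b) = a * D b + D a * b) (hN : Monotone N)
    (hND : ∀ u ∈ N L, D u ∈ N L) (hML : N L ⊓ LinearMap.ker D ≤ M) (hM : M ≤ LinearMap.ker D)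
    (hM0 : M ≤ N 0) (hy : D y = 1) (hc : c ≠ 0) (hDc : D c = 0) (hcy : c * y = x)
    (hNc : ∀ n, ∀ u ∈ N n, u * c ∈ N (n + 1)) (hNx : ∀ n, ∀ u ∈ N n, u * x ∈ N (n + 1))
    {d : ℕ} {w : Q} (hw : (D ^ (d + 1)) w = 0)
    (hNw : ∀ i n, ∀ u ∈ N n, u * (D ^ i) w ∈ N (n + 1)) {i : ℕ} (hi : i + 2 * d + 1 ≤ L)
    {u : Q} (hu : u ∈ M) : u * (fun q => y * q - q * y)^[i] (dixmier k D y d w) ∈ M := by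
  have hPN := polySpan_le hD hN hND hML hM hM0 hy hc hDc hcy hNc hNx
  have hmul : ∀ j i, j + d + 1 ≤ L → ∀ u ∈ M.polySpan y j,
      u * (D ^ i) w ∈ M.polySpan y (j + d) := fun j i hj u hu =>
    mem_polySpan_of_pow_apply_eq_zero hD hN hND hML hM hy (by omega)
      (fun i hi => hPN i (by omega)) (hN (by omega) (hNw i j u (hPN j (by omega) hu)))
      (Module.End.pow_apply_mul_eq_zero hD _ (q := d + 1)
        (pow_apply_eq_zero_of_mem_polySpan hD hM hy hu)
        (by rw [← Module.End.mul_apply, ← pow_add, add_comm, pow_add, Module.End.mul_apply, hw,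
          map_zero]) (by omega))
  have hcomm : ∀ i j, j + i + 2 * d + 1 ≤ L → ∀ u ∈ M.polySpan y j,
      u * (fun q => y * q - q * y)^[i] (dixmier k D y d w) ∈ M.polySpan y (j + i + 2 * d) := by
    intro i
    induction i with
    | zero =>
      intro j hj u hu
      simp only [Function.iterate_zero, id_eq, dixmier, Finset.mul_sum]
      refine Submodule.sum_mem _ fun l hl => ?_
      rw [mul_smul_comm, ← mul_assoc]
      refine Submodule.smul_of_tower_mem _ _ (M.polySpan_mono y ?_
        (M.polySpan_mul_pow_mem y (hmul j l (by omega) u hu) l))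
      have := Finset.mem_range.1 hl
      omega
    | succ i ih =>
      intro j hj u hu
      rw [Function.iterate_succ_apply', mul_sub, ← mul_assoc, ← mul_assoc]
      refine Submodule.sub_mem _ ?_ ?_
      · have := ih (j + 1) (by omega) _ (M.polySpan_mul_mem y hu)
        rwa [show j + (i + 1) + 2 * d = j + 1 + i + 2 * d by omega]
      · have := M.polySpan_mul_mem y (ih j (by omega) u hu)
        rwa [show j + (i + 1) + 2 * d = j + i + 2 * d + 1 by omega]
  have hconst : ∀ i, D ((fun q => y * q - q * y)^[i] (dixmier k D y d w)) = 0 := by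
    intro i
    induction i with
    | zero => exact map_dixmier_eq_zero hD hy hw
    | succ i ih =>
      rw [Function.iterate_succ_apply', map_sub, hD, hD, ih, hy]
      simp
  refine hML ⟨hN (by omega) (hPN _ (by omega) (hcomm i 0 (by omega) u hu)), ?_⟩
  rw [SetLike.mem_coe, LinearMap.mem_ker, hD, hconst, hM hu]
  simp

end Plateau

section RankBounds

theorem eq_zero_of_map_mul_eq_zero {S R : Type*} [Semiring S] [Ring R] [Module S R] [CharZero R]
    [NoZeroDivisors R] {D : Module.End S R} (hD : ∀ a b, D (a * b) = a * D b + D a * b) {y : R}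
    (hy : D y = 1) {e : ℕ} {u : R} (hu : (D ^ e) u = 0) (h : D (u * y) = 0) : u = 0 := by
  suffices ∀ n : ℕ, ∀ u : R, (D ^ e) u = 0 → D (u * y) = -(n * u) → u = 0 from
    this 0 u hu (by simpa using h)
  clear hu h u
  induction e with
  | zero => intro n u hu _; simpa using hu
  | succ e ih =>
    intro n u hu h
    have h1 : D u * y = -((n + 1 : ℕ) * u) := by
      rw [hD, hy] at h
      push_cast
      rw [add_comm (n : R), add_mul, one_mul, neg_add, ← h, mul_one]
      abel
    have h2 : D u = 0 := by
      refine ih (n + 1) (D u) (by rwa [pow_succ] at hu) ?_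
      rw [h1, map_neg, ← nsmul_eq_mul, map_nsmul, nsmul_eq_mul]
    rw [h2, zero_mul, eq_comm, neg_eq_zero, mul_eq_zero] at h1
    exact h1.resolve_left (Nat.cast_ne_zero.2 n.succ_ne_zero)

instance Submodule.finiteDimensional_pow_s2 {k A : Type*} [Field k] [Ring A] [Algebra k A]
    (W : Submodule k A) [FiniteDimensional k W] (n : ℕ) : FiniteDimensional k (W ^ n : Submodule k A) :=
  Module.Finite.iff_fg.2 ((Module.Finite.iff_fg.1 inferInstance).pow n)

variable {k κ Q : Type*} [Field k] [Field κ] [Algebra k κ] [DivisionRing Q]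
  [Algebra k Q] [Module κ Q] [IsScalarTower k κ Q] [IsScalarTower κ Q Q]

omit [IsScalarTower κ Q Q] in
theorem finiteDimensional_span_of_tower (W : Submodule k Q) [FiniteDimensional k W] :
    FiniteDimensional κ (Submodule.span κ (W : Set Q)) := by
  obtain ⟨s, rfl⟩ := Module.Finite.iff_fg.1 (inferInstance : Module.Finite k W)
  rw [Submodule.span_span_of_tower]
  exact FiniteDimensional.span_finset κ s

theorem mul_finrank_span_le {W : Submodule k Q} [FiniteDimensional k W] {t : κ}
    (ht : LinearIndependent k fun n : ℕ => t ^ n) (hW1 : 1 ∈ W)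
    (htW : t • (1 : Q) ∈ W) (l m : ℕ) :
    (m + 1) * Module.finrank κ (Submodule.span κ ((W ^ l : Submodule k Q) : Set Q)) ≤
      Module.finrank k (W ^ (l + m) : Submodule k Q) := by
  have := finiteDimensional_span_of_tower (κ := κ) (W ^ l)
  obtain ⟨f, hf, -, hli⟩ := Submodule.exists_fun_fin_finrank_span_eq κ
    ((W ^ l : Submodule k Q) : Set Q)
  have h1 : LinearIndependent k fun i : Fin (m + 1) => t ^ (i : ℕ) :=
    ht.comp _ Fin.val_injective
  have h2 := linearIndependent_smul h1 hli
  have hpow : ∀ i : ℕ, t ^ i • (1 : Q) ∈ W ^ i := fun i => by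
    induction i with
    | zero => simp
    | succ i ih =>
      have := Submodule.mul_mem_mul htW ih
      rwa [smul_mul_assoc, one_mul, smul_smul, ← pow_succ', ← pow_succ'] at this
  have hmem : ∀ p : Fin (m + 1) × _, t ^ (p.1 : ℕ) • f p.2 ∈ W ^ (l + m) := fun p => by
    have h3 := Submodule.mul_mem_mul (hpow p.1) (hf p.2)
    rw [smul_mul_assoc, one_mul, ← pow_add] at h3
    exact pow_le_pow_right₀ (Submodule.one_le.2 hW1) (by omega) h3
  have h3 : LinearIndependent k
      fun p : Fin (m + 1) × _ => (⟨_, hmem p⟩ : (W ^ (l + m) : Submodule k Q)) :=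
    LinearIndependent.of_comp (Submodule.subtype _) h2
  simpa using h3.fintype_card_le_finrank

theorem mul_finrank_le_finrank_polySpan [CharZero Q] {D : Module.End κ Q}
    (hD : ∀ a b, D (a * b) = a * D b + D a * b) {M : Submodule κ Q} [FiniteDimensional κ M]
    (hM : M ≤ LinearMap.ker D) {c x y : Q} (hy : D y = 1) (hc : c ≠ 0) (hDc : D c = 0)
    (hcy : c * y = x) (m : ℕ) :
    (m + 1) * Module.finrank κ M ≤ Module.finrank κ (M.polySpan x m) := by
  have hx : (D ^ 2) x = 0 := by
    rw [← hcy, pow_two, Module.End.mul_apply, hD, hy, hDc, zero_mul, add_zero, mul_one, hDc]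
  have hnil : ∀ j : ℕ, ∀ u ∈ M.polySpan x j, (D ^ (j + 1)) u = 0 := by
    intro j
    induction j with
    | zero => intro u hu; simpa using hM hu
    | succ j ih =>
      intro u hu
      obtain ⟨m, hm, v, ⟨v, hv, rfl⟩, rfl⟩ := Submodule.mem_sup.1 hu
      have h1 : (D ^ (j + 1 + 1)) m = 0 :=
        Module.End.pow_apply_eq_zero_of_le (m := 1) (by omega) (by simpa using hM hm)
      rw [map_add, h1, zero_add]
      exact Module.End.pow_apply_mul_eq_zero hD _ (ih _ hv) hx (by omega)
  induction m with
  | zero => rw [zero_add, one_mul]; exact le_rfl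
  | succ m ih =>
    have hx0 : x ≠ 0 := by
      rw [← hcy]
      refine mul_ne_zero hc fun h => one_ne_zero (α := Q) ?_
      rw [← hy, h, map_zero]
    have hdisj : Disjoint M ((M.polySpan x m).map (LinearMap.mulRight κ x)) := by
      rw [Submodule.disjoint_def]
      rintro _ hu ⟨v, hv, rfl⟩
      have h0 : D (v * c * y) = 0 := by rw [mul_assoc, hcy]; exact hM hu
      have h1 : v * c = 0 := eq_zero_of_map_mul_eq_zero hD hy
        (Module.End.pow_apply_mul_eq_zero hD (m + 1) (q := 1) (hnil m v hv) (by simpa using hDc)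
          (by omega)) h0
      rw [(mul_eq_zero.1 h1).resolve_right hc]
      simp
    have hinj : Function.Injective (LinearMap.mulRight κ x) := fun u v h =>
      mul_right_cancel₀ hx0 h
    have h1 := Submodule.finrank_sup_add_finrank_inf_eq M
      ((M.polySpan x m).map (LinearMap.mulRight κ x))
    rw [hdisj.eq_bot, finrank_bot, add_zero, ← (Submodule.equivMapOfInjective _ hinj _).finrank_eq] at h1
    calc (m + 1 + 1) * Module.finrank κ M = Module.finrank κ M + (m + 1) * Module.finrank κ M := by
          ring
      _ ≤ _ := by
        have h2 : Module.finrank κ (M.polySpan x (m + 1)) = _ := h1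
        omega

end RankBounds

section NatEstimates

theorem exists_mul_pow_lt_two_pow (B e E : ℕ) : ∃ i : ℕ, B * (i + e) ^ E < 2 ^ i := by
  have h := tendsto_pow_const_div_const_pow_of_one_lt E (one_lt_two : (1 : ℝ) < 2)
  have hpos : (0 : ℝ) < 1 / ((B + 1) * 2 ^ e) := by positivity
  obtain ⟨N, hN⟩ := Filter.eventually_atTop.1 (h.eventually (gt_mem_nhds hpos))
  refine ⟨N, ?_⟩
  have h1 := hN (N + e) (by omega)
  rw [div_lt_div_iff₀ (by positivity) (by positivity), one_mul, pow_add] at h1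
  have h2 : ((N + e : ℕ) : ℝ) ^ E * (B + 1) < 2 ^ N := by
    have : (0 : ℝ) < 2 ^ e := by positivity
    nlinarith
  have h3 : (N + e) ^ E * (B + 1) < 2 ^ N := by exact_mod_cast h2
  nlinarith [Nat.zero_le ((N + e) ^ E)]

theorem exists_plateau {r : ℕ → ℕ} (hr : Monotone r) {p C : ℕ} (hp : 1 ≤ p)
    (hrp : ∀ n, 1 ≤ n → r n ^ p ≤ C * n ^ (p - 1)) :
    ∃ B E : ℕ, ∀ L, 1 ≤ L → ∃ s, r (s * L) = r ((s + 1) * L) ∧ r (s * L) ≤ B * L ^ E := by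
  obtain ⟨p, rfl⟩ : ∃ q, p = q + 1 := ⟨p - 1, by omega⟩
  simp only [Nat.add_sub_cancel] at hrp
  refine ⟨C * (C + 1) ^ p, (p + 1) * p, fun L hL => ?_⟩
  set t := C * L ^ p with ht
  have hex : ∃ s ≤ t, r (s * L) = r ((s + 1) * L) := by
    by_contra! hcon
    have hlow : ∀ s ≤ t + 1, s ≤ r (s * L) := by
      intro s
      induction s with
      | zero => simp
      | succ s ih =>
        intro hs
        have h1 := hr (Nat.mul_le_mul_right L (Nat.le_succ s))
        have h2 := hcon s (by omega)
        have h3 := ih (by omega)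
        simp only [Nat.succ_eq_add_one] at h1
        omega
    have h1 := hrp ((t + 1) * L) (Nat.mul_pos t.succ_pos hL)
    have h2 := Nat.pow_le_pow_left (hlow (t + 1) le_rfl) (p + 1)
    rw [mul_pow, ← mul_assoc, mul_comm C, mul_assoc, ← ht] at h1
    have h3 := h2.trans h1
    rw [pow_succ] at h3
    have := Nat.le_of_mul_le_mul_left h3 (by positivity)
    omega
  obtain ⟨s, hs, hrs⟩ := hex
  refine ⟨s, hrs, ?_⟩
  have htL : (t + 1) * L ≤ (C + 1) * L ^ (p + 1) := by
    have : 1 ≤ L ^ p := Nat.one_le_pow _ _ hL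
    rw [pow_succ, ← mul_assoc]
    exact Nat.mul_le_mul_right _ (by rw [ht]; nlinarith)
  calc r (s * L) ≤ r ((t + 1) * L) := hr (Nat.mul_le_mul_right _ (by omega))
    _ ≤ r ((t + 1) * L) ^ (p + 1) := Nat.le_self_pow (by omega) _
    _ ≤ C * ((t + 1) * L) ^ p := hrp _ (Nat.mul_pos t.succ_pos hL)
    _ ≤ C * ((C + 1) * L ^ (p + 1)) ^ p := by gcongr
    _ = _ := by rw [mul_pow, ← pow_mul, mul_assoc]

end NatEstimates

section Subfields

variable {κ Q : Type*} [Field κ] [DivisionRing Q] [Module κ Q] [IsScalarTower κ Q Q]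

/-- A division subring closed under scalar multiplication, as a subspace. -/
def Subfield.toSubspace (S : Subfield Q) (hS : ∀ s : κ, s • (1 : Q) ∈ S) : Submodule κ Q where
  carrier := S
  add_mem' := S.add_mem
  zero_mem' := S.zero_mem
  smul_mem' s q hq := by
    rw [← one_mul q, ← smul_mul_assoc]
    exact S.mul_mem (hS s) hq

/-- The division subring of elements stabilizing a finite-dimensional subspace by right
multiplication. -/
def Submodule.rightStabilizer (M : Submodule κ Q) [FiniteDimensional κ M] : Subfield Q where
  carrier := {q | ∀ u ∈ M, u * q ∈ M}
  mul_mem' ha hb u hu := by rw [← mul_assoc]; exact hb _ (ha u hu)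
  one_mem' u hu := by rwa [mul_one]
  add_mem' ha hb u hu := by rw [mul_add]; exact M.add_mem (ha u hu) (hb u hu)
  zero_mem' u _ := by rw [mul_zero]; exact M.zero_mem
  neg_mem' ha u hu := by rw [mul_neg]; exact M.neg_mem (ha u hu)
  inv_mem' q hq u hu := by
    rcases eq_or_ne q 0 with rfl | h0
    · rw [inv_zero, mul_zero]; exact M.zero_mem
    · obtain ⟨v, hv, rfl⟩ := Submodule.exists_mul_eq_of_mul_mem h0 hq hu
      rwa [mul_inv_cancel_right₀ h0]

theorem Subfield.two_mul_finrank_toSubspace_le {S T : Subfield Q}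
    (hS : ∀ s : κ, s • (1 : Q) ∈ S) (hT : ∀ s : κ, s • (1 : Q) ∈ T)
    [FiniteDimensional κ (T.toSubspace hT)] (hST : S < T) :
    2 * Module.finrank κ (S.toSubspace hS) ≤ Module.finrank κ (T.toSubspace hT) := by
  obtain ⟨g, hgT, hgS⟩ := SetLike.exists_of_lt hST
  have hg0 : g ≠ 0 := fun h => hgS (h ▸ S.zero_mem)
  have hle : S.toSubspace hS ≤ T.toSubspace hT := fun q hq => hST.le hq
  have hfd : FiniteDimensional κ (S.toSubspace hS) := Submodule.finiteDimensional_of_le hle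
  have hdisj : Disjoint (S.toSubspace hS)
      ((S.toSubspace hS).map (LinearMap.mulRight κ g)) := by
    rw [Submodule.disjoint_def]
    rintro _ hu ⟨v, hv, rfl⟩
    by_contra h0
    have hv0 : v ≠ 0 := by rintro rfl; simp at h0
    refine hgS ?_
    have := S.mul_mem (S.inv_mem hv) hu
    rwa [LinearMap.mulRight_apply, inv_mul_cancel_left₀ hv0] at this
  have hinj : Function.Injective (LinearMap.mulRight κ g) := fun u v h =>
    mul_right_cancel₀ hg0 h
  have h1 := Submodule.finrank_sup_add_finrank_inf_eq (S.toSubspace hS)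
    ((S.toSubspace hS).map (LinearMap.mulRight κ g))
  rw [hdisj.eq_bot, finrank_bot, add_zero,
    ← (Submodule.equivMapOfInjective _ hinj _).finrank_eq, ← two_mul] at h1
  rw [← h1]
  refine Submodule.finrank_mono (sup_le hle ?_)
  rintro _ ⟨v, hv, rfl⟩
  exact T.mul_mem (hST.le hv) hgT

/-- A monotone sequence of division subrings of polynomially bounded dimension has two equal
consecutive terms. -/
theorem Subfield.exists_eq_succ {S : ℕ → Subfield Q} (hmono : Monotone S)
    (hS : ∀ i, ∀ s : κ, s • (1 : Q) ∈ S i)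
    (hfd : ∀ i, FiniteDimensional κ ((S i).toSubspace (hS i))) {B e E : ℕ}
    (hle : ∀ i, Module.finrank κ ((S i).toSubspace (hS i)) ≤ B * (i + e) ^ E) :
    ∃ i, S i = S (i + 1) := by
  by_contra! hne
  have hlow : ∀ i, 2 ^ i ≤ Module.finrank κ ((S i).toSubspace (hS i)) := by
    intro i
    induction i with
    | zero =>
      have : Nontrivial ((S 0).toSubspace (hS 0)) :=
        ⟨⟨1, (S 0).one_mem⟩, 0, fun h => one_ne_zero (congrArg Subtype.val h)⟩
      exact Module.finrank_pos
    | succ i ih =>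
      rw [pow_succ']
      exact (Nat.mul_le_mul_left 2 ih).trans (Subfield.two_mul_finrank_toSubspace_le (hS i)
        (hS (i + 1)) ((hmono i.le_succ).lt_of_ne (hne i)))
  obtain ⟨i, hi⟩ := exists_mul_pow_lt_two_pow B e E
  exact absurd ((hlow i).trans (hle i)) (by omega)

theorem Subfield.commutator_mem_of_mem_closure {s : Set Q} {S : Subfield Q} (y : Q)
    (hle : Subfield.closure s ≤ S) (hs : ∀ q ∈ s, y * q - q * y ∈ S) {q : Q}
    (hq : q ∈ Subfield.closure s) : y * q - q * y ∈ S := by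
  induction hq using Subfield.closure_induction with
  | mem q hq => exact hs q hq
  | one => simp
  | add a b _ _ iha ihb =>
    have := S.add_mem iha ihb
    convert this using 1
    noncomm_ring
  | neg a _ ih =>
    have := S.neg_mem ih
    convert this using 1
    noncomm_ring
  | inv a ha ih =>
    rcases eq_or_ne a 0 with rfl | h0
    · simp
    have := S.neg_mem (S.mul_mem (S.mul_mem (S.inv_mem (hle ha)) ih) (S.inv_mem (hle ha)))
    convert this using 1
    rw [mul_sub, sub_mul, ← mul_assoc, mul_inv_cancel_right₀ h0, inv_mul_cancel_left₀ h0]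
    abel
  | mul a b ha hb iha ihb =>
    have := S.add_mem (S.mul_mem iha (hle hb)) (S.mul_mem (hle ha) ihb)
    convert this using 1
    noncomm_ring

end Subfields

section Stabilization

theorem dixmier_eq_self {k S Q : Type*} [Field k] [Semiring S] [Ring Q] [Module k Q] [Module S Q]
    {δ : Module.End S Q} {y : Q} {d : ℕ} {w : Q} (hw : δ w = 0) : dixmier k δ y d w = w := by
  rw [dixmier, Finset.sum_range_succ', Finset.sum_eq_zero]
  · simp
  · intro i _
    rw [pow_succ δ, Module.End.mul_apply, hw, map_zero, zero_mul, smul_zero]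

variable {k κ Q : Type*} [Field k] [CharZero k] [Field κ] [Algebra k κ] [DivisionRing Q]
  [Algebra k Q] [Module κ Q] [IsScalarTower k κ Q] [IsScalarTower κ Q Q]

omit [CharZero k] [Algebra k κ] [IsScalarTower k κ Q] in
theorem mul_mem_span_pow {W : Submodule k Q} {n : ℕ} {u w : Q}
    (hu : u ∈ Submodule.span κ ((W ^ n : Submodule k Q) : Set Q)) (hw : w ∈ W) :
    u * w ∈ Submodule.span κ ((W ^ (n + 1) : Submodule k Q) : Set Q) := by
  have : Submodule.span κ ((W ^ n : Submodule k Q) : Set Q) ≤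
      (Submodule.span κ ((W ^ (n + 1) : Submodule k Q) : Set Q)).comap
        (LinearMap.mulRight κ w) :=
    Submodule.span_le.2 fun v hv => Submodule.subset_span (by
      rw [pow_succ]; exact Submodule.mul_mem_mul hv hw)
  exact this hu

omit [CharZero k] [IsScalarTower κ Q Q] in
theorem map_mem_span_pow {W : Submodule k Q} {D : Module.End κ Q}
    (hD : ∀ a b, D (a * b) = a * D b + D a * b) (hWD : ∀ w ∈ W, D w ∈ W) {n : ℕ} {u : Q}
    (hu : u ∈ Submodule.span κ ((W ^ n : Submodule k Q) : Set Q)) :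
    D u ∈ Submodule.span κ ((W ^ n : Submodule k Q) : Set Q) := by
  have hmem : ∀ n, ∀ u ∈ W ^ n, D u ∈ W ^ n := by
    intro n
    induction n with
    | zero =>
      intro u hu
      rw [pow_zero] at hu ⊢
      obtain ⟨r, rfl⟩ := Submodule.mem_one.1 hu
      rw [Algebra.algebraMap_eq_smul_one, LinearMap.map_smul_of_tower,
        Module.End.map_one_eq_zero hD, smul_zero]
      exact Submodule.zero_mem _
    | succ n ih =>
      intro u hu
      rw [pow_succ] at hu ⊢
      refine Submodule.mul_induction_on hu (fun a ha b hb => ?_) fun a b ha hb => ?_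
      · rw [hD]
        exact Submodule.add_mem _ (Submodule.mul_mem_mul ha (hWD b hb))
          (Submodule.mul_mem_mul (ih a ha) hb)
      · rw [map_add]
        exact Submodule.add_mem _ ha hb
  have : Submodule.span κ ((W ^ n : Submodule k Q) : Set Q) ≤
      (Submodule.span κ ((W ^ n : Submodule k Q) : Set Q)).comap D :=
    Submodule.span_le.2 fun v hv => Submodule.subset_span (hmem n v hv)
  exact this hu

theorem exists_subfield_of_growth_s2 {D : Module.End κ Q}
    (hD : ∀ a b, D (a * b) = a * D b + D a * b) {W : Submodule k Q} [FiniteDimensional k W]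
    (hW1 : 1 ∈ W) (hWD : ∀ w ∈ W, D w ∈ W) {d : ℕ} (hWd : ∀ w ∈ W, (D ^ (d + 1)) w = 0)
    {c x y : Q} (hc : c ≠ 0) (hcW : c ∈ W) (hxW : x ∈ W) (hDc : D c = 0) (hcy : c * y = x)
    (hy : D y = 1) {t : κ} (ht : LinearIndependent k fun n : ℕ => t ^ n)
    (htW : t • (1 : Q) ∈ W)
    (hκ : ∀ S : Subfield Q, (∀ r : k, algebraMap k Q r ∈ S) → t • (1 : Q) ∈ S →
      ∀ s : κ, s • (1 : Q) ∈ S) {p C : ℕ} (hp : 1 ≤ p)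
    (hgr : ∀ n, 1 ≤ n →
      Module.finrank k (W ^ (3 * n) : Submodule k Q) ^ p ≤ C * n ^ (3 * p - 1)) :
    ∃ (S : Subfield Q) (hS : ∀ s : κ, s • (1 : Q) ∈ S), FiniteDimensional κ (S.toSubspace hS) ∧
      (∀ q ∈ S, y * q - q * y ∈ S) ∧ ∀ w ∈ W, dixmier k D y d w ∈ S := by
  have : CharZero κ := charZero_of_injective_algebraMap (algebraMap k κ).injective
  have : CharZero Q := charZero_of_injective_algebraMap (algebraMap k Q).injective
  have hD1 := Module.End.map_one_eq_zero hD
  let N : ℕ → Submodule κ Q := fun n => Submodule.span κ ((W ^ n : Submodule k Q) : Set Q)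
  have hNfd : ∀ n, FiniteDimensional κ (N n) := fun n => finiteDimensional_span_of_tower _
  have hN : Monotone N := fun m n hmn =>
    Submodule.span_mono (pow_le_pow_right₀ (Submodule.one_le.2 hW1) hmn)
  have hN1 : ∀ n, (1 : Q) ∈ N n := fun n => hN n.zero_le (Submodule.subset_span (by simp))
  have hND : ∀ n, ∀ u ∈ N n, D u ∈ N n := fun n u hu => map_mem_span_pow hD hWD hu
  have hNW : ∀ w ∈ W, ∀ n, ∀ u ∈ N n, u * w ∈ N (n + 1) := fun w hw n u hu =>
    mul_mem_span_pow hu hw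
  let M : ℕ → Submodule κ Q := fun n => N n ⊓ LinearMap.ker D
  have hMfd : ∀ n, FiniteDimensional κ (M n) := fun n =>
    Submodule.finiteDimensional_of_le (inf_le_left : M n ≤ N n)
  have hM : Monotone M := fun m n hmn => inf_le_inf_right _ (hN hmn)
  have hr : Monotone fun n => Module.finrank κ (M n) := fun m n hmn =>
    Submodule.finrank_mono (hM hmn)
  have hrank : ∀ n, (n + 1) ^ 2 * Module.finrank κ (M n) ≤
      Module.finrank k (W ^ (3 * n) : Submodule k Q) := by
    intro n
    have hP : ∀ j, (M n).polySpan x j ≤ N (n + j) := by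
      intro j
      induction j with
      | zero => exact inf_le_left
      | succ j ih =>
        refine sup_le (inf_le_left.trans (hN (by omega))) ?_
        rintro _ ⟨v, hv, rfl⟩
        exact hNW x hxW _ v (ih hv)
    have h1 := mul_finrank_le_finrank_polySpan hD (M := M n) inf_le_right hy hc hDc hcy n
    have h2 := h1.trans (Submodule.finrank_mono (hP n))
    have h3 := mul_finrank_span_le ht hW1 htW (n + n) n
    rw [show n + n + n = 3 * n by ring] at h3
    refine le_trans ?_ h3
    rw [pow_two, mul_assoc]
    exact Nat.mul_le_mul_left _ h2
  have hrp : ∀ n, 1 ≤ n → Module.finrank κ (M n) ^ p ≤ C * n ^ (p - 1) := by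
    intro n hn
    have h1 := (Nat.pow_le_pow_left (hrank n) p).trans (hgr n hn)
    have h2 : (n ^ 2) ^ p * Module.finrank κ (M n) ^ p ≤ (n ^ 2) ^ p * (C * n ^ (p - 1)) := by
      calc _ ≤ ((n + 1) ^ 2 * Module.finrank κ (M n)) ^ p := by
            rw [mul_pow]
            gcongr
            omega
        _ ≤ _ := h1
        _ = _ := by
          rw [← pow_mul, show 3 * p - 1 = 2 * p + (p - 1) by omega, pow_add]
          ring
    exact Nat.le_of_mul_le_mul_left h2 (by positivity)
  obtain ⟨B, E, hBE⟩ := exists_plateau hr hp hrp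
  let G : ℕ → Set Q := fun i =>
    {q | ∃ j ≤ i, ∃ w ∈ W, (fun q => y * q - q * y)^[j] (dixmier k D y d w) = q}
  have hG : Monotone G := by
    rintro i i' hi _ ⟨j, hj, w, hw, rfl⟩
    exact ⟨j, hj.trans hi, w, hw, rfl⟩
  have hGW : ∀ i, ∀ w ∈ W, dixmier k D y d w ∈ G i := fun i w hw => ⟨0, i.zero_le, w, hw, rfl⟩
  have hS : ∀ i, ∀ s : κ, s • (1 : Q) ∈ Subfield.closure (G i) := by
    intro i
    refine hκ _ (fun r => Subfield.subset_closure ?_) (Subfield.subset_closure ?_)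
    · have h := hGW i (r • 1) (W.smul_mem r hW1)
      rwa [dixmier_eq_self (by rw [LinearMap.map_smul_of_tower, hD1, smul_zero]),
        ← Algebra.algebraMap_eq_smul_one] at h
    · have h := hGW i _ htW
      rwa [dixmier_eq_self (by rw [map_smul, hD1, smul_zero])] at h
  have hSM : ∀ i, ∃ s, (Subfield.closure (G i)).toSubspace (hS i) ≤ M s ∧
      Module.finrank κ (M s) ≤ B * (i + (2 * d + 1)) ^ E := by
    intro i
    obtain ⟨s, hs, hsB⟩ := hBE (i + (2 * d + 1)) (by omega)
    set L := i + (2 * d + 1) with hL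
    refine ⟨s * L, ?_, hsB⟩
    have hMeq : M (s * L) = M ((s + 1) * L) :=
      Submodule.eq_of_le_of_finrank_eq (hM (Nat.mul_le_mul_right _ s.le_succ)) hs
    have hstab : Subfield.closure (G i) ≤ (M (s * L)).rightStabilizer := by
      rw [Subfield.closure_le]
      rintro _ ⟨j, hj, w, hw, rfl⟩ u hu
      have hDi : ∀ i, (D ^ i) w ∈ W := by
        intro i
        induction i with
        | zero => simpa
        | succ i ih => rw [pow_succ', Module.End.mul_apply]; exact hWD _ ih
      refine mul_commutator_dixmier_mem (k := k) (N := fun n => N (s * L + n)) (M := M (s * L))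
        (L := L) hD (fun m n hmn => hN (by omega)) (hND _) ?_ inf_le_right inf_le_left hy hc hDc
        hcy (fun n => hNW c hcW _) (fun n => hNW x hxW _) (hWd w hw)
        (fun i n => hNW _ (hDi i) _) (by omega) hu
      rw [hMeq, Nat.succ_mul]
    intro q hq
    rw [← one_mul q]
    exact hstab hq 1 ⟨hN1 _, hD1⟩
  have hSfd : ∀ i, FiniteDimensional κ ((Subfield.closure (G i)).toSubspace (hS i)) := fun i =>
    have ⟨s, hs, _⟩ := hSM i
    Submodule.finiteDimensional_of_le hs
  obtain ⟨i, hi⟩ := Subfield.exists_eq_succ (fun i j hij => Subfield.closure_mono (hG hij)) hS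
    hSfd (fun i => have ⟨s, hs, hsB⟩ := hSM i; (Submodule.finrank_mono hs).trans hsB)
  refine ⟨_, hS i, hSfd i, fun q hq => ?_, fun w hw => Subfield.subset_closure (hGW i w hw)⟩
  refine Subfield.commutator_mem_of_mem_closure y le_rfl ?_ hq
  rintro _ ⟨j, hj, w, hw, rfl⟩
  rw [hi]
  refine Subfield.subset_closure ⟨j + 1, by omega, w, hw, ?_⟩
  rw [Function.iterate_succ_apply']

end Stabilization

section RatFunc

open Polynomial

theorem mem_range_algebraMap_of_isAlgebraic {k E : Type*} [Field k] [IsAlgClosed k] [Ring E]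
    [IsDomain E] [Algebra k E] {z : E} (hz : IsAlgebraic k z) : z ∈ (algebraMap k E).range :=
  minpoly.mem_range_of_degree_eq_one k z
    (IsAlgClosed.degree_eq_one_of_irreducible k (minpoly.irreducible hz.isIntegral))

variable {k E : Type*} [Field k] [DivisionRing E] [Algebra k E]

theorem Transcendental.exists_ratFunc_algHom {a : E} (ha : Transcendental k a) :
    ∃ φ : RatFunc k →ₐ[k] E, φ RatFunc.X = a := by
  let C := Subalgebra.centralizer k (Set.centralizer {a})
  have haC : a ∈ C := Set.subset_centralizer_centralizer rfl
  have hC : IsField C := by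
    refine ⟨⟨0, 1, zero_ne_one⟩, fun u v => Subtype.ext ?_, fun {u} hu => ?_⟩
    · refine (Set.mem_centralizer_iff.1 u.2 v ?_).symm
      exact Set.centralizer_subset (Set.singleton_subset_iff.2 (Set.mem_centralizer_iff.2
        (by simp))) v.2
    · have hu0 : (u : E) ≠ 0 := fun h => hu (Subtype.ext h)
      exact ⟨⟨(u : E)⁻¹, Set.inv_mem_centralizer₀ u.2⟩, Subtype.ext (mul_inv_cancel₀ hu0)⟩
  let := hC.toField
  let ψ : k[X] →ₐ[k] C := Polynomial.aeval ⟨a, haC⟩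
  have hψ : ∀ p, ((ψ p : C) : E) = Polynomial.aeval a p := fun p => by
    have := Polynomial.aeval_algHom_apply C.val ⟨a, haC⟩ p
    exact this.symm
  have hinj : Function.Injective ψ := by
    rw [injective_iff_map_eq_zero]
    intro p hp
    by_contra h0
    refine ha (show IsAlgebraic k a from ⟨p, h0, ?_⟩)
    rw [← hψ, hp]
    rfl
  refine ⟨C.val.comp (RatFunc.liftAlgHom ψ
    (nonZeroDivisors_le_comap_nonZeroDivisors_of_injective ψ hinj)), ?_⟩
  rw [AlgHom.comp_apply, ← RatFunc.algebraMap_X, RatFunc.liftAlgHom_apply]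
  simp [ψ]

theorem Transcendental.linearIndependent_pow {a : E} (ha : Transcendental k a) :
    LinearIndependent k fun n : ℕ => a ^ n := by
  have h := (basisMonomials k).linearIndependent.map' (Polynomial.aeval a).toLinearMap
    (LinearMap.ker_eq_bot.2 (transcendental_iff_injective.1 ha))
  have hfun : (fun n : ℕ => a ^ n) = (Polynomial.aeval a).toLinearMap ∘ basisMonomials k := by
    ext n
    simp [← C_mul_X_pow_eq_monomial]
  rw [hfun]
  exact h

theorem map_algebraMap_eq_aeval (φ : RatFunc k →ₐ[k] E) (p : k[X]) :
    φ (algebraMap k[X] (RatFunc k) p) = aeval (φ RatFunc.X) p := by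
  have : φ.comp (IsScalarTower.toAlgHom k k[X] (RatFunc k)) = aeval (φ RatFunc.X) := by
    ext
    simp
  exact DFunLike.congr_fun this p

theorem map_ratFunc_mem (φ : RatFunc k →ₐ[k] E) {S : Subfield E}
    (hS : ∀ r : k, algebraMap k E r ∈ S) (hX : φ RatFunc.X ∈ S) (s : RatFunc k) : φ s ∈ S := by
  have h : ∀ p : k[X], φ (algebraMap k[X] (RatFunc k) p) ∈ S := fun p => by
    rw [map_algebraMap_eq_aeval]
    induction p using Polynomial.induction_on with
    | C r => simpa using hS r
    | add p q hp hq => rw [map_add]; exact S.add_mem hp hq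
    | monomial n r _ =>
      rw [map_mul, aeval_C, map_pow, aeval_X]
      exact S.mul_mem (hS r) (S.pow_mem hX _)
  rw [← RatFunc.num_div_denom s, map_div₀]
  exact S.div_mem (h _) (h _)

theorem commute_map_ratFunc (φ : RatFunc k →ₐ[k] E) (hX : ∀ v, Commute (φ RatFunc.X) v)
    (s : RatFunc k) (v : E) : Commute (φ s) v := by
  let S : Subfield E :=
    { Subring.centralizer {v} with
      inv_mem' := fun _ => Set.inv_mem_centralizer₀ }
  have hS : ∀ u : E, u ∈ S ↔ Commute v u := fun u => by
    refine Subring.mem_centralizer_iff.trans ⟨fun h => h v rfl, ?_⟩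
    rintro h _ rfl
    exact h
  exact ((hS _).1 (map_ratFunc_mem φ (fun r => (hS _).2 (Algebra.commutes r v).symm)
    ((hS _).2 (hX v).symm) s)).symm

end RatFunc

section Amitsur

variable {k E ι : Type*} [Field k] [DivisionRing E] [Algebra k E]

/-- Amitsur's lemma: over a division ring with centre `k`, the maps `v ↦ v * c i` are left linearly
independent when the `c i` are linearly independent over `k`. -/
theorem eq_zero_of_forall_sum_mul_mul_eq_zero
    (hk : ∀ z : E, (∀ v, v * z = z * v) → z ∈ (algebraMap k E).range) {c : ι → E}
    (hc : LinearIndependent k c) {s : Finset ι} :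
    ∀ p : ι → E, (∀ v, ∑ i ∈ s, p i * v * c i = 0) → ∀ i ∈ s, p i = 0 := by
  classical
  induction s using Finset.induction_on with
  | empty => simp
  | insert j s hj ih =>
    intro p hp
    simp only [Finset.sum_insert hj] at hp
    have hpj : p j = 0 := by
      by_contra h0
      have hq : ∀ v, v * c j = -∑ i ∈ s, (p j)⁻¹ * p i * v * c i := fun v => by
        have := congrArg ((p j)⁻¹ * ·) (hp v)
        simp only [mul_add, mul_zero, Finset.mul_sum, ← mul_assoc, inv_mul_cancel₀ h0,
          one_mul] at this
        exact eq_neg_of_add_eq_zero_left this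
      have hcentral : ∀ i ∈ s, (p j)⁻¹ * p i ∈ (algebraMap k E).range := by
        intro i hi
        refine hk _ fun v => sub_eq_zero.1 ?_
        refine ih (fun i => v * ((p j)⁻¹ * p i) - (p j)⁻¹ * p i * v) (fun u => ?_) i hi
        have h1 := hq (v * u)
        rw [mul_assoc, hq u, mul_neg, neg_inj, Finset.mul_sum] at h1
        rw [← sub_eq_zero.2 h1, ← Finset.sum_sub_distrib]
        exact Finset.sum_congr rfl fun i _ => by noncomm_ring
      choose! r hr using hcentral
      have h1 : ∑ i ∈ insert j s, (if i = j then 1 else r i) • c i = 0 := by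
        rw [Finset.sum_insert hj, if_pos rfl, one_smul, ← one_mul (c j), hq 1,
          neg_add_eq_zero]
        refine Finset.sum_congr rfl fun i hi => ?_
        rw [if_neg (by rintro rfl; exact hj hi), mul_one, ← hr i hi, Algebra.smul_def]
      have := linearIndependent_iff'.1 hc _ _ h1 j (Finset.mem_insert_self j s)
      simp at this
    intro i hi
    rcases Finset.mem_insert.1 hi with rfl | hi
    · exact hpj
    · exact ih p (fun v => by simpa [hpj] using hp v) i hi

theorem exists_central_of_transcendental (κ : Type*) [Field κ] [Module κ E] [IsScalarTower κ E E]
    [FiniteDimensional κ E] {a : E} (ha : Transcendental k a) :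
    ∃ z : E, (∀ v, v * z = z * v) ∧ z ∉ (algebraMap k E).range := by
  by_contra! hk
  set n := Module.finrank κ (E →ₗ[κ] E)
  have hli : LinearIndependent k fun i : Fin (n + 1) => a ^ (i : ℕ) :=
    (ha.linearIndependent_pow).comp _ Fin.val_injective
  have hdep : ¬ LinearIndependent κ fun i : Fin (n + 1) => LinearMap.mulRight κ (a ^ (i : ℕ)) :=
    fun h => by simpa [n] using h.fintype_card_le_finrank
  obtain ⟨g, hg, i, hi⟩ := Fintype.not_linearIndependent_iff.1 hdep
  refine hi ?_
  have h1 := eq_zero_of_forall_sum_mul_mul_eq_zero hk hli (s := Finset.univ)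
    (fun i => g i • (1 : E)) (fun v => by
      have := LinearMap.congr_fun hg v
      simpa [smul_mul_assoc] using this) i (Finset.mem_univ i)
  exact (smul_eq_zero.1 h1).resolve_right one_ne_zero

end Amitsur

section CentralFinite

open Polynomial

variable {k E : Type*} [Field k] [DivisionRing E] [Algebra k E]

theorem RatFunc.exists_common_denominator {ι : Type*} [Fintype ι] (g : ι → RatFunc k) :
    ∃ q : k[X], q ≠ 0 ∧ ∃ p : ι → k[X], ∀ i,
      algebraMap k[X] (RatFunc k) q * g i = algebraMap k[X] (RatFunc k) (p i) := by
  obtain ⟨q, hq⟩ := IsLocalization.exist_integer_multiples_of_finite (nonZeroDivisors k[X]) g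
  choose p hp using hq
  exact ⟨q, nonZeroDivisors.ne_zero q.2, p, fun i => by rw [hp, Algebra.smul_def]⟩

theorem exists_sum_aeval_mul_pow_eq_zero (φ : RatFunc k →ₐ[k] E) [Module (RatFunc k) E]
    [FiniteDimensional (RatFunc k) E] (hφ : ∀ (s : RatFunc k) (v : E), s • v = φ s * v) (z : E) :
    ∃ (n : ℕ) (p : Fin n → k[X]), p ≠ 0 ∧ ∑ i, aeval (φ RatFunc.X) (p i) * z ^ (i : ℕ) = 0 := by
  set n := Module.finrank (RatFunc k) E
  have hdep : ¬ LinearIndependent (RatFunc k) fun i : Fin (n + 1) => z ^ (i : ℕ) :=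
    fun h => by simpa [n] using h.fintype_card_le_finrank
  obtain ⟨g, hg, i, hi⟩ := Fintype.not_linearIndependent_iff.1 hdep
  obtain ⟨q, hq, p, hp⟩ := RatFunc.exists_common_denominator g
  refine ⟨n + 1, p, fun h0 => ?_, ?_⟩
  · have := hp i
    rw [h0, Pi.zero_apply, map_zero, mul_eq_zero] at this
    exact this.elim (RatFunc.algebraMap_ne_zero hq) hi
  · have := congrArg (algebraMap k[X] (RatFunc k) q • ·) hg
    simp only [Finset.smul_sum, smul_smul, hp, smul_zero] at this
    rw [← this]
    exact Finset.sum_congr rfl fun i _ => by rw [hφ, map_algebraMap_eq_aeval]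

theorem finiteDimensional_of_isAlgebraic {K : Type*} [Field K] [Algebra k K] [Algebra K E]
    [IsScalarTower k K E] (φ : RatFunc k →ₐ[k] E) (ha : IsAlgebraic K (φ RatFunc.X)) {ι : Type*}
    [Fintype ι] {e : ι → E} (he : ∀ v, ∃ s : ι → RatFunc k, v = ∑ i, φ (s i) * e i) :
    FiniteDimensional K E := by
  set a := φ RatFunc.X with haX
  let M := Subalgebra.toSubmodule (Algebra.adjoin K {a})
  have hMfd : FiniteDimensional K M := Module.Finite.iff_fg.2 ha.isIntegral.fg_adjoin_singleton
  have hM : ∀ s, φ s ∈ M := fun s => by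
    rw [← one_mul (φ s)]
    refine map_ratFunc_mem φ (S := M.rightStabilizer) (fun r u hu => ?_) (fun u hu => ?_) s 1
      (one_mem (Algebra.adjoin K {a}))
    · rw [← Algebra.commutes, ← Algebra.smul_def]
      exact Submodule.smul_of_tower_mem M r hu
    · exact mul_mem (S := Subalgebra K E) hu (Algebra.subset_adjoin rfl)
  have htop : ⨆ i, M.map (LinearMap.mulRight K (e i)) = ⊤ := by
    rw [eq_top_iff]
    intro v _
    obtain ⟨s, rfl⟩ := he v
    exact Submodule.sum_mem _ fun i _ => Submodule.mem_iSup_of_mem i ⟨_, hM _, rfl⟩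
  refine Module.finite_def.2 ?_
  rw [← htop]
  exact Module.Finite.iff_fg.1 inferInstance

theorem exists_family_over_central (φ ψ : RatFunc k →ₐ[k] E)
    (hψ : ∀ v, Commute (ψ RatFunc.X) v) [Module (RatFunc k) E] [FiniteDimensional (RatFunc k) E]
    (hφ : ∀ (s : RatFunc k) (v : E), s • v = φ s * v) :
    ∃ (m : ℕ) (b : Fin m → E), ∀ v, ∃ (q : k[X]) (p : Fin m → k[X]), q ≠ 0 ∧
      aeval (ψ RatFunc.X) q * v = ∑ i, aeval (ψ RatFunc.X) (p i) * b i := by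
  obtain ⟨n, p, hp, hsum⟩ := exists_sum_aeval_mul_pow_eq_zero φ hφ (ψ RatFunc.X)
  obtain ⟨r, e, he⟩ : ∃ (r : ℕ) (e : Fin r → E), ∀ v, ∃ s : Fin r → RatFunc k,
      v = ∑ i, φ (s i) * e i := by
    let b := Module.finBasis (RatFunc k) E
    refine ⟨_, b, fun v => ⟨b.repr v, (b.sum_repr v).symm.trans ?_⟩⟩
    simp only [hφ]
  rename_i inst1 inst2
  clear hφ inst2
  clear inst1
  let _ : Algebra (RatFunc k) E := ψ.toRingHom.toAlgebra' fun s v => commute_map_ratFunc ψ hψ s v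
  have hsmul : ∀ (s : RatFunc k) (v : E), s • v = ψ s * v := fun s v => rfl
  have : IsScalarTower k (RatFunc k) E := IsScalarTower.of_algebraMap_eq fun r =>
    (ψ.commutes r).symm
  have halg : IsAlgebraic (RatFunc k) (φ RatFunc.X) := by
    refine ⟨∑ i, (p i).map (algebraMap k (RatFunc k)) * C (RatFunc.X ^ (i : ℕ)), ?_, ?_⟩
    · obtain ⟨i, hi⟩ := Function.ne_iff.1 hp
      obtain ⟨j, hj⟩ : ∃ j, (p i).coeff j ≠ 0 := by
        by_contra! h
        exact hi (Polynomial.ext h)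
      intro h0
      have h1 := congrArg (coeff · j) h0
      simp only [finsetSum_coeff, coeff_mul_C, coeff_map, coeff_zero, ← Algebra.smul_def] at h1
      exact hj (Fintype.linearIndependent_iff.1
        ((RatFunc.transcendental_X (K := k)).linearIndependent_pow.comp _ Fin.val_injective)
        (fun i => (p i).coeff j) h1 i)
    · rw [← hsum, map_sum]
      refine Finset.sum_congr rfl fun i _ => ?_
      rw [map_mul, aeval_map_algebraMap, aeval_C, map_pow]
      rfl
  have := finiteDimensional_of_isAlgebraic φ halg he
  let b := Module.finBasis (RatFunc k) E
  refine ⟨_, b, fun v => ?_⟩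
  obtain ⟨q, hq, p, hp⟩ := RatFunc.exists_common_denominator (b.repr v)
  refine ⟨q, p, hq, ?_⟩
  simp only [← map_algebraMap_eq_aeval, ← hp, ← hsmul]
  conv_lhs => rw [← b.sum_repr v]
  simp only [Finset.smul_sum, smul_smul]

end CentralFinite

section OreGrowth

variable {k Q : Type*} [Field k] [DivisionRing Q] [Algebra k Q]

/-- The sum of the subspaces `G (2 * (t - j)) * y ^ j` for `j ≤ t`. -/
def skewFiltration (G : ℕ → Submodule k Q) (y : Q) : ℕ → Submodule k Q
  | 0 => G 0
  | t + 1 => G (2 * (t + 1)) ⊔ (skewFiltration G y t).map (LinearMap.mulRight k y)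

variable {G : ℕ → Submodule k Q} {y : Q}

theorem le_skewFiltration (t : ℕ) : G (2 * t) ≤ skewFiltration G y t := by
  cases t with
  | zero => exact le_rfl
  | succ t => exact le_sup_left

theorem mul_mem_skewFiltration_succ {t : ℕ} {v : Q} (hv : v ∈ skewFiltration G y t) :
    v * y ∈ skewFiltration G y (t + 1) :=
  Submodule.mem_sup_right ⟨v, hv, rfl⟩

theorem skewFiltration_mono (hG : Monotone G) : Monotone (skewFiltration G y) := by
  refine monotone_nat_of_le_succ fun t => ?_
  induction t with
  | zero => exact (hG (Nat.zero_le _)).trans le_sup_left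
  | succ t ih => exact sup_le_sup (hG (by omega)) (Submodule.map_mono ih)

theorem mul_mem_skewFiltration (hG : Monotone G)
    (hmul : ∀ m n, ∀ u ∈ G m, ∀ v ∈ G n, u * v ∈ G (m + n + 1))
    (hcomm : ∀ n, ∀ u ∈ G n, y * u - u * y ∈ G (n + 2)) {t : ℕ} :
    ∀ {n : ℕ} {u v : Q}, u ∈ skewFiltration G y t → v ∈ G (2 * n + 1) →
      u * v ∈ skewFiltration G y (t + n + 1) := by
  induction t with
  | zero =>
    intro n u v hu hv
    exact le_skewFiltration _ (hG (by omega) (hmul _ _ u hu v hv))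
  | succ t ih =>
    intro n u v hu hv
    obtain ⟨g, hg, _, ⟨w, hw, rfl⟩, rfl⟩ := Submodule.mem_sup.1 hu
    rw [add_mul]
    refine Submodule.add_mem _ (le_skewFiltration _ (hG (by omega) (hmul _ _ g hg v hv))) ?_
    have h1 := mul_mem_skewFiltration_succ (ih hw hv)
    have h2 := ih (n := n + 1) hw (hcomm _ v hv)
    rw [show t + 1 + n + 1 = t + n + 1 + 1 by omega]
    have h3 := Submodule.add_mem _ h1 h2
    rw [LinearMap.mulRight_apply]
    convert h3 using 1
    noncomm_ring

theorem finrank_skewFiltration_le (hG : Monotone G) [∀ n, FiniteDimensional k (G n)] (t : ℕ) :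
    FiniteDimensional k (skewFiltration G y t) ∧
      Module.finrank k (skewFiltration G y t) ≤ (t + 1) * Module.finrank k (G (2 * t)) := by
  induction t with
  | zero => exact ⟨inferInstanceAs (FiniteDimensional k (G 0)), by rw [zero_add, one_mul]; exact le_rfl⟩
  | succ t ih =>
    have := ih.1
    refine ⟨Submodule.finiteDimensional_sup _ _, ?_⟩
    refine (Submodule.finrank_add_le_finrank_add_finrank _ _).trans ?_
    have h1 := Submodule.finrank_map_le (LinearMap.mulRight k y) (skewFiltration G y t)
    have h2 := Submodule.finrank_mono (hG (show 2 * t ≤ 2 * (t + 1) by omega))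
    have h3 := ih.2.trans (Nat.mul_le_mul_left (t + 1) h2)
    rw [add_mul (t + 1)]
    omega

theorem exists_finrank_pow_le_mul_sq (hG : Monotone G) [∀ n, FiniteDimensional k (G n)] {c : ℕ}
    (hdim : ∀ n, Module.finrank k (G n) ≤ c * (n + 1))
    (hmul : ∀ m n, ∀ u ∈ G m, ∀ v ∈ G n, u * v ∈ G (m + n + 1))
    (hcomm : ∀ n, ∀ u ∈ G n, y * u - u * y ∈ G (n + 2)) (h1 : 1 ∈ G 1) {F W : Submodule k Q}
    (hF : F ≤ G 1) {e : ℕ} (hW : W ≤ F.polySpan y e) :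
    ∃ C : ℕ, ∀ n, 1 ≤ n → Module.finrank k (W ^ n : Submodule k Q) ≤ C * n ^ 2 := by
  have hstep : ∀ e, ∀ t, ∀ u ∈ skewFiltration G y t, ∀ v ∈ F.polySpan y e,
      u * v ∈ skewFiltration G y (t + (e + 1)) := by
    intro e
    induction e with
    | zero =>
      intro t u hu v hv
      exact mul_mem_skewFiltration hG hmul hcomm (n := 0) hu (hF hv)
    | succ e ih =>
      intro t u hu v hv
      obtain ⟨f, hf, _, ⟨w, hw, rfl⟩, rfl⟩ := Submodule.mem_sup.1 hv
      rw [mul_add, LinearMap.mulRight_apply, ← mul_assoc]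
      refine Submodule.add_mem _ (skewFiltration_mono hG (by omega)
        (mul_mem_skewFiltration hG hmul hcomm (n := 0) hu (hF hf))) ?_
      exact mul_mem_skewFiltration_succ (ih t u hu w hw)
  have hpow : ∀ n, W ^ n ≤ skewFiltration G y (n * (e + 1) + 1) := by
    intro n
    induction n with
    | zero =>
      rw [pow_zero, Submodule.one_le]
      exact le_skewFiltration _ (hG (by omega) h1)
    | succ n ih =>
      rw [pow_succ, Submodule.mul_le]
      intro u hu w hw
      have := hstep e _ u (ih hu) w (hW hw)
      rwa [show (n + 1) * (e + 1) + 1 = n * (e + 1) + 1 + (e + 1) by ring]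
  refine ⟨(e + 3) * (c * (2 * (e + 2) + 1)), fun n hn => ?_⟩
  obtain ⟨hfd, hle⟩ := finrank_skewFiltration_le (y := y) hG (n * (e + 1) + 1)
  have ht : n * (e + 1) + 1 ≤ n * (e + 2) := by nlinarith
  calc Module.finrank k (W ^ n : Submodule k Q)
      ≤ (n * (e + 1) + 1 + 1) * (c * (2 * (n * (e + 1) + 1) + 1)) :=
        (Submodule.finrank_mono (hpow n)).trans (hle.trans (Nat.mul_le_mul_left _ (hdim _)))
    _ ≤ (n * (e + 3)) * (c * (n * (2 * (e + 2) + 1))) := by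
        gcongr
        · nlinarith
        · nlinarith
    _ = _ := by ring

end OreGrowth

section Denominators

open Polynomial

theorem Commute.polynomial_aeval_left {k Q : Type*} [CommSemiring k] [Semiring Q] [Algebra k Q]
    {z v : Q} (h : Commute z v) (p : k[X]) : Commute (Polynomial.aeval z p) v := by
  induction p using Polynomial.induction_on with
  | C r => rw [aeval_C]; exact Algebra.commutes r v
  | add p q hp hq => rw [map_add]; exact hp.add_left hq
  | monomial n r _ =>
    rw [map_mul, aeval_C, map_pow, aeval_X]
    exact Commute.mul_left (Algebra.commutes r v) (h.pow_left _)

variable {k Q : Type*} [Field k]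

theorem commutator_aeval [Ring Q] [Algebra k Q] {y z : Q} (h : Commute z (y * z - z * y))
    (p : k[X]) :
    y * aeval z p - aeval z p * y = aeval z (derivative p) * (y * z - z * y) := by
  induction p using Polynomial.induction_on with
  | C r => simp [Algebra.commutes r y]
  | add p q hp hq =>
    simp only [map_add, add_mul, ← hp, ← hq]
    noncomm_ring
  | monomial n r ih =>
    rw [pow_succ, ← mul_assoc]
    generalize C r * X ^ n = f at ih ⊢
    rw [derivative_mul, derivative_X, mul_one, map_add, map_mul, map_mul, aeval_X]
    calc _ = (y * aeval z f - aeval z f * y) * z + aeval z f * (y * z - z * y) := by noncomm_ring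
      _ = aeval z (derivative f) * (z * (y * z - z * y)) + aeval z f * (y * z - z * y) := by
        rw [ih, mul_assoc, ← h.eq]
      _ = _ := by rw [add_mul, mul_assoc]

variable [DivisionRing Q] [Algebra k Q]

/-- The span of the elements `z ^ i * b j` for `i ≤ M`. -/
def powSpan (k : Type*) {Q : Type*} [Field k] [DivisionRing Q] [Algebra k Q] (z : Q) {m : ℕ}
    (b : Fin m → Q) (M : ℕ) : Submodule k Q :=
  Submodule.span k (Set.range fun x : Fin (M + 1) × Fin m => z ^ (x.1 : ℕ) * b x.2)

variable {z : Q} {m : ℕ} {b : Fin m → Q}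

theorem finrank_powSpan_le (M : ℕ) : Module.finrank k (powSpan k z b M) ≤ (M + 1) * m :=
  (finrank_range_le_card _).trans (by simp)

instance (M : ℕ) : FiniteDimensional k (powSpan k z b M) :=
  FiniteDimensional.span_of_finite k (Set.finite_range _)

theorem pow_mul_mem_powSpan {M i : ℕ} (hi : i ≤ M) (j : Fin m) : z ^ i * b j ∈ powSpan k z b M :=
  Submodule.subset_span ⟨(⟨i, by omega⟩, j), rfl⟩

theorem powSpan_le {M : ℕ} {P : Submodule k Q} (h : ∀ i ≤ M, ∀ j, z ^ i * b j ∈ P) :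
    powSpan k z b M ≤ P := by
  refine Submodule.span_le.2 ?_
  rintro _ ⟨x, rfl⟩
  exact h _ (by omega) _

theorem powSpan_mono : Monotone (powSpan k z b) := fun _ _ hMN =>
  powSpan_le fun _ hi j => pow_mul_mem_powSpan (hi.trans hMN) j

theorem pow_mul_mem_powSpan_add {M : ℕ} {v : Q} (hv : v ∈ powSpan k z b M) (i : ℕ) :
    z ^ i * v ∈ powSpan k z b (M + i) := by
  have : powSpan k z b M ≤ (powSpan k z b (M + i)).comap (LinearMap.mulLeft k (z ^ i)) :=
    powSpan_le fun l hl j => by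
      rw [Submodule.mem_comap, LinearMap.mulLeft_apply, ← mul_assoc, ← pow_add]
      exact pow_mul_mem_powSpan (by omega) j
  exact this hv

theorem aeval_mul_mem_powSpan {M N : ℕ} {v : Q} (hv : v ∈ powSpan k z b M) {p : k[X]}
    (hp : p.natDegree ≤ N) : aeval z p * v ∈ powSpan k z b (M + N) := by
  rw [aeval_eq_sum_range, Finset.sum_mul]
  refine Submodule.sum_mem _ fun i hi => ?_
  rw [smul_mul_assoc]
  have := Finset.mem_range.1 hi
  exact Submodule.smul_mem _ _ (powSpan_mono (by omega) (pow_mul_mem_powSpan_add hv i))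

theorem exists_common_denominator_powSpan {S : Set Q}
    (hfin : ∀ v ∈ S, ∃ (q : k[X]) (p : Fin m → k[X]), q ≠ 0 ∧
      aeval z q * v = ∑ i, aeval z (p i) * b i) {T : Set Q} (hT : T.Finite) (hTS : T ⊆ S) :
    ∃ q : k[X], q ≠ 0 ∧ ∃ N, q.natDegree ≤ N ∧ ∀ v ∈ T, aeval z q * v ∈ powSpan k z b N := by
  induction T, hT using Set.Finite.induction_on with
  | empty => exact ⟨1, one_ne_zero, 0, by simp⟩
  | @insert v T _ _ ih =>
    obtain ⟨q, hq, N, hqN, hN⟩ := ih ((Set.subset_insert _ _).trans hTS)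
    obtain ⟨r, p, hr, hrp⟩ := hfin v (hTS (Set.mem_insert _ _))
    set M := Finset.univ.sup fun i => (p i).natDegree
    have hv : aeval z r * v ∈ powSpan k z b M := by
      rw [hrp]
      refine Submodule.sum_mem _ fun i _ => ?_
      have h0 : b i ∈ powSpan k z b 0 := by
        have h1 : z ^ 0 * b i ∈ powSpan k z b 0 := pow_mul_mem_powSpan le_rfl i
        simpa using h1
      have := aeval_mul_mem_powSpan h0
        (Finset.le_sup (f := fun i => (p i).natDegree) (Finset.mem_univ i))
      rwa [zero_add] at this
    refine ⟨q * r, mul_ne_zero hq hr, N + M + r.natDegree, ?_, ?_⟩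
    · exact natDegree_mul_le.trans (by omega)
    rintro w (rfl | hw)
    · rw [map_mul, mul_assoc]
      exact powSpan_mono (by omega) (aeval_mul_mem_powSpan hv hqN)
    · rw [mul_comm, map_mul, mul_assoc]
      exact powSpan_mono (by omega) (aeval_mul_mem_powSpan (hN w hw) (le_refl r.natDegree))

theorem exists_filtration {S : Subfield Q} (hk : ∀ r : k, algebraMap k Q r ∈ S) {y : Q}
    (hy : ∀ v ∈ S, y * v - v * y ∈ S) (hz : Transcendental k z) (hzS : z ∈ S)
    (hzc : ∀ v ∈ S, Commute z v) (hb : ∀ j, b j ∈ S)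
    (hfin : ∀ v ∈ S, ∃ (q : k[X]) (p : Fin m → k[X]), q ≠ 0 ∧
      aeval z q * v = ∑ i, aeval z (p i) * b i)
    {F : Submodule k Q} [FiniteDimensional k F] (hF : ∀ v ∈ F, v ∈ S) :
    ∃ G : ℕ → Submodule k Q, Monotone G ∧ (∀ n, FiniteDimensional k (G n)) ∧
      (∃ c, ∀ n, Module.finrank k (G n) ≤ c * (n + 1)) ∧
      (∀ m n, ∀ u ∈ G m, ∀ v ∈ G n, u * v ∈ G (m + n + 1)) ∧
      (∀ n, ∀ u ∈ G n, y * u - u * y ∈ G (n + 2)) ∧ 1 ∈ G 1 ∧ F ≤ G 1 := by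
  set x := y * z - z * y with hx
  have hxS : x ∈ S := hy z hzS
  have hxc : ∀ v ∈ S, Commute x v := fun v hv => by
    have h1 := hzc v hv
    have h2 := hzc _ (hy v hv)
    have h3 : x * v - v * x = y * (z * v - v * z) - (z * v - v * z) * y -
        (z * (y * v - v * y) - (y * v - v * y) * z) := by rw [hx]; noncomm_ring
    rwa [h1.eq, h2.eq, sub_self, sub_self, mul_zero, zero_mul, sub_self, sub_zero, sub_eq_zero] at h3
  obtain ⟨s, rfl⟩ := Module.Finite.iff_fg.1 (inferInstance : Module.Finite k F)
  obtain ⟨q, hq, N, hqN, hN⟩ := exists_common_denominator_powSpan (S := S) hfin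
    (T := insert 1 (s ∪ Set.range (fun i : Fin m × Fin m => b i.1 * b i.2) ∪
      Set.range (fun i => y * b i - b i * y) ∪ Set.range (fun i => x * b i)))
    (Set.toFinite _) (by
      rintro v (rfl | ((hv | ⟨i, rfl⟩) | ⟨i, rfl⟩) | ⟨i, rfl⟩)
      · exact S.one_mem
      · exact hF v (Submodule.subset_span hv)
      · exact S.mul_mem (hb _) (hb _)
      · exact hy _ (hb _)
      · exact S.mul_mem hxS (hb _))
  set a := aeval z q with ha
  have ha0 : a ≠ 0 := fun h => hz ⟨q, hq, h⟩
  have hac : ∀ v ∈ S, Commute a v := fun v hv => (hzc v hv).polynomial_aeval_left q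
  have hS : ∀ r : k, r • (1 : Q) ∈ S := fun r => by
    rw [← Algebra.algebraMap_eq_smul_one]; exact hk r
  have hPS : ∀ M, ∀ v ∈ powSpan k z b M, v ∈ S := fun M =>
    powSpan_le (P := S.toSubspace hS) fun i _ j => S.mul_mem (S.pow_mem hzS i) (hb j)
  have haP : ∀ M, ∀ v ∈ powSpan k z b M, a * v ∈ powSpan k z b (M + N) := fun M v hv =>
    aeval_mul_mem_powSpan hv hqN
  have hpS : ∀ p : k[X], aeval z p ∈ S := fun p => by
    rw [aeval_eq_sum_range]
    refine S.sum_mem fun i _ => ?_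
    rw [Algebra.smul_def]
    exact S.mul_mem (hk _) (S.pow_mem hzS i)
  have haS : a ∈ S := hpS q
  let G : ℕ → Submodule k Q := fun n => (powSpan k z b (n * N)).comap (LinearMap.mulLeft k (a ^ n))
  have hGmem : ∀ n v, v ∈ G n ↔ a ^ n * v ∈ powSpan k z b (n * N) := fun n v => Iff.rfl
  have hGS : ∀ n, ∀ v ∈ G n, v ∈ S := fun n v hv => by
    have := S.mul_mem (S.inv_mem (S.pow_mem haS n)) (hPS _ _ ((hGmem n v).1 hv))
    rwa [inv_mul_cancel_left₀ (pow_ne_zero n ha0)] at this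
  have hinj : ∀ n, Function.Injective (LinearMap.mulLeft k (a ^ n)) := fun n u v h =>
    mul_left_cancel₀ (pow_ne_zero n ha0) h
  have hbb : ∀ i j, a * (b i * b j) ∈ powSpan k z b N := fun i j => hN _ (by simp)
  have hyb : ∀ i, a * (y * b i - b i * y) ∈ powSpan k z b N := fun i => hN _ (by simp)
  have hxb : ∀ i, a * (x * b i) ∈ powSpan k z b N := fun i =>
    hN _ (Or.inr (Or.inr ⟨i, rfl⟩))
  have haz : ∀ i, a * z ^ i = z ^ i * a := fun i => hac _ (S.pow_mem hzS i)
  have hPP : ∀ A B, ∀ u ∈ powSpan k z b A, ∀ v ∈ powSpan k z b B,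
      a * (u * v) ∈ powSpan k z b (A + B + N) := by
    intro A B u hu v hv
    have h1 : powSpan k z b A ≤ (powSpan k z b (A + B + N)).comap
        (LinearMap.mulLeft k a ∘ₗ LinearMap.mulRight k v) := powSpan_le fun i hi j => by
      have h2 : powSpan k z b B ≤ (powSpan k z b (A + B + N)).comap
          (LinearMap.mulLeft k (a * (z ^ i * b j))) := powSpan_le fun i' hi' j' => by
        have h3 := pow_mul_mem_powSpan_add (hbb j j') (i + i')
        have h4 : a * (z ^ i * b j) * (z ^ i' * b j') = z ^ (i + i') * (a * (b j * b j')) := by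
          calc _ = (a * z ^ i) * (b j * z ^ i') * b j' := by simp only [mul_assoc]
            _ = z ^ i * (a * z ^ i') * b j * b j' := by
              rw [haz, ((hzc _ (hb j)).pow_left i').symm.eq]; simp only [mul_assoc]
            _ = _ := by rw [haz, pow_add]; simp only [mul_assoc]
        rw [Submodule.mem_comap, LinearMap.mulLeft_apply, h4]
        exact powSpan_mono (by omega) h3
      have := h2 hv
      rwa [Submodule.mem_comap, LinearMap.mulLeft_apply, mul_assoc] at this
    exact h1 hu
  have hxP : ∀ A, ∀ u ∈ powSpan k z b A, a * (x * u) ∈ powSpan k z b (A + N) := by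
    intro A u hu
    have h1 : powSpan k z b A ≤ (powSpan k z b (A + N)).comap
        (LinearMap.mulLeft k a ∘ₗ LinearMap.mulLeft k x) := powSpan_le fun i hi j => by
      have h3 := pow_mul_mem_powSpan_add (hxb j) i
      have h4 : a * (x * (z ^ i * b j)) = z ^ i * (a * (x * b j)) := by
        rw [← mul_assoc x, (hxc _ (S.pow_mem hzS i)).eq, mul_assoc, ← mul_assoc a, haz, mul_assoc]
      rw [Submodule.mem_comap, LinearMap.comp_apply, LinearMap.mulLeft_apply,
        LinearMap.mulLeft_apply, h4]
      exact powSpan_mono (by omega) h3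
    exact h1 hu
  have hyp : ∀ p : k[X], y * aeval z p - aeval z p * y = aeval z (derivative p) * x := fun p =>
    commutator_aeval (hxc z hzS).symm p
  have hyP : ∀ A, ∀ u ∈ powSpan k z b A, a * (y * u - u * y) ∈ powSpan k z b (A + N) := by
    intro A u hu
    have h1 : powSpan k z b A ≤ (powSpan k z b (A + N)).comap
        (LinearMap.mulLeft k a ∘ₗ (LinearMap.mulLeft k y - LinearMap.mulRight k y)) :=
      powSpan_le fun i hi j => by
        have h3 := pow_mul_mem_powSpan_add (hyb j) i
        have h5 := aeval_mul_mem_powSpan (hxb j) (p := derivative (X ^ i)) (N := i)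
          ((natDegree_derivative_le (X ^ i : k[X])).trans (by simp))
        have h6 := hyp (X ^ i)
        have h7 := (hac _ (hpS (derivative (X ^ i)))).eq
        generalize aeval z (derivative (X ^ i : k[X])) = f at h5 h6 h7
        rw [map_pow, aeval_X] at h6
        have h4 : a * (y * (z ^ i * b j) - z ^ i * b j * y) =
            f * (a * (x * b j)) + z ^ i * (a * (y * b j - b j * y)) := by
          calc _ = a * (y * z ^ i - z ^ i * y) * b j + (a * z ^ i) * (y * b j - b j * y) := by
                noncomm_ring
            _ = (a * f) * x * b j + (a * z ^ i) * (y * b j - b j * y) := by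
                rw [h6, mul_assoc a f x]
            _ = _ := by rw [h7, haz]; simp only [mul_assoc]
        simp only [Submodule.mem_comap, LinearMap.comp_apply, LinearMap.sub_apply,
          LinearMap.mulLeft_apply, LinearMap.mulRight_apply, h4]
        exact Submodule.add_mem _ (powSpan_mono (by omega) h5) (powSpan_mono (by omega) h3)
    exact h1 hu
  refine ⟨G, ?_, ?_, ?_, ?_, ?_, ?_, ?_⟩
  · refine monotone_nat_of_le_succ fun n v hv => ?_
    rw [hGmem, pow_succ', mul_assoc, add_mul, one_mul]
    exact haP _ _ hv
  · exact fun n => Module.Finite.of_injective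
      ((LinearMap.mulLeft k (a ^ n)).restrict (p := G n) (q := powSpan k z b (n * N))
        fun v hv => hv) fun u v h => Subtype.ext (hinj n (congrArg Subtype.val h))
  · refine ⟨(N + 1) * m, fun n => ?_⟩
    have h1 := LinearMap.finrank_le_finrank_of_injective
      (f := (LinearMap.mulLeft k (a ^ n)).restrict (p := G n) (q := powSpan k z b (n * N))
        fun v hv => hv) fun u v h => Subtype.ext (hinj n (congrArg Subtype.val h))
    refine (h1.trans (finrank_powSpan_le _)).trans ?_
    calc (n * N + 1) * m ≤ ((N + 1) * (n + 1)) * m := Nat.mul_le_mul_right _ (by nlinarith)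
      _ = _ := by ring
  · intro m n u hu v hv
    have h1 := hPP _ _ _ hu _ hv
    have h2 : a ^ (m + n + 1) * (u * v) = a * (a ^ m * u * (a ^ n * v)) := by
      calc _ = a * (a ^ m * (a ^ n * u) * v) := by rw [pow_succ', pow_add]; simp only [mul_assoc]
        _ = _ := by
          rw [((hac _ (hGS _ _ hu)).pow_left n).eq]; simp only [mul_assoc]
    rw [hGmem, h2]
    exact powSpan_mono (by ring_nf; rfl) h1
  · intro n u hu
    have h1 := haP _ _ (hyP _ _ hu)
    have h2 := aeval_mul_mem_powSpan (hxP _ _ hu) (p := derivative q) (N := N)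
      ((natDegree_derivative_le _).trans (by omega))
    have h3 := hyp (q ^ n)
    have h4 : aeval z (derivative (q ^ n)) * a = (n : k) • (aeval z (derivative q) * a ^ n) := by
      have h5 : derivative (q ^ n) * q = (n : k) • (derivative q * q ^ n) := by
        rw [derivative_pow, smul_eq_C_mul]
        cases n with
        | zero => simp
        | succ n => rw [Nat.add_sub_cancel]; ring
      simpa using congrArg (aeval z) h5
    have h7 := (hac _ (hpS (derivative (q ^ n)))).eq
    generalize aeval z (derivative (q ^ n)) = f at h3 h4 h7
    rw [map_pow] at h3
    have h5 : a ^ (n + 2) * (y * u - u * y) = a * (a * (y * (a ^ n * u) - a ^ n * u * y)) -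
        (n : k) • (aeval z (derivative q) * (a * (x * (a ^ n * u)))) := by
      calc _ = a * (a * (y * (a ^ n * u) - a ^ n * u * y)) -
            a * (a * ((y * a ^ n - a ^ n * y) * u)) := by
            rw [add_comm n, pow_add, pow_two]; noncomm_ring
        _ = a * (a * (y * (a ^ n * u) - a ^ n * u * y)) - a * ((a * f) * (x * u)) := by
            rw [ha, h3]; simp only [mul_assoc]
        _ = _ := by
            rw [h7, h4]
            congr 1
            rw [smul_mul_assoc, mul_smul_comm]
            congr 1
            rw [← mul_assoc a, ← mul_assoc a, (hac _ (hpS (derivative q))).eq, mul_assoc,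
              mul_assoc, ← mul_assoc (a ^ n), ← (hxc _ (S.pow_mem haS n)).eq, mul_assoc x]
    rw [hGmem, h5]
    exact Submodule.sub_mem _ (powSpan_mono (by ring_nf; rfl) h1)
      (Submodule.smul_mem _ _ (powSpan_mono (by ring_nf; rfl) h2))
  · rw [hGmem, pow_one, one_mul]
    exact hN 1 (Set.mem_insert _ _)
  · rw [Submodule.span_le]
    intro v hv
    rw [SetLike.mem_coe, hGmem, pow_one, one_mul]
    exact hN v (by simp [hv])

end Denominators

section DixmierDecomposition

variable {k Q : Type*} [Field k] [DivisionRing Q] [Algebra k Q]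

theorem exists_le_polySpan_dixmier {D : Module.End k Q} {W : Submodule k Q} [FiniteDimensional k W]
    (hWD : ∀ w ∈ W, D w ∈ W) {d : ℕ} (hWd : ∀ w ∈ W, (D ^ (d + 1)) w = 0) (y : Q) :
    ∃ F : Submodule k Q, FiniteDimensional k F ∧ (∀ v ∈ F, ∃ w ∈ W, dixmier k D y d w = v) ∧
      W ≤ F.polySpan y (d + 1) := by
  let π : Q →ₗ[k] Q := ∑ i ∈ Finset.range (d + 1), ((-1) ^ i * (i.factorial : k)⁻¹) •
    (LinearMap.mulRight k (y ^ i) ∘ₗ D ^ i)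
  have hπ : ∀ w, π w = dixmier k D y d w := fun w => by
    simp [π, dixmier, LinearMap.sum_apply]
  have hpow : ∀ i, ∀ w ∈ W, (D ^ i) w ∈ W := by
    intro i
    induction i with
    | zero => exact fun w hw => hw
    | succ i ih =>
      intro w hw
      rw [pow_succ', Module.End.mul_apply]
      exact hWD _ (ih w hw)
  refine ⟨W.map π, inferInstance, ?_, ?_⟩
  · rintro _ ⟨w, hw, rfl⟩
    exact ⟨w, hw, (hπ w).symm⟩
  have key : ∀ e ≤ d + 1, ∀ w ∈ W, (D ^ e) w = 0 → w ∈ (W.map π).polySpan y e := by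
    intro e
    induction e using Nat.strong_induction_on with
    | _ e ih =>
      intro he w hw hDw
      have h1 : w = π w - ∑ i ∈ Finset.range d, ((-1) ^ (i + 1) * ((i + 1).factorial : k)⁻¹) •
          ((D ^ (i + 1)) w * y ^ (i + 1)) := by
        rw [hπ, dixmier, Finset.sum_range_succ']
        simp
      rw [h1]
      refine Submodule.sub_mem _ (Submodule.polySpan_mono _ y (Nat.zero_le e) ⟨w, hw, rfl⟩)
        (Submodule.sum_mem _ fun i _ => Submodule.smul_mem _ _ ?_)
      by_cases hi : i + 1 ≤ e
      · have h2 := ih (e - (i + 1)) (by omega) (by omega) _ (hpow (i + 1) w hw) (by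
          rw [← Module.End.mul_apply, ← pow_add, Nat.sub_add_cancel hi, hDw])
        have h3 := Submodule.polySpan_mul_pow_mem _ y h2 (i + 1)
        rwa [Nat.sub_add_cancel hi] at h3
      · rw [Module.End.pow_apply_eq_zero_of_le (by omega) hDw, zero_mul]
        exact Submodule.zero_mem _
  exact fun w hw => key _ le_rfl w hw (hWd w hw)

end DixmierDecomposition

section DivisionRingGrowth

variable {k Q : Type*} [Field k] [CharZero k] [DivisionRing Q] [Algebra k Q]

theorem sq_le_finrank_pow {κ : Type*} [Field κ] [Algebra k κ] [Module κ Q] [IsScalarTower k κ Q]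
    [IsScalarTower κ Q Q] {D : Module.End κ Q} (hD : ∀ a b, D (a * b) = a * D b + D a * b)
    {W : Submodule k Q} [FiniteDimensional k W] (hW1 : 1 ∈ W) {c x y : Q} (hc : c ≠ 0)
    (hxW : x ∈ W) (hDc : D c = 0) (hcy : c * y = x) (hy : D y = 1) {t : κ}
    (ht : LinearIndependent k fun n : ℕ => t ^ n) (htW : t • (1 : Q) ∈ W) (m : ℕ) :
    (m + 1) ^ 2 ≤ Module.finrank k (W ^ (m + m) : Submodule k Q) := by
  have : CharZero Q := charZero_of_injective_algebraMap (algebraMap k Q).injective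
  have h1 := mul_finrank_span_le ht hW1 htW m m
  have h2 := mul_finrank_le_finrank_polySpan hD (M := Submodule.span κ {(1 : Q)})
    ((Submodule.span_singleton_le_iff_mem _ _).2 (Module.End.map_one_eq_zero hD)) hy hc hDc hcy m
  rw [finrank_span_singleton one_ne_zero, mul_one] at h2
  have h3 : ∀ n, (Submodule.span κ {(1 : Q)}).polySpan x n ≤
      Submodule.span κ ((W ^ n : Submodule k Q) : Set Q) := by
    intro n
    induction n with
    | zero =>
      refine (Submodule.span_singleton_le_iff_mem _ _).2 (Submodule.subset_span ?_)
      rw [pow_zero]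
      exact Submodule.one_le.1 le_rfl
    | succ n ih =>
      refine sup_le ((Submodule.span_singleton_le_iff_mem _ _).2 (Submodule.subset_span ?_)) ?_
      · simpa using Submodule.pow_mem_pow W hW1 (n + 1)
      · rintro _ ⟨u, hu, rfl⟩
        exact mul_mem_span_pow (ih hu) hxW
  have := finiteDimensional_span_of_tower (κ := κ) (W ^ m)
  have h4 := Submodule.finrank_mono (h3 m)
  calc (m + 1) ^ 2 = (m + 1) * (m + 1) := sq _
    _ ≤ _ := (Nat.mul_le_mul_left _ (h2.trans h4)).trans h1

omit [CharZero k] in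
theorem exists_subfield_mem_iff_map_eq_zero {D : Module.End k Q}
    (hD : ∀ a b, D (a * b) = a * D b + D a * b) : ∃ K : Subfield Q, ∀ v, v ∈ K ↔ D v = 0 := by
  have hD1 := Module.End.map_one_eq_zero hD
  refine ⟨{ carrier := {v | D v = 0}, mul_mem' := ?_, one_mem' := hD1, add_mem' := ?_
            zero_mem' := map_zero D, neg_mem' := ?_, inv_mem' := ?_ }, fun v => Iff.rfl⟩
  · intro u v hu hv
    simp_all
  · intro u v hu hv
    simp_all
  · intro u hu
    simp_all
  · intro u hu
    rcases eq_or_ne u 0 with rfl | hu0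
    · simp
    · have h1 := hD u u⁻¹
      rw [mul_inv_cancel₀ hu0, hD1, show D u = 0 from hu, zero_mul, add_zero] at h1
      exact (mul_eq_zero.1 h1.symm).resolve_left hu0

omit [CharZero k] in
theorem exists_central_family [IsAlgClosed k] (φ : RatFunc k →ₐ[k] Q) [Module (RatFunc k) Q]
    (hφ : ∀ (s : RatFunc k) (v : Q), s • v = φ s * v) {S : Subfield Q}
    (hS : ∀ s : RatFunc k, s • (1 : Q) ∈ S) [IsScalarTower (RatFunc k) Q Q]
    [FiniteDimensional (RatFunc k) (S.toSubspace hS)] :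
    ∃ z : Q, Transcendental k z ∧ z ∈ S ∧ (∀ v ∈ S, Commute z v) ∧
      ∃ (m : ℕ) (b : Fin m → Q), (∀ j, b j ∈ S) ∧
        ∀ v ∈ S, ∃ (q : Polynomial k) (p : Fin m → Polynomial k), q ≠ 0 ∧
          Polynomial.aeval z q * v = ∑ i, Polynomial.aeval z (p i) * b i := by
  have hφS : ∀ s, φ s ∈ S := fun s => by simpa [hφ] using hS s
  have hkS : ∀ r : k, algebraMap k Q r ∈ S := fun r => by
    rw [← φ.commutes]
    exact hφS _
  let _ : Algebra k S := ((algebraMap k Q).codRestrict S hkS).toAlgebra' fun r v =>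
    Subtype.ext (Algebra.commutes r (v : Q))
  let ι : S →ₐ[k] Q := { S.subtype with commutes' := fun r => rfl }
  have hι : ∀ v : S, ι v = v := fun v => rfl
  have hιinj : Function.Injective ι := Subtype.val_injective
  let φ' : RatFunc k →ₐ[k] S :=
    { (φ : RatFunc k →+* Q).codRestrict S hφS with
      commutes' := fun r => Subtype.ext (φ.commutes r) }
  have hφ' : ∀ s, (φ' s : Q) = φ s := fun s => rfl
  let _ : Module (RatFunc k) S := Module.compHom S (φ' : RatFunc k →+* S)
  have hsmul : ∀ (s : RatFunc k) (v : S), s • v = φ' s * v := fun s v => rfl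
  have : IsScalarTower (RatFunc k) S S := ⟨fun s u v => by
    rw [hsmul, smul_eq_mul, smul_eq_mul, hsmul, mul_assoc]⟩
  have : FiniteDimensional (RatFunc k) S := by
    let f : S.toSubspace hS →ₗ[RatFunc k] S :=
      { toFun := fun v => ⟨v.1, v.2⟩
        map_add' := fun u v => rfl
        map_smul' := fun s v => Subtype.ext (hφ s v.1) }
    exact Module.Finite.of_surjective f fun v => ⟨⟨v.1, v.2⟩, rfl⟩
  obtain ⟨z, hzc, hz⟩ := exists_central_of_transcendental (RatFunc k) (a := φ' RatFunc.X)
    (fun h =>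
      RatFunc.transcendental_X ((isAlgebraic_algHom_iff φ' φ'.toRingHom.injective).1 h))
  have hzt : Transcendental k z := fun h => hz (mem_range_algebraMap_of_isAlgebraic h)
  obtain ⟨ψ, hψ⟩ := hzt.exists_ratFunc_algHom
  obtain ⟨m, b, hb⟩ := exists_family_over_central φ' ψ
    (by rw [hψ]; exact fun v => (hzc v).symm) hsmul
  rw [hψ] at hb
  refine ⟨z, ?_, z.2, fun v hv => congrArg Subtype.val (hzc ⟨v, hv⟩).symm, m, fun j => b j,
    fun j => (b j).2, fun v hv => ?_⟩
  · exact fun h => hzt ((isAlgebraic_algHom_iff ι hιinj).1 h)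
  · obtain ⟨q, p, hq, hqp⟩ := hb ⟨v, hv⟩
    refine ⟨q, p, hq, ?_⟩
    have h1 := congrArg ι hqp
    simp only [map_mul, map_sum, ← Polynomial.aeval_algHom_apply] at h1
    exact h1

theorem exists_finrank_pow_quadratic [IsAlgClosed k] {D : Module.End k Q}
    (hD : ∀ a b, D (a * b) = a * D b + D a * b) {W : Submodule k Q} [FiniteDimensional k W]
    (hW1 : 1 ∈ W) (hWD : ∀ w ∈ W, D w ∈ W) {d : ℕ} (hWd : ∀ w ∈ W, (D ^ (d + 1)) w = 0)
    {a c x : Q} (hc : c ≠ 0) (hcW : c ∈ W) (hxW : x ∈ W) (hDc : D c = 0) (hDx : D x = c)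
    (ha : Transcendental k a) (haW : a ∈ W) (hDa : D a = 0) {p C : ℕ} (hp : 1 ≤ p)
    (hgr : ∀ n, 1 ≤ n →
      Module.finrank k (W ^ (3 * n) : Submodule k Q) ^ p ≤ C * n ^ (3 * p - 1)) :
    (∀ m : ℕ, (m + 1) ^ 2 ≤ Module.finrank k (W ^ (m + m) : Submodule k Q)) ∧
      ∃ B, ∀ n, 1 ≤ n → Module.finrank k (W ^ n : Submodule k Q) ≤ B * n ^ 2 := by
  obtain ⟨φ, hφ⟩ := ha.exists_ratFunc_algHom
  have hD1 := Module.End.map_one_eq_zero hD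
  obtain ⟨K, hK⟩ := exists_subfield_mem_iff_map_eq_zero hD
  have hφK : ∀ s, D (φ s) = 0 := fun s => (hK _).1 <| map_ratFunc_mem φ
    (fun r => (hK _).2 (by rw [Algebra.algebraMap_eq_smul_one, map_smul, hD1, smul_zero]))
    (by rw [hφ, hK]; exact hDa) s
  let _ : Module (RatFunc k) Q := Module.compHom Q φ.toRingHom
  have hsmul : ∀ (s : RatFunc k) (v : Q), s • v = φ s * v := fun s v => rfl
  have : IsScalarTower k (RatFunc k) Q := ⟨fun r s v => by
    rw [hsmul, hsmul, map_smul, smul_mul_assoc]⟩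
  have : IsScalarTower (RatFunc k) Q Q := ⟨fun s u v => by
    rw [hsmul, smul_eq_mul, smul_eq_mul, hsmul, mul_assoc]⟩
  let D' : Module.End (RatFunc k) Q :=
    { D with
      map_smul' := fun s v => by
        change D (s • v) = s • D v
        rw [hsmul, hD, hφK, zero_mul, add_zero, hsmul] }
  have hpow : ∀ (i : ℕ) (v : Q), (D' ^ i) v = (D ^ i) v := fun i v => by
    simp only [Module.End.pow_apply]
    rfl
  have hcy : c * (c⁻¹ * x) = x := mul_inv_cancel_left₀ hc x
  set y := c⁻¹ * x
  have hy : D y = 1 := by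
    have h1 := hD c y
    rw [hcy, hDx, hDc, zero_mul, add_zero] at h1
    exact (mul_eq_left₀ hc).1 h1.symm
  have ht : LinearIndependent k fun n : ℕ => (RatFunc.X : RatFunc k) ^ n :=
    (RatFunc.transcendental_X (K := k)).linearIndependent_pow
  have hX1 : (RatFunc.X : RatFunc k) • (1 : Q) = a := by rw [hsmul, mul_one, hφ]
  have htW : (RatFunc.X : RatFunc k) • (1 : Q) ∈ W := by rwa [hX1]
  refine ⟨sq_le_finrank_pow (κ := RatFunc k) (D := D') hD hW1 hc hxW hDc hcy hy ht htW, ?_⟩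
  obtain ⟨S, hS, hSfin, hyS, hSW⟩ := exists_subfield_of_growth_s2 (D := D') hD hW1 hWD (d := d)
    (fun w hw => by rw [hpow, hWd w hw]) hc hcW hxW hDc hcy hy ht htW
    (fun S hk ha s => by
      rw [hsmul, mul_one]
      exact map_ratFunc_mem φ hk (by rwa [hφ, ← hX1]) s) hp hgr
  have hφS : ∀ s, φ s ∈ S := fun s => by simpa [hsmul] using hS s
  have hkS : ∀ r : k, algebraMap k Q r ∈ S := fun r => by
    rw [← φ.commutes]
    exact hφS _
  obtain ⟨F, hF, hFW, hWF⟩ := exists_le_polySpan_dixmier hWD hWd y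
  have hFS : ∀ v ∈ F, v ∈ S := fun v hv => by
    obtain ⟨w, hw, rfl⟩ := hFW v hv
    simpa [dixmier, hpow] using hSW w hw
  obtain ⟨z, hz, hzS, hzc, m, b, hb, hfin⟩ := exists_central_family φ hsmul hS
  obtain ⟨G, hG, hGfin, ⟨e, hdim⟩, hmul, hcomm, h1, hFG⟩ :=
    exists_filtration hkS hyS hz hzS hzc hb hfin hFS
  exact exists_finrank_pow_le_mul_sq hG hdim hmul hcomm h1 hFG hWF

end DivisionRingGrowth

section LogGrowth

open Filter Real

variable {f : ℕ → ℕ}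

theorem limsup_log_div_log_le {b : ℝ} (h : ∀ᶠ n in atTop, log (f n) / log (n : ℕ) ≤ b) :
    limsup (fun n : ℕ => log (f n) / log n) atTop ≤ b :=
  limsup_le_of_le (isCoboundedUnder_le_of_le atTop (x := 0) fun _ =>
    div_nonneg (log_natCast_nonneg _) (log_natCast_nonneg _)) h

theorem exists_mul_lt_of_two_le_limsup (hf : ∀ n, 1 ≤ f n)
    (h : 2 ≤ limsup (fun n : ℕ => log (f n) / log n) atTop) (C : ℕ) :
    ∃ n, 1 ≤ n ∧ C * n < f n := by
  by_contra! hC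
  suffices limsup (fun n : ℕ => log (f n) / log n) atTop ≤ 3 / 2 by linarith
  refine limsup_log_div_log_le ?_
  filter_upwards [eventually_ge_atTop (max 2 (C ^ 2))] with n hn
  have hn2 : 2 ≤ n := (le_max_left _ _).trans hn
  have hnC : C ^ 2 ≤ n := (le_max_right _ _).trans hn
  have hlog : 0 < log n := log_pos (by exact_mod_cast hn2)
  have hf0 : (0 : ℝ) < f n := by exact_mod_cast hf n
  rw [div_le_iff₀ hlog]
  have h1 : f n ^ 2 ≤ n ^ 3 :=
    calc f n ^ 2 ≤ (C * n) ^ 2 := Nat.pow_le_pow_left (hC n (by omega)) 2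
      _ = C ^ 2 * n ^ 2 := mul_pow _ _ _
      _ ≤ n * n ^ 2 := Nat.mul_le_mul_right _ hnC
      _ = n ^ 3 := by ring
  have h2 : log ((f n : ℝ) ^ 2) ≤ log ((n : ℝ) ^ 3) :=
    log_le_log (by positivity) (by exact_mod_cast h1)
  rw [log_pow, log_pow] at h2
  push_cast at h2
  linarith

theorem exists_pow_le_pow_of_limsup_lt_three (h2 : 2 ≤ limsup (fun n : ℕ => log (f n) / log n) atTop)
    (h3 : limsup (fun n : ℕ => log (f n) / log n) atTop < 3) :
    ∃ p, 1 ≤ p ∧ ∃ N, ∀ n, N ≤ n → f n ^ p ≤ n ^ (3 * p - 1) := by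
  rw [limsup_eq] at h2 h3
  have hne : {a | ∀ᶠ n : ℕ in atTop, log (f n) / log n ≤ a}.Nonempty := by
    by_contra! h
    rw [h, sInf_empty] at h2
    norm_num at h2
  obtain ⟨b, hb, hb3⟩ := exists_lt_of_csInf_lt hne h3
  obtain ⟨m, hm⟩ := exists_nat_one_div_lt (sub_pos.2 hb3)
  obtain ⟨N, hN⟩ := eventually_atTop.1 (Set.mem_ofPred.1 hb)
  refine ⟨m + 1, by omega, max N 2, fun n hn => ?_⟩
  have hn2 : 2 ≤ n := (le_max_right _ _).trans hn
  have hlog : 0 < log n := log_pos (by exact_mod_cast hn2)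
  rcases Nat.eq_zero_or_pos (f n) with h0 | hf0
  · rw [h0, zero_pow (by omega)]
    exact Nat.zero_le _
  have hf0' : (0 : ℝ) < f n := by exact_mod_cast hf0
  have h1 := (div_le_iff₀ hlog).1 (hN n ((le_max_left _ _).trans hn))
  have h4 : (m + 1 : ℝ) * b ≤ 3 * m + 2 := by
    rw [div_lt_iff₀ (by positivity)] at hm
    nlinarith
  have h5 : log ((f n : ℝ) ^ (m + 1)) ≤ log ((n : ℝ) ^ (3 * (m + 1) - 1)) := by
    rw [log_pow, log_pow, show 3 * (m + 1) - 1 = 3 * m + 2 by omega]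
    push_cast
    calc (m + 1 : ℝ) * log (f n) ≤ (m + 1) * (b * log n) := by gcongr
      _ = ((m + 1) * b) * log n := by ring
      _ ≤ _ := by gcongr
  exact_mod_cast (log_le_log_iff (by positivity) (by positivity)).1 h5

end LogGrowth

section Generation

variable {k A : Type*} [Field k] [Ring A] [Algebra k A] {V : Submodule k A}

theorem exists_mem_pow_of_adjoin_eq_top (hV1 : (1 : A) ∈ V)
    (hV : Algebra.adjoin k (V : Set A) = ⊤) (v : A) : ∃ n, v ∈ V ^ n := by
  have hv : v ∈ Algebra.adjoin k (V : Set A) := hV ▸ Algebra.mem_top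
  induction hv using Algebra.adjoin_induction with
  | mem v hv => exact ⟨1, by simpa using hv⟩
  | algebraMap r => exact ⟨0, by simp⟩
  | add u v _ _ hu hv =>
    obtain ⟨m, hm⟩ := hu
    obtain ⟨n, hn⟩ := hv
    exact ⟨m + n, Submodule.add_mem _
      (pow_right_mono₀ (Submodule.one_le.2 hV1) (Nat.le_add_right m n) hm)
      (pow_right_mono₀ (Submodule.one_le.2 hV1) (Nat.le_add_left n m) hn)⟩
  | mul u v _ _ hu hv =>
    obtain ⟨m, hm⟩ := hu
    obtain ⟨n, hn⟩ := hv
    exact ⟨m + n, by rw [pow_add]; exact Submodule.mul_mem_mul hm hn⟩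

theorem exists_le_pow_of_adjoin_eq_top (hV1 : (1 : A) ∈ V)
    (hV : Algebra.adjoin k (V : Set A) = ⊤) (U : Submodule k A) [FiniteDimensional k U] :
    ∃ n, 1 ≤ n ∧ U ≤ V ^ n := by
  obtain ⟨s, rfl⟩ := Module.Finite.iff_fg.1 (inferInstance : Module.Finite k U)
  choose n hn using exists_mem_pow_of_adjoin_eq_top hV1 hV
  refine ⟨s.sup n + 1, by omega, Submodule.span_le.2 fun v hv =>
    pow_right_mono₀ (Submodule.one_le.2 hV1) ?_ (hn v)⟩
  exact (Finset.le_sup (f := n) hv).trans (Nat.le_succ _)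

theorem exists_mul_eq_mul_of_growth [IsDomain A] [FiniteDimensional k V] (hV1 : (1 : A) ∈ V)
    (hV : Algebra.adjoin k (V : Set A) = ⊤) {C E : ℕ}
    (hgr : ∀ n, 1 ≤ n → Module.finrank k (V ^ n : Submodule k A) ≤ C * n ^ E) (a b : A)
    (hb : b ≠ 0) : ∃ a' b', b' ≠ 0 ∧ b' * a = a' * b := by
  rcases eq_or_ne a 0 with rfl | ha
  · exact ⟨0, 1, one_ne_zero, by simp⟩
  by_contra! hab
  have := FiniteDimensional.span_of_finite k (Set.toFinite {a, b})
  obtain ⟨q, hq, hle⟩ := exists_le_pow_of_adjoin_eq_top hV1 hV (Submodule.span k {a, b})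
  have haq : a ∈ V ^ q := hle (Submodule.subset_span (by simp))
  have hbq : b ∈ V ^ q := hle (Submodule.subset_span (by simp))
  have hmono := pow_right_mono₀ (Submodule.one_le.2 hV1)
  have hinj : ∀ c : A, c ≠ 0 → Function.Injective (LinearMap.mulRight k c) := fun c hc u v h =>
    mul_right_cancel₀ hc h
  have hstep : ∀ n, 2 * Module.finrank k (V ^ n : Submodule k A) ≤
      Module.finrank k (V ^ (n + q) : Submodule k A) := fun n => by
    have hdisj : Disjoint ((V ^ n).map (LinearMap.mulRight k a))
        ((V ^ n).map (LinearMap.mulRight k b)) := by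
      rw [Submodule.disjoint_def]
      rintro _ ⟨u, hu, rfl⟩ ⟨v, hv, huv⟩
      by_contra h0
      exact hab v u (fun h => h0 (by simp [h])) huv.symm
    have h1 := Submodule.finrank_sup_add_finrank_inf_eq ((V ^ n).map (LinearMap.mulRight k a))
      ((V ^ n).map (LinearMap.mulRight k b))
    rw [hdisj.eq_bot, finrank_bot, add_zero,
      ← (Submodule.equivMapOfInjective _ (hinj a ha) _).finrank_eq,
      ← (Submodule.equivMapOfInjective _ (hinj b hb) _).finrank_eq, ← two_mul] at h1
    rw [← h1]
    refine Submodule.finrank_mono (sup_le ?_ ?_)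
    · rintro _ ⟨u, hu, rfl⟩
      rw [pow_add]
      exact Submodule.mul_mem_mul hu haq
    · rintro _ ⟨u, hu, rfl⟩
      rw [pow_add]
      exact Submodule.mul_mem_mul hu hbq
  have hexp : ∀ i, 2 ^ i ≤ Module.finrank k (V ^ (i * q) : Submodule k A) := by
    intro i
    induction i with
    | zero =>
      rw [pow_zero, zero_mul, pow_zero, Submodule.one_eq_span, finrank_span_singleton one_ne_zero]
    | succ i ih =>
      rw [add_mul, one_mul, pow_succ']
      exact (Nat.mul_le_mul_left 2 ih).trans (hstep _)
  obtain ⟨i, hi⟩ := exists_mul_pow_lt_two_pow (C * q ^ E) 1 E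
  have h1 : Module.finrank k (V ^ (i * q) : Submodule k A) ≤
      Module.finrank k (V ^ ((i + 1) * q) : Submodule k A) :=
    Submodule.finrank_mono (hmono (show i * q ≤ (i + 1) * q by gcongr; omega))
  have h2 := hgr ((i + 1) * q) (Nat.mul_pos (by omega) hq)
  have h3 : C * ((i + 1) * q) ^ E = C * q ^ E * (i + 1) ^ E := by rw [mul_pow]; ring
  have := hexp i
  omega

end Generation

section LocallyNilpotent

variable {k A : Type*} [Field k] [Ring A] [Algebra k A] {δ : A →ₗ[k] A}

theorem IsLocallyNilpotent.exists_slice (hln : IsLocallyNilpotent δ) (hδ0 : δ ≠ 0) :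
    ∃ x, δ x ≠ 0 ∧ δ (δ x) = 0 := by
  obtain ⟨v, hv⟩ : ∃ v, δ v ≠ 0 := by
    by_contra! h
    exact hδ0 (LinearMap.ext h)
  by_contra! h
  have : ∀ n, (δ ^ (n + 1)) v ≠ 0 := by
    intro n
    induction n with
    | zero => simpa using hv
    | succ n ih =>
      rw [pow_succ', Module.End.mul_apply] at ih ⊢
      rw [pow_succ', Module.End.mul_apply]
      exact h _ ih
  obtain ⟨n, hn⟩ := hln v
  exact this n (Module.End.pow_apply_eq_zero_of_le (Nat.le_succ n) hn)

theorem IsLocallyNilpotent.exists_le_ker_pow (hln : IsLocallyNilpotent δ) (U : Submodule k A)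
    [FiniteDimensional k U] : ∃ d, U ≤ LinearMap.ker (δ ^ (d + 1)) := by
  obtain ⟨s, rfl⟩ := Module.Finite.iff_fg.1 (inferInstance : Module.Finite k U)
  choose n hn using hln
  exact ⟨s.sup n, Submodule.span_le.2 fun v hv => Module.End.pow_apply_eq_zero_of_le
    ((Finset.le_sup (f := n) hv).trans (Nat.le_succ _)) (hn v)⟩

theorem IsLocallyNilpotent.exists_stable (hln : IsLocallyNilpotent δ) (U : Submodule k A)
    [FiniteDimensional k U] : ∃ W : Submodule k A, FiniteDimensional k W ∧ U ≤ W ∧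
      (∀ w ∈ W, δ w ∈ W) ∧ ∃ d, W ≤ LinearMap.ker (δ ^ (d + 1)) := by
  obtain ⟨d, hd⟩ := hln.exists_le_ker_pow U
  refine ⟨⨆ i : Fin (d + 1), U.map (δ ^ (i : ℕ)), Submodule.finiteDimensional_iSup _, ?_, ?_, d, ?_⟩
  · refine le_iSup_of_le (0 : Fin (d + 1)) ?_
    rw [Fin.val_zero, pow_zero, Module.End.one_eq_id, Submodule.map_id]
  · suffices (⨆ i : Fin (d + 1), U.map (δ ^ (i : ℕ))) ≤
        (⨆ i : Fin (d + 1), U.map (δ ^ (i : ℕ))).comap δ from fun w hw => this hw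
    refine iSup_le fun i => ?_
    rintro _ ⟨u, hu, rfl⟩
    rw [Submodule.mem_comap, ← Module.End.mul_apply, ← pow_succ']
    rcases Nat.lt_or_ge (i + 1) (d + 1) with hi | hi
    · exact Submodule.mem_iSup_of_mem (⟨i + 1, hi⟩ : Fin (d + 1)) ⟨u, hu, rfl⟩
    · rw [Module.End.pow_apply_eq_zero_of_le hi (hd hu)]
      exact Submodule.zero_mem _
  · refine iSup_le fun i => ?_
    rintro _ ⟨u, hu, rfl⟩
    rw [LinearMap.mem_ker, ← Module.End.mul_apply, ← pow_add]
    exact Module.End.pow_apply_eq_zero_of_le (by omega) (hd hu)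

theorem exists_transcendental_of_growth [IsAlgClosed k] [IsDomain A] (hδ : IsDerivation δ)
    (hln : IsLocallyNilpotent δ) {V : Submodule k A} [FiniteDimensional k V]
    (hgr : ∀ C, ∃ n, 1 ≤ n ∧ C * n < Module.finrank k (V ^ n : Submodule k A)) :
    ∃ a, Transcendental k a ∧ δ a = 0 := by
  by_contra! h
  have h1 : LinearMap.ker δ ≤ Submodule.span k {(1 : A)} := fun a ha => by
    obtain ⟨r, rfl⟩ := mem_range_algebraMap_of_isAlgebraic (k := k) (z := a)
      (by_contra fun h0 => h a h0 ha)
    exact Submodule.mem_span_singleton.2 ⟨r, (Algebra.algebraMap_eq_smul_one r).symm⟩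
  have := FiniteDimensional.span_of_finite k (Set.finite_singleton (1 : A))
  have : FiniteDimensional k (LinearMap.ker δ) := Submodule.finiteDimensional_of_le h1
  have h2 : Module.finrank k (LinearMap.ker δ) ≤ 1 :=
    (Submodule.finrank_mono h1).trans (finrank_span_singleton one_ne_zero).le
  obtain ⟨d, hd⟩ := hln.exists_le_ker_pow V
  obtain ⟨n, hn, hC⟩ := hgr (d + 1)
  obtain ⟨h3, h4⟩ := finrank_ker_pow_le (f := δ) (d * n + 1)
  have h5 := Submodule.finrank_mono (hδ.pow_le_ker hd n)
  nlinarith [Nat.mul_le_mul_left (d * n + 1) h2]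

theorem finrank_map_pow {B : Type*} [Ring B] [Algebra k B] {ι : A →ₐ[k] B}
    (hι : Function.Injective ι) (W : Submodule k A) (n : ℕ) :
    Module.finrank k ((W.map ι.toLinearMap) ^ n : Submodule k B) =
      Module.finrank k (W ^ n : Submodule k A) := by
  rw [← Submodule.map_pow]
  exact (Submodule.equivMapOfInjective _ hι _).finrank_eq.symm

end LocallyNilpotent

/-- Let `k` be an algebraically closed field of characteristic `0` and
let `A` be a finitely generated `k`-algebra that is a domain, with a finite-dimensional
generating subspace `V ∋ 1` satisfying `2 ≤ limsup_n log(dim V^n)/log n < 3`.  If `A` has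
a nonzero locally nilpotent `k`-derivation, then `A` has quadratic growth: there are a
finite-dimensional generating subspace `W ∋ 1` and constants `C₁, C₂ > 0` with
`C₁ n² < dim W^n < C₂ n²` for all `n ≥ 1`. -/
theorem quadratic_growth_of_locally_nilpotent_derivation
    (k A : Type*) [Field k] [IsAlgClosed k] [CharZero k]
    [Ring A] [IsDomain A] [Algebra k A]
    (V : Submodule k A) (hVfd : FiniteDimensional k V) (hV1 : (1 : A) ∈ V)
    (hVgen : Algebra.adjoin k (V : Set A) = ⊤)
    (hlow : 2 ≤ Filter.limsup
      (fun n : ℕ => Real.log (Module.finrank k ↥(V ^ n)) / Real.log n) Filter.atTop)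
    (hhigh : Filter.limsup
      (fun n : ℕ => Real.log (Module.finrank k ↥(V ^ n)) / Real.log n) Filter.atTop < 3)
    (δ : A →ₗ[k] A) (hδ : IsDerivation δ) (hδ0 : δ ≠ 0) (hln : IsLocallyNilpotent δ) :
    ∃ W : Submodule k A, FiniteDimensional k W ∧ (1 : A) ∈ W ∧
      Algebra.adjoin k (W : Set A) = ⊤ ∧
      ∃ C₁ C₂ : ℝ, 0 < C₁ ∧ 0 < C₂ ∧ ∀ n : ℕ, 1 ≤ n →
        C₁ * (n : ℝ) ^ 2 < (Module.finrank k ↥(W ^ n) : ℝ) ∧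
        (Module.finrank k ↥(W ^ n) : ℝ) < C₂ * (n : ℝ) ^ 2 := by
  have hmono : Monotone fun n => Module.finrank k (V ^ n : Submodule k A) := fun m n hmn =>
    Submodule.finrank_mono (pow_right_mono₀ (Submodule.one_le.2 hV1) hmn)
  have hpos : ∀ n, 1 ≤ Module.finrank k (V ^ n : Submodule k A) := fun n => by
    have h1 := hmono (Nat.zero_le n)
    dsimp only at h1
    rwa [pow_zero, Submodule.one_eq_span, finrank_span_singleton one_ne_zero] at h1
  obtain ⟨p, hp, N, hN⟩ := exists_pow_le_pow_of_limsup_lt_three hlow hhigh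
  obtain ⟨C, hC⟩ : ∃ C, ∀ n, 1 ≤ n →
      Module.finrank k (V ^ n : Submodule k A) ^ p ≤ C * n ^ (3 * p - 1) := by
    refine ⟨Module.finrank k (V ^ N : Submodule k A) ^ p + 1, fun n hn => ?_⟩
    have hn1 : 1 ≤ n ^ (3 * p - 1) := Nat.one_le_pow _ _ hn
    rcases le_total N n with h | h
    · exact (hN n h).trans (Nat.le_mul_of_pos_left _ (by omega))
    · exact (Nat.pow_le_pow_left (hmono h) p).trans
        ((Nat.le_succ _).trans (Nat.le_mul_of_pos_right _ hn1))
  obtain ⟨Q, _, _, ι, D, hι, hD, hDι⟩ := hδ.exists_extend_divisionRing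
    (exists_mul_eq_mul_of_growth hV1 hVgen (C := C) (E := 3 * p - 1) fun n hn =>
      (Nat.le_self_pow (by omega) _).trans (hC n hn))
  obtain ⟨x, hx0, hx⟩ := hln.exists_slice hδ0
  obtain ⟨a, ha, hδa⟩ := exists_transcendental_of_growth hδ hln
    (exists_mul_lt_of_two_le_limsup hpos hlow)
  have := FiniteDimensional.span_of_finite k (Set.toFinite {a, x})
  obtain ⟨W, hWfd, hUW, hWδ, d, hWd⟩ := hln.exists_stable (V ⊔ Submodule.span k {a, x})
  have hVW : V ≤ W := le_sup_left.trans hUW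
  have hWspan : Submodule.span k {a, x} ≤ W := le_sup_right.trans hUW
  have haW : a ∈ W := hWspan (Submodule.subset_span (by simp))
  have hxW : x ∈ W := hWspan (Submodule.subset_span (by simp))
  obtain ⟨q, hq, hWq⟩ := exists_le_pow_of_adjoin_eq_top hV1 hVgen W
  have hDpow : ∀ (i : ℕ) (v : A), (D ^ i) (ι v) = ι ((δ ^ i) v) := fun i v => by
    induction i with
    | zero => rfl
    | succ i ih => rw [pow_succ', pow_succ', Module.End.mul_apply, Module.End.mul_apply, ih, hDι]
  have hWgr : ∀ n, 1 ≤ n → Module.finrank k (W ^ (3 * n) : Submodule k A) ^ p ≤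
      C * (3 * q) ^ (3 * p - 1) * n ^ (3 * p - 1) := fun n hn => by
    have h1 : Module.finrank k (W ^ (3 * n) : Submodule k A) ≤
        Module.finrank k (V ^ (q * (3 * n)) : Submodule k A) := by
      refine Submodule.finrank_mono ?_
      rw [pow_mul V]
      exact pow_le_pow_left' hWq _
    refine (Nat.pow_le_pow_left h1 p).trans ((hC _ (Nat.mul_pos hq (by omega))).trans_eq ?_)
    rw [mul_assoc, ← mul_pow]
    congr 2
    ring
  obtain ⟨hlower, B, hB⟩ := exists_finrank_pow_quadratic hD (W := W.map ι.toLinearMap)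
    ⟨1, hVW hV1, map_one ι⟩ (by rintro _ ⟨w, hw, rfl⟩; exact ⟨_, hWδ w hw, (hDι w).symm⟩) (d := d)
    (by
      rintro _ ⟨w, hw, rfl⟩
      exact (hDpow _ w).trans ((congrArg ι (hWd hw)).trans (map_zero ι)))
    (a := ι a) (c := ι (δ x)) (x := ι x) (fun h => hx0 (hι (h.trans (map_zero ι).symm)))
    ⟨_, hWδ x hxW, rfl⟩ ⟨x, hxW, rfl⟩ (by rw [hDι, hx, map_zero]) (hDι x)
    (fun h => ha ((isAlgebraic_algHom_iff ι hι).1 h)) ⟨a, haW, rfl⟩ (by rw [hDι, hδa, map_zero]) hp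
    (fun n hn => by rw [finrank_map_pow hι]; exact hWgr n hn)
  simp only [finrank_map_pow hι] at hlower hB
  refine ⟨W, hWfd, hVW hV1, top_le_iff.1 (hVgen ▸ Algebra.adjoin_mono hVW), 1 / 4, B + 1,
    by norm_num, by positivity, fun n hn => ⟨?_, ?_⟩⟩
  · have h1 : Module.finrank k (W ^ (n / 2 + n / 2) : Submodule k A) ≤
        Module.finrank k (W ^ n : Submodule k A) :=
      Submodule.finrank_mono (pow_right_mono₀ (Submodule.one_le.2 (hVW hV1)) (by omega))
    have h2 : ((n / 2 : ℕ) + 1 : ℝ) ^ 2 ≤ Module.finrank k (W ^ n : Submodule k A) := by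
      exact_mod_cast (hlower (n / 2)).trans h1
    have h3 : (n : ℝ) < 2 * ((n / 2 : ℕ) + 1) := by
      exact_mod_cast (show n < 2 * (n / 2 + 1) by omega)
    nlinarith [Nat.cast_nonneg (α := ℝ) n]
  · have h1 : (Module.finrank k (W ^ n : Submodule k A) : ℝ) ≤ B * (n : ℝ) ^ 2 := by
      exact_mod_cast hB n hn
    have h2 : (0 : ℝ) < (n : ℝ) ^ 2 := by positivity
    linarith
end
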